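/- Let 2 < p, q, r' < ∞ be exponents with 1/r = 1/p + 1/q (so r' = r/(r−1)). Let θ₁, θ₂ ∈ (−π/2, π/2) ∖ {0, −π/4} with θ₁ ≠ θ₂. Let (a_n), (b_n), (c_n), (d_n) be real sequences satisfying a_n < b_n ≤ a_{n+1} and c_n < d_n ≤ c_{n+1} for all n ∈ ℤ, with b_n − a_n, a_{n+1} − b_n, d_n − c_n and c_{n+1} − d_n all independent of n. For n, m ∈ ℤ define the parallelogram C_{n,m} = { (ξ₁,ξ₂) ∈ ℝ² : a_n ≤ ξ₂ − tan(θ₁)ξ₁ ≤ b_n and c_m ≤ ξ₂ − tan(θ₂)ξ₁ ≤ d_m }. Then there exists a constant C depending only on p, q, r, θ₁, θ₂ such that for all Schwartz functions f, g on ℝ, ‖ ( Σ_{n,m∈ℤ} |Π_{C_{n,m}}(f,g)|² )^{1/2} ‖_{L^r(ℝ)} ≤ C ‖f‖_{L^p(ℝ)} ‖g‖_{L^q(ℝ)}. -/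

import Mathlib

open MeasureTheory Real Set
open scoped ENNReal

/-- The Fourier transform `f̂(ξ) = ∫ f(t) e^{-2πitξ} dt`. -/
noncomputable def FT (f : ℝ → ℂ) (ξ : ℝ) : ℂ :=
  ∫ t : ℝ, Complex.exp (((-2 * Real.pi * t * ξ : ℝ) : ℂ) * Complex.I) * f t

/-- The bilinear multiplier with a planar symbol:
`Π_B(f,g)(x) = ∫∫ e^{2πix(ξ₁+ξ₂)} f̂(ξ₁) ĝ(ξ₂) 1_B(ξ₁,ξ₂) dξ₁ dξ₂`. -/
noncomputable def biMul2 (B : Set (ℝ × ℝ)) (f g : ℝ → ℂ) (x : ℝ) : ℂ :=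
  ∫ ξ : ℝ × ℝ, Complex.exp (((2 * Real.pi * x * (ξ.1 + ξ.2) : ℝ) : ℂ) * Complex.I) *
    FT f ξ.1 * FT g ξ.2 * B.indicator 1 ξ

/-- The parallelogram
`{(ξ₁,ξ₂) : a ≤ ξ₂ - tan θ₁ ξ₁ ≤ b, c ≤ ξ₂ - tan θ₂ ξ₁ ≤ d}`. -/
def parallelogram (θ₁ θ₂ a b c d : ℝ) : Set (ℝ × ℝ) :=
  {ξ : ℝ × ℝ | a ≤ ξ.2 - Real.tan θ₁ * ξ.1 ∧ ξ.2 - Real.tan θ₁ * ξ.1 ≤ b ∧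
    c ≤ ξ.2 - Real.tan θ₂ * ξ.1 ∧ ξ.2 - Real.tan θ₂ * ξ.1 ≤ d}

/-! ### Elementary weighted sums over the integers -/

/-- The summable weight `(1 + x²)⁻¹`. -/
noncomputable def bump (x : ℝ) : ℝ := (1 + x ^ 2)⁻¹

/-- The total mass of `bump` over the integers. -/
noncomputable def bumpMass : ℝ := ∑' n : ℤ, bump n

lemma bump_pos (x : ℝ) : 0 < bump x := by unfold bump; positivity

lemma bump_le_one (x : ℝ) : bump x ≤ 1 := by
  unfold bump
  exact inv_le_one_of_one_le₀ (by nlinarith [sq_nonneg x])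

lemma bump_neg (x : ℝ) : bump (-x) = bump x := by simp [bump]

lemma bump_sq_le (x : ℝ) : bump x ^ 2 ≤ bump x := by
  nlinarith [bump_pos x, bump_le_one x]

lemma summable_bump_int : Summable fun n : ℤ => bump n := by
  have h : Summable fun n : ℤ => 1 / (n : ℝ) ^ 2 :=
    Real.summable_one_div_int_pow.mpr (by norm_num)
  refine Summable.of_norm_bounded_eventually (g := fun n : ℤ => 1 / (n : ℝ) ^ 2) h ?_
  have : ∀ᶠ n : ℤ in Filter.cofinite, n ≠ 0 :=
    (Set.finite_singleton (0 : ℤ)).subset fun n hn => by simpa using hn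
  filter_upwards [this] with n hn
  rw [Real.norm_of_nonneg (bump_pos _).le, bump, ← one_div]
  have : (0 : ℝ) < (n : ℝ) ^ 2 := by positivity
  exact one_div_le_one_div_of_le this (by linarith)

lemma bumpMass_pos : 0 < bumpMass :=
  summable_bump_int.tsum_pos (fun _ => (bump_pos _).le) 0 (bump_pos _)

lemma sum_bump_le (s : Finset ℤ) : ∑ n ∈ s, bump n ≤ bumpMass :=
  summable_bump_int.sum_le_tsum s (fun _ _ => (bump_pos _).le)

lemma sum_bump_sub_le (s : Finset ℤ) (a : ℤ) :
    ∑ n ∈ s, bump ((a : ℝ) - n) ≤ bumpMass := by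
  have h : ∑ n ∈ s.image (fun n => a - n), bump n = ∑ n ∈ s, bump ((a : ℝ) - n) := by
    rw [Finset.sum_image (fun x _ y _ h => by simpa using h)]
    simp
  rw [← h]; exact sum_bump_le _

/-- The weight `(1 + x²)⁻²`. -/
noncomputable def wt (x : ℝ) : ℝ := bump x ^ 2

lemma wt_pos (x : ℝ) : 0 < wt x := pow_pos (bump_pos x) 2

lemma wt_neg (x : ℝ) : wt (-x) = wt x := by simp [wt, bump_neg]

lemma wt_add_le {a b : ℝ} (hab : 0 ≤ a * b) : wt (a + b) ≤ bump a * bump b := by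
  unfold wt bump
  rw [← mul_inv, inv_pow]
  apply inv_anti₀ (by positivity)
  nlinarith [sq_nonneg a, sq_nonneg b, sq_nonneg (a * b), mul_nonneg (sq_nonneg a) (sq_nonneg b),
    mul_nonneg hab (sq_nonneg a), mul_nonneg hab (sq_nonneg b), sq_nonneg (a+b)]

lemma sum_wt_sub_le (s : Finset ℤ) (a : ℤ) : ∑ n ∈ s, wt ((a : ℝ) - n) ≤ bumpMass :=
  (Finset.sum_le_sum fun n _ => bump_sq_le _).trans (sum_bump_sub_le s a)

/-- Interaction of an interval of integers with its complement. -/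
lemma sum_wt_interval_compl_le (X Y : Finset ℤ) (a b : ℤ)
    (hX : ∀ i ∈ X, a ≤ i ∧ i < b) (hY : ∀ y ∈ Y, y < a ∨ b ≤ y) :
    ∑ i ∈ X, ∑ y ∈ Y, wt ((i : ℝ) - y) ≤ 2 * bumpMass ^ 2 := by
  have key : ∀ i ∈ X, ∀ y ∈ Y, wt ((i : ℝ) - y) ≤
      bump ((a : ℝ) - i) * bump ((a : ℝ) - y) + bump ((b : ℝ) - i) * bump ((b : ℝ) - y) := by
    intro i hi y hy
    obtain ⟨h1, h2⟩ := hX i hi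
    have h1' : (a : ℝ) ≤ i := by exact_mod_cast h1
    have h2' : (i : ℝ) ≤ b := by exact_mod_cast h2.le
    rcases hY y hy with h | h
    · have h' : (y : ℝ) ≤ a := by exact_mod_cast h.le
      have := wt_add_le (a := (i : ℝ) - a) (b := (a : ℝ) - y)
        (mul_nonneg (by linarith) (by linarith))
      have e : ((i : ℝ) - a) + (a - y) = i - y := by ring
      rw [e, ← bump_neg ((i : ℝ) - a), neg_sub] at this
      have := mul_pos (bump_pos ((b : ℝ) - i)) (bump_pos ((b : ℝ) - y))
      linarith
    · have h' : (b : ℝ) ≤ y := by exact_mod_cast h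
      have := wt_add_le (a := (b : ℝ) - i) (b := (y : ℝ) - b)
        (mul_nonneg (by linarith) (by linarith))
      have e : ((b : ℝ) - i) + (y - b) = -(i - y) := by ring
      rw [e, wt_neg, ← bump_neg ((y : ℝ) - b), neg_sub] at this
      have := mul_pos (bump_pos ((a : ℝ) - i)) (bump_pos ((a : ℝ) - y))
      linarith
  calc ∑ i ∈ X, ∑ y ∈ Y, wt ((i : ℝ) - y)
      ≤ ∑ i ∈ X, ∑ y ∈ Y, (bump ((a : ℝ) - i) * bump ((a : ℝ) - y)
          + bump ((b : ℝ) - i) * bump ((b : ℝ) - y)) :=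
        Finset.sum_le_sum fun i hi => Finset.sum_le_sum fun y hy => key i hi y hy
    _ = (∑ i ∈ X, bump ((a : ℝ) - i)) * (∑ y ∈ Y, bump ((a : ℝ) - y))
        + (∑ i ∈ X, bump ((b : ℝ) - i)) * (∑ y ∈ Y, bump ((b : ℝ) - y)) := by
        rw [Finset.sum_mul_sum, Finset.sum_mul_sum, ← Finset.sum_add_distrib]
        exact Finset.sum_congr rfl fun i _ => Finset.sum_add_distrib
    _ ≤ bumpMass * bumpMass + bumpMass * bumpMass := by
        have n1 : ∀ (s : Finset ℤ) (c : ℤ), 0 ≤ ∑ i ∈ s, bump ((c : ℝ) - i) :=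
          fun s c => Finset.sum_nonneg fun i _ => (bump_pos _).le
        exact add_le_add
          (mul_le_mul (sum_bump_sub_le X a) (sum_bump_sub_le Y a) (n1 _ _) bumpMass_pos.le)
          (mul_le_mul (sum_bump_sub_le X b) (sum_bump_sub_le Y b) (n1 _ _) bumpMass_pos.le)
    _ = 2 * bumpMass ^ 2 := by ring

lemma card_le_of_abs_sub_le (s : Finset ℤ) (c l : ℝ) (hl : 0 ≤ l)
    (h : ∀ z ∈ s, |(z : ℝ) - c| ≤ l) : (s.card : ℝ) ≤ 2 * l + 1 := by
  have hsub : s ⊆ Finset.Icc ⌈c - l⌉ ⌊c + l⌋ := by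
    intro z hz
    have := abs_le.mp (h z hz)
    rw [Finset.mem_Icc]
    exact ⟨Int.ceil_le.mpr (by linarith), Int.le_floor.mpr (by linarith)⟩
  have h1 := Finset.card_le_card hsub
  rw [Int.card_Icc] at h1
  have h2 : (s.card : ℝ) ≤ ((⌊c + l⌋ + 1 - ⌈c - l⌉).toNat : ℝ) := by exact_mod_cast h1
  refine h2.trans ?_
  have h3 : (((⌊c + l⌋ + 1 - ⌈c - l⌉).toNat : ℤ) : ℝ) =
      ((max (⌊c + l⌋ + 1 - ⌈c - l⌉) 0 : ℤ) : ℝ) := by rw [Int.toNat_eq_max]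
  rw [← Int.cast_natCast, h3, Int.cast_max, Int.cast_zero]
  refine max_le ?_ (by linarith)
  push_cast
  linarith [Int.floor_le (c + l), Int.le_ceil (c - l)]

/-- The integers in a block. -/
lemma ediv_pow_eq_iff (x i : ℤ) (m : ℕ) :
    x / 2 ^ m = i ↔ i * 2 ^ m ≤ x ∧ x < (i + 1) * 2 ^ m := by
  have h : (0 : ℤ) < 2 ^ m := by positivity
  constructor
  · rintro rfl
    exact ⟨Int.ediv_mul_le _ h.ne', Int.lt_ediv_add_one_mul_self _ h⟩
  · rintro ⟨h1, h2⟩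
    apply le_antisymm
    · exact Int.lt_add_one_iff.mp (Int.ediv_lt_of_lt_mul h h2)
    · exact Int.le_ediv_of_mul_le h h1

/-- The finite set of integers in a dyadic block. -/
noncomputable def block (m : ℕ) (i : ℤ) : Finset ℤ := Finset.Ico (i * 2 ^ m) ((i + 1) * 2 ^ m)

lemma mem_block {m : ℕ} {i x : ℤ} : x ∈ block m i ↔ x / 2 ^ m = i := by
  rw [block, Finset.mem_Ico, ediv_pow_eq_iff]

lemma card_block (m : ℕ) (i : ℤ) : ((block m i).card : ℝ) = 2 ^ m := by
  have : ((i + 1) * 2 ^ m - i * 2 ^ m : ℤ) = ((2 ^ m : ℕ) : ℤ) := by push_cast; ring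
  rw [block, Int.card_Ico, this, Int.toNat_natCast]
  simp

lemma ediv_pow_ediv_pow (x : ℤ) (m n : ℕ) : x / 2 ^ m / 2 ^ n = x / 2 ^ (m + n) := by
  rw [pow_add, Int.ediv_ediv_of_nonneg (by positivity)]

lemma sum_ediv_pow_le (s : Finset ℤ) (m : ℕ) (g : ℤ → ℝ) (hg : ∀ i, 0 ≤ g i) :
    ∑ x ∈ s, g (x / 2 ^ m) ≤ 2 ^ m * ∑ i ∈ s.image (fun x => x / 2 ^ m), g i := by
  rw [Finset.mul_sum,
    ← Finset.sum_fiberwise_of_maps_to (t := s.image (fun x => x / 2 ^ m))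
      (g := fun x : ℤ => x / 2 ^ m) (fun x hx => Finset.mem_image_of_mem _ hx)]
  refine Finset.sum_le_sum fun i _ => ?_
  have h1 : ∑ x ∈ s.filter (fun x => x / 2 ^ m = i), g (x / 2 ^ m)
      = ((s.filter (fun x => x / 2 ^ m = i)).card : ℝ) * g i := by
    rw [Finset.sum_congr rfl (g := fun _ => g i), Finset.sum_const, nsmul_eq_mul]
    intro x hx
    rw [(Finset.mem_filter.mp hx).2]
  rw [h1]
  refine mul_le_mul_of_nonneg_right ?_ (hg i)
  rw [← card_block m i]
  exact_mod_cast Finset.card_le_card fun x hx => mem_block.mpr (Finset.mem_filter.mp hx).2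

/-! ### Tiles, trees and the interaction kernel -/

/-- A tile: the time interval `[pos * 2 ^ scale, (pos + 1) * 2 ^ scale)` and the frequency cell
numbered `freq` at resolution `2 ^ (-scale)`. -/
@[ext] structure Tile where
  scale : ℕ
  pos : ℤ
  freq : ℤ

/-- A tree top: a dyadic interval and a frequency. -/
structure TreeTop where
  scale : ℕ
  pos : ℤ
  freq : ℝ

noncomputable instance : DecidableEq Tile := Classical.decEq _

namespace Tile

/-- The length of the time interval. -/
noncomputable def len (P : Tile) : ℝ := 2 ^ P.scale

lemma len_pos (P : Tile) : 0 < P.len := by unfold len; positivity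

/-- The time interval of `P` is contained in the dyadic interval `(j, i)`. -/
def Below (j : ℕ) (i : ℤ) (P : Tile) : Prop := P.scale ≤ j ∧ P.pos / 2 ^ (j - P.scale) = i

/-- `P` belongs to the tree with top `T`. -/
def InTree (A : ℝ) (T : TreeTop) (P : Tile) : Prop :=
  Below T.scale T.pos P ∧ |(P.freq : ℝ) - P.len * T.freq| ≤ A

/-- The frequency cells of two tiles, shifted by `d`, are close at the coarser resolution. -/
def Near (B d : ℝ) (P P' : Tile) : Prop :=
  |((P.freq : ℝ) + d) * P'.len - ((P'.freq : ℝ) + d) * P.len| ≤ B * max P.len P'.len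

lemma Near.symm {B d : ℝ} {P P' : Tile} (h : Near B d P P') : Near B d P' P := by
  unfold Near at *; rwa [abs_sub_comm, max_comm]

/-- The spatial interaction of two tiles. -/
noncomputable def kern (P P' : Tile) : ℝ :=
  if P'.scale ≤ P.scale then
    P.len⁻¹ * wt ((P.pos : ℝ) - ((P'.pos / 2 ^ (P.scale - P'.scale) : ℤ) : ℝ))
  else P'.len⁻¹ * wt ((P'.pos : ℝ) - ((P.pos / 2 ^ (P'.scale - P.scale) : ℤ) : ℝ))

lemma kern_pos (P P' : Tile) : 0 < kern P P' := by
  unfold kern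
  split_ifs <;> exact mul_pos (inv_pos.mpr (len_pos _)) (wt_pos _)

lemma kern_comm (P P' : Tile) : kern P P' = kern P' P := by
  unfold kern
  rcases lt_trichotomy P.scale P'.scale with h | h | h
  · simp [h.le, not_le.mpr h]
  · simp only [h, le_refl, if_true, Nat.sub_self, pow_zero, Int.ediv_one]
    rw [← wt_neg, neg_sub, len, len, h]
  · simp [h.le, not_le.mpr h]

lemma len_mul_pow_sub {P P' : Tile} (h : P'.scale ≤ P.scale) :
    P'.len * 2 ^ (P.scale - P'.scale) = P.len := by
  rw [len, len, ← pow_add, Nat.add_sub_cancel' h]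

lemma Near.abs_sub_le {B d : ℝ} {P P' : Tile} (h : Near B d P P')
    (hs : P'.scale ≤ P.scale) :
    |((P'.freq : ℝ) + d) - ((P.freq : ℝ) + d) * (P'.len / P.len)| ≤ B := by
  unfold Near at h
  have hl : P'.len ≤ P.len := pow_le_pow_right₀ (by norm_num) hs
  rw [max_eq_left hl] at h
  have hp := P.len_pos
  have e : ((P'.freq : ℝ) + d) - ((P.freq : ℝ) + d) * (P'.len / P.len)
      = -((((P.freq : ℝ) + d) * P'.len - ((P'.freq : ℝ) + d) * P.len) / P.len) := by
    field_simp; ring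
  rw [e, abs_neg, abs_div, abs_of_pos hp, div_le_iff₀ hp]
  exact h

lemma sum_pos_le (W : Finset Tile) (s : ℕ) (c l : ℝ) (hl : 0 ≤ l)
    (hs : ∀ P ∈ W, P.scale = s) (hz : ∀ P ∈ W, |(P.freq : ℝ) - c| ≤ l)
    (g : ℤ → ℝ) (hg : ∀ i, 0 ≤ g i) :
    ∑ P ∈ W, g P.pos ≤ (2 * l + 1) * ∑ i ∈ W.image Tile.pos, g i := by
  rw [Finset.mul_sum, ← Finset.sum_fiberwise_of_maps_to (t := W.image Tile.pos)
      (g := Tile.pos) (fun x hx => Finset.mem_image_of_mem _ hx)]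
  refine Finset.sum_le_sum fun i _ => ?_
  have h1 : ∑ P ∈ W.filter (fun P => P.pos = i), g P.pos
      = ((W.filter (fun P => P.pos = i)).card : ℝ) * g i := by
    rw [Finset.sum_congr rfl (g := fun _ => g i), Finset.sum_const, nsmul_eq_mul]
    intro x hx
    rw [(Finset.mem_filter.mp hx).2]
  rw [h1]
  refine mul_le_mul_of_nonneg_right ?_ (hg i)
  have hinj : Set.InjOn Tile.freq (W.filter (fun P => P.pos = i) : Finset Tile) := by
    intro P hP P' hP' h
    simp only [Finset.coe_filter, Set.mem_ofPred_eq] at hP hP'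
    ext1
    · rw [hs P hP.1, hs P' hP'.1]
    · rw [hP.2, hP'.2]
    · exact h
  rw [← Finset.card_image_of_injOn hinj]
  refine card_le_of_abs_sub_le _ c l hl fun z hzz => ?_
  obtain ⟨P, hP, rfl⟩ := Finset.mem_image.mp hzz
  exact hz P (Finset.mem_filter.mp hP).1

lemma card_fibre_le (W : Finset Tile) (s : ℕ) (i : ℤ) (c l : ℝ) (hl : 0 ≤ l)
    (hs : ∀ P ∈ W, P.scale = s) (hi : ∀ P ∈ W, P.pos = i)
    (hz : ∀ P ∈ W, |(P.freq : ℝ) - c| ≤ l) :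
    (W.card : ℝ) ≤ 2 * l + 1 := by
  have h := sum_pos_le W s c l hl hs hz (fun _ => 1) (fun _ => zero_le_one)
  have h2 : (W.image Tile.pos).card ≤ 1 := by
    refine Finset.card_le_one.mpr fun a ha b hb => ?_
    obtain ⟨P, hP, rfl⟩ := Finset.mem_image.mp ha
    obtain ⟨P', hP', rfl⟩ := Finset.mem_image.mp hb
    rw [hi P hP, hi P' hP']
  have h3 : ((W.image Tile.pos).card : ℝ) ≤ 1 := by exact_mod_cast h2
  simp only [Finset.sum_const, nsmul_eq_mul, mul_one] at h
  nlinarith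

/-- Row sums of the kernel over tiles at one scale. -/
lemma sum_len_mul_kern_le (P : Tile) (W : Finset Tile) (s : ℕ) (c l : ℝ) (hl : 0 ≤ l)
    (hs : ∀ P' ∈ W, P'.scale = s) (hz : ∀ P' ∈ W, |(P'.freq : ℝ) - c| ≤ l) :
    ∑ P' ∈ W, P'.len * kern P P' ≤ (2 * l + 1) * bumpMass := by
  have hl' : 0 ≤ 2 * l + 1 := by linarith
  rcases le_or_gt s P.scale with h | h
  · have e : ∀ P' ∈ W, P'.len * kern P P' = (2 ^ (P.scale - s))⁻¹ *
        wt ((P.pos : ℝ) - ((P'.pos / 2 ^ (P.scale - s) : ℤ) : ℝ)) := by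
      intro P' hP'
      have h1 := hs P' hP'
      rw [kern, if_pos (h1 ▸ h), ← mul_assoc, h1, ← len_mul_pow_sub (h1 ▸ h : P'.scale ≤ P.scale),
        h1]
      have := P'.len_pos
      congr 1
      field_simp
    rw [Finset.sum_congr rfl e, ← Finset.mul_sum]
    have h1 := sum_pos_le W s c l hl hs hz
      (fun i => wt ((P.pos : ℝ) - ((i / 2 ^ (P.scale - s) : ℤ) : ℝ))) (fun i => (wt_pos _).le)
    have h2 := sum_ediv_pow_le (W.image Tile.pos) (P.scale - s)
      (fun i => wt ((P.pos : ℝ) - i)) (fun i => (wt_pos _).le)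
    have h3 := sum_wt_sub_le ((W.image Tile.pos).image (fun x => x / 2 ^ (P.scale - s))) P.pos
    have hp : (0 : ℝ) < 2 ^ (P.scale - s) := by positivity
    rw [inv_mul_le_iff₀ hp]
    calc _ ≤ _ := h1
      _ ≤ (2 * l + 1) * (2 ^ (P.scale - s) * bumpMass) := by gcongr; exact h2.trans (by gcongr)
      _ = _ := by ring
  · have e : ∀ P' ∈ W, P'.len * kern P P' =
        wt (((P.pos / 2 ^ (s - P.scale) : ℤ) : ℝ) - (P'.pos : ℝ)) := by
      intro P' hP'
      have h1 := hs P' hP'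
      rw [kern, if_neg (by rw [h1]; exact not_le.mpr h), ← mul_assoc,
        mul_inv_cancel₀ P'.len_pos.ne', one_mul, h1, ← wt_neg, neg_sub]
    rw [Finset.sum_congr rfl e]
    refine (sum_pos_le W s c l hl hs hz
      (fun i => wt (((P.pos / 2 ^ (s - P.scale) : ℤ) : ℝ) - i)) (fun i => (wt_pos _).le)).trans ?_
    gcongr
    exact sum_wt_sub_le _ _

open scoped Classical in
/-- Row sums of the kernel over nearby tiles at comparable scales. -/
lemma sum_near_scale_le {B d : ℝ} (hB : 0 ≤ B) (J : ℕ) (P : Tile) (W : Finset Tile)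
    (hn : ∀ P' ∈ W, Near B d P P')
    (h1 : ∀ P' ∈ W, P'.scale ≤ P.scale + J) (h2 : ∀ P' ∈ W, P.scale ≤ P'.scale + J) :
    ∑ P' ∈ W, P'.len * kern P P' ≤ (2 * J + 1) * ((2 * (B * 2 ^ J) + 1) * bumpMass) := by
  have hmaps : ∀ P' ∈ W, P'.scale ∈ Finset.Icc (P.scale - J) (P.scale + J) := by
    intro P' hP'
    have := h1 P' hP'; have := h2 P' hP'
    rw [Finset.mem_Icc]; omega
  rw [← Finset.sum_fiberwise_of_maps_to hmaps]
  have key : ∀ s ∈ Finset.Icc (P.scale - J) (P.scale + J),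
      ∑ P' ∈ W.filter (fun P' => P'.scale = s), P'.len * kern P P'
        ≤ (2 * (B * 2 ^ J) + 1) * bumpMass := by
    intro s hs
    refine sum_len_mul_kern_le P _ s (((P.freq : ℝ) + d) * (2 ^ s / P.len) - d) _ (by positivity)
      (fun P' hP' => (Finset.mem_filter.mp hP').2) ?_
    intro P' hP'
    obtain ⟨hW, hPs⟩ := Finset.mem_filter.mp hP'
    have hlen : P'.len = 2 ^ s := by rw [len, hPs]
    have hN := hn P' hW
    have hmax : max P.len P'.len ≤ 2 ^ J * P.len := by
      refine max_le ?_ ?_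
      · exact le_mul_of_one_le_left P.len_pos.le (one_le_pow₀ (by norm_num))
      · rw [len, len, ← pow_add]
        exact pow_le_pow_right₀ (by norm_num) (by have := h1 P' hW; omega)
    have hp := P.len_pos
    unfold Near at hN
    have e : (P'.freq : ℝ) - (((P.freq : ℝ) + d) * (2 ^ s / P.len) - d)
        = -((((P.freq : ℝ) + d) * P'.len - ((P'.freq : ℝ) + d) * P.len) / P.len) := by
      rw [← hlen]; field_simp; ring
    rw [e, abs_neg, abs_div, abs_of_pos hp, div_le_iff₀ hp]
    calc _ ≤ _ := hN
      _ ≤ B * (2 ^ J * P.len) := by gcongr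
      _ = _ := by ring
  refine (Finset.sum_le_sum key).trans ?_
  rw [Finset.sum_const, nsmul_eq_mul, Nat.card_Icc]
  have hc : ((P.scale + J + 1 - (P.scale - J) : ℕ) : ℝ) ≤ 2 * J + 1 := by
    have : P.scale + J + 1 - (P.scale - J) ≤ 2 * J + 1 := by omega
    exact_mod_cast this
  refine mul_le_mul_of_nonneg_right hc ?_
  have := bumpMass_pos
  positivity

/-- Strong disjointness of the tiles in a family of trees. -/
def StronglyDisjoint (B d : ℝ) (J : ℕ) (V : Finset Tile) (top : Tile → TreeTop) : Prop :=
  ∀ P ∈ V, ∀ P' ∈ V, P'.scale + J < P.scale →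
    |((P'.freq : ℝ) + d) - ((P.freq : ℝ) + d) * (P'.len / P.len)| ≤ B →
    ¬ Below (top P).scale (top P).pos P'

/-- The integers in the time interval of a tile. -/
noncomputable def pts (P : Tile) : Finset ℤ := block P.scale P.pos

lemma mem_pts {P : Tile} {x : ℤ} : x ∈ P.pts ↔ x / 2 ^ P.scale = P.pos := mem_block

lemma Below.ediv {j : ℕ} {i : ℤ} {P : Tile} (h : Below j i P) {x : ℤ} (hx : x ∈ P.pts) :
    x / 2 ^ j = i := by
  rw [← h.2, ← mem_pts.mp hx, ediv_pow_ediv_pow, Nat.add_sub_cancel' h.1]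

lemma below_of_mem {j : ℕ} {i : ℤ} {P : Tile} (h : P.scale ≤ j) {x : ℤ} (hx : x ∈ P.pts)
    (hi : x / 2 ^ j = i) : Below j i P := by
  refine ⟨h, ?_⟩
  rw [← hi, ← mem_pts.mp hx, ediv_pow_ediv_pow, Nat.add_sub_cancel' h]

open scoped Classical in
lemma card_overlap_le {B d : ℝ} (hB : 0 ≤ B) {J : ℕ} {V : Finset Tile} {top : Tile → TreeTop}
    (hsd : StronglyDisjoint (2 * B) d J V top)
    (hbelow : ∀ P ∈ V, Below (top P).scale (top P).pos P)
    (P : Tile) (x : ℤ) (W : Finset Tile) (hW : W ⊆ V) (hx : ∀ P' ∈ W, x ∈ P'.pts)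
    (hnear : ∀ P' ∈ W, |((P'.freq : ℝ) + d) - ((P.freq : ℝ) + d) * (P'.len / P.len)| ≤ B) :
    (W.card : ℝ) ≤ (J + 1) * (2 * B + 1) := by
  rcases W.eq_empty_or_nonempty with rfl | hne
  · simp; positivity
  have hcl : ∀ P' ∈ W, ∀ P'' ∈ W, P'.scale ≤ P''.scale + J := by
    intro P' hP' P'' hP''
    by_contra! hlt
    refine hsd P' (hW hP') P'' (hW hP'') hlt ?_ ?_
    · have a1 := hnear P' hP'
      have a2 := hnear P'' hP''
      have hp := P'.len_pos
      have hr : P''.len / P'.len ≤ 1 := by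
        rw [div_le_one hp]
        exact pow_le_pow_right₀ (by norm_num) (by omega)
      have hr0 : 0 ≤ P''.len / P'.len := div_nonneg P''.len_pos.le hp.le
      have e : ((P''.freq : ℝ) + d) - ((P'.freq : ℝ) + d) * (P''.len / P'.len)
          = (((P''.freq : ℝ) + d) - ((P.freq : ℝ) + d) * (P''.len / P.len))
            - (P''.len / P'.len) *
              (((P'.freq : ℝ) + d) - ((P.freq : ℝ) + d) * (P'.len / P.len)) := by
        have := P.len_pos
        field_simp; ring
      rw [e]
      refine (abs_sub _ _).trans ?_
      rw [abs_mul, abs_of_nonneg hr0]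
      have := mul_le_mul hr a1 (abs_nonneg _) zero_le_one
      linarith
    · refine below_of_mem ?_ (hx P'' hP'') ((hbelow P' (hW hP')).ediv (hx P' hP'))
      have := (hbelow P' (hW hP')).1
      omega
  obtain ⟨P₀, hP₀, hmin⟩ := W.exists_min_image Tile.scale hne
  have hmaps : ∀ P' ∈ W, P'.scale ∈ Finset.Icc P₀.scale (P₀.scale + J) := fun P' hP' =>
    Finset.mem_Icc.mpr ⟨hmin P' hP', hcl P' hP' P₀ hP₀⟩
  rw [Finset.card_eq_sum_card_fiberwise hmaps]
  push_cast
  have key : ∀ s ∈ Finset.Icc P₀.scale (P₀.scale + J),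
      ((W.filter (fun P' => P'.scale = s)).card : ℝ) ≤ 2 * B + 1 := by
    intro s _
    refine card_fibre_le _ s (x / 2 ^ s) (((P.freq : ℝ) + d) * (2 ^ s / P.len) - d) B hB
      (fun P' hP' => (Finset.mem_filter.mp hP').2) ?_ ?_
    · intro P' hP'
      obtain ⟨h1, h2⟩ := Finset.mem_filter.mp hP'
      rw [← h2, mem_pts.mp (hx P' h1)]
    · intro P' hP'
      obtain ⟨h1, h2⟩ := Finset.mem_filter.mp hP'
      have := hnear P' h1
      have hlen : P'.len = 2 ^ s := by rw [len, h2]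
      rw [hlen] at this
      convert this using 2; ring
  refine (Finset.sum_le_sum key).trans ?_
  rw [Finset.sum_const, nsmul_eq_mul, Nat.card_Icc]
  have : P₀.scale + J + 1 - P₀.scale = J + 1 := by omega
  rw [this]; push_cast; rfl

end Tile

namespace Tile

open scoped Classical in
/-- The interaction sum over pairs of tiles close in frequency. -/
noncomputable def pairSum (B d : ℝ) (F : Tile → ℝ) (V : Finset Tile) : ℝ :=
  ∑ P ∈ V, ∑ P' ∈ V.filter (fun P' => Near B d P P'),
    P.len * P'.len * F P * F P' * kern P P'

/-- The energy of `F` on a set of tiles. -/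
noncomputable def energy (F : Tile → ℝ) (V : Finset Tile) : ℝ := ∑ P ∈ V, P.len * F P ^ 2

/-- The `TT*` inequality. -/
def TTStar (B d : ℝ) (F : Tile → ℝ) (U : Finset Tile) (E : ℝ) : Prop :=
  ∀ V ⊆ U, energy F V ^ 2 ≤ E * pairSum B d F V

lemma energy_nonneg (F : Tile → ℝ) (V : Finset Tile) : 0 ≤ energy F V :=
  Finset.sum_nonneg fun P _ => mul_nonneg P.len_pos.le (sq_nonneg _)

lemma energy_mono (F : Tile → ℝ) {V W : Finset Tile} (h : V ⊆ W) : energy F V ≤ energy F W :=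
  Finset.sum_le_sum_of_subset_of_nonneg h fun P _ _ => mul_nonneg P.len_pos.le (sq_nonneg _)

lemma TTStar.mono {B d : ℝ} {F : Tile → ℝ} {U U' : Finset Tile} {E : ℝ}
    (h : TTStar B d F U E) (hU : U' ⊆ U) : TTStar B d F U' E :=
  fun V hV => h V (hV.trans hU)

open scoped Classical in
/-- Interaction of one tile with the much shorter tiles close to it in frequency. -/
lemma sum_far_le {B d : ℝ} (hB : 0 ≤ B) {J : ℕ} {V : Finset Tile} {top : Tile → TreeTop}
    (hsd : StronglyDisjoint (2 * B) d J V top)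
    (hbelow : ∀ P ∈ V, Below (top P).scale (top P).pos P)
    (P : Tile) (hP : P ∈ V) :
    ∑ P' ∈ V.filter (fun P' => Near B d P P' ∧ P'.scale + J < P.scale), P'.len * kern P P'
      ≤ ((J + 1) * (2 * B + 1)) * ∑ y ∈ ((V.biUnion pts).image (fun x => x / 2 ^ P.scale)).filter
          (fun y => y / 2 ^ ((top P).scale - P.scale) ≠ (top P).pos), wt ((P.pos : ℝ) - y) := by
  set W := V.filter (fun P' => Near B d P P' ∧ P'.scale + J < P.scale) with hWdef
  set X := W.biUnion pts with hX
  have hWV : W ⊆ V := Finset.filter_subset _ _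
  have hWp : ∀ P' ∈ W, Near B d P P' ∧ P'.scale + J < P.scale := fun P' h =>
    (Finset.mem_filter.mp h).2
  have hnear : ∀ P' ∈ W, |((P'.freq : ℝ) + d) - ((P.freq : ℝ) + d) * (P'.len / P.len)| ≤ B :=
    fun P' h => (hWp P' h).1.abs_sub_le (by have := (hWp P' h).2; omega)
  have hp := P.len_pos
  have step1 : ∑ P' ∈ W, P'.len * kern P P' = P.len⁻¹ *
      ∑ P' ∈ W, ∑ x ∈ P'.pts, wt ((P.pos : ℝ) - ((x / 2 ^ P.scale : ℤ) : ℝ)) := by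
    rw [Finset.mul_sum]
    refine Finset.sum_congr rfl fun P' h => ?_
    have hs : P'.scale ≤ P.scale := by have := (hWp P' h).2; omega
    have e : ∀ x ∈ P'.pts, wt ((P.pos : ℝ) - ((x / 2 ^ P.scale : ℤ) : ℝ)) =
        wt ((P.pos : ℝ) - ((P'.pos / 2 ^ (P.scale - P'.scale) : ℤ) : ℝ)) := by
      intro x hx
      rw [← mem_pts.mp hx, ediv_pow_ediv_pow, Nat.add_sub_cancel' hs]
    rw [Finset.sum_congr rfl e, Finset.sum_const, nsmul_eq_mul, pts, card_block, kern, if_pos hs,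
      len]
    ring
  have step2 : ∑ P' ∈ W, ∑ x ∈ P'.pts, wt ((P.pos : ℝ) - ((x / 2 ^ P.scale : ℤ) : ℝ)) =
      ∑ x ∈ X, ∑ P' ∈ W.filter (fun P' => x ∈ P'.pts),
        wt ((P.pos : ℝ) - ((x / 2 ^ P.scale : ℤ) : ℝ)) := by
    refine Finset.sum_comm' fun P' x => ?_
    simp only [hX, Finset.mem_biUnion, Finset.mem_filter]
    exact ⟨fun h => ⟨h, P', h⟩, fun h => h.1⟩
  have hC : (0 : ℝ) ≤ (J + 1) * (2 * B + 1) := by positivity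
  have step3 : ∑ x ∈ X, ∑ P' ∈ W.filter (fun P' => x ∈ P'.pts),
        wt ((P.pos : ℝ) - ((x / 2 ^ P.scale : ℤ) : ℝ)) ≤
      ((J + 1) * (2 * B + 1)) * ∑ x ∈ X, wt ((P.pos : ℝ) - ((x / 2 ^ P.scale : ℤ) : ℝ)) := by
    rw [Finset.mul_sum]
    refine Finset.sum_le_sum fun x _ => ?_
    rw [Finset.sum_const, nsmul_eq_mul]
    refine mul_le_mul_of_nonneg_right ?_ (wt_pos _).le
    exact card_overlap_le hB hsd hbelow P x _ ((Finset.filter_subset _ _).trans hWV)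
      (fun P' h => (Finset.mem_filter.mp h).2)
      (fun P' h => hnear P' (Finset.mem_filter.mp h).1)
  have step4 := sum_ediv_pow_le X P.scale (fun y => wt ((P.pos : ℝ) - y)) fun _ => (wt_pos _).le
  have step5 : ∑ y ∈ X.image (fun x : ℤ => x / 2 ^ P.scale), wt ((P.pos : ℝ) - (y : ℝ)) ≤
      ∑ y ∈ ((V.biUnion pts).image (fun x => x / 2 ^ P.scale)).filter
          (fun y => y / 2 ^ ((top P).scale - P.scale) ≠ (top P).pos), wt ((P.pos : ℝ) - y) := by
    refine Finset.sum_le_sum_of_subset_of_nonneg ?_ fun _ _ _ => (wt_pos _).le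
    intro y hy
    obtain ⟨x, hx, rfl⟩ := Finset.mem_image.mp hy
    obtain ⟨P', hP', hxP'⟩ := Finset.mem_biUnion.mp hx
    refine Finset.mem_filter.mpr ⟨Finset.mem_image_of_mem _
      (Finset.mem_biUnion.mpr ⟨P', hWV hP', hxP'⟩), fun hbad => ?_⟩
    have hb := (hbelow P hP).1
    rw [ediv_pow_ediv_pow, Nat.add_sub_cancel' hb] at hbad
    have hfar := (hWp P' hP').2
    refine hsd P hP P' (hWV hP') hfar ((hnear P' hP').trans (by linarith)) ?_
    exact below_of_mem (by omega) hxP' hbad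
  rw [step1, step2, inv_mul_le_iff₀ hp]
  calc _ ≤ _ := step3
    _ ≤ ((J + 1) * (2 * B + 1)) * (2 ^ P.scale *
        ∑ y ∈ ((V.biUnion pts).image (fun x => x / 2 ^ P.scale)).filter
          (fun y => y / 2 ^ ((top P).scale - P.scale) ≠ (top P).pos), wt ((P.pos : ℝ) - y)) := by
        gcongr
        exact step4.trans (by gcongr)
    _ = _ := by rw [len]; ring

lemma sum_two_pow_le (n : ℕ) : ∑ s ∈ Finset.range (n + 1), (2 : ℝ) ^ s ≤ 2 * 2 ^ n := by
  rw [geom_sum_eq (by norm_num)]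
  have : (2 : ℝ) ^ (n + 1) = 2 * 2 ^ n := by ring
  rw [this]; norm_num

open scoped Classical in
/-- Summing the exterior interaction over the tiles of one tree. -/
lemma sum_tree_exterior_le {A : ℝ} (hA : 0 ≤ A) (T : TreeTop) (V : Finset Tile)
    (hV : ∀ P ∈ V, InTree A T P) (Y : ℕ → Finset ℤ) :
    ∑ P ∈ V, P.len * ∑ y ∈ (Y P.scale).filter (fun y => y / 2 ^ (T.scale - P.scale) ≠ T.pos),
        wt ((P.pos : ℝ) - y)
      ≤ 4 * (2 * A + 1) * bumpMass ^ 2 * 2 ^ T.scale := by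
  have hmaps : ∀ P ∈ V, P.scale ∈ Finset.range (T.scale + 1) := fun P hP =>
    Finset.mem_range_succ_iff.mpr (hV P hP).1.1
  rw [← Finset.sum_fiberwise_of_maps_to hmaps]
  have key : ∀ s ∈ Finset.range (T.scale + 1),
      ∑ P ∈ V.filter (fun P => P.scale = s), P.len *
        ∑ y ∈ (Y P.scale).filter (fun y => y / 2 ^ (T.scale - P.scale) ≠ T.pos),
        wt ((P.pos : ℝ) - y) ≤ 2 ^ s * ((2 * A + 1) * (2 * bumpMass ^ 2)) := by
    intro s hs
    have e : ∀ P ∈ V.filter (fun P => P.scale = s), P.len *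
        ∑ y ∈ (Y P.scale).filter (fun y => y / 2 ^ (T.scale - P.scale) ≠ T.pos),
        wt ((P.pos : ℝ) - y) = 2 ^ s *
        ∑ y ∈ (Y s).filter (fun y => y / 2 ^ (T.scale - s) ≠ T.pos), wt ((P.pos : ℝ) - y) := by
      intro P hP
      have h := (Finset.mem_filter.mp hP).2
      rw [len, h]
    rw [Finset.sum_congr rfl e, ← Finset.mul_sum]
    refine mul_le_mul_of_nonneg_left ?_ (by positivity)
    refine (sum_pos_le _ s (2 ^ s * T.freq) A hA (fun P hP => (Finset.mem_filter.mp hP).2) ?_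
      (fun i => ∑ y ∈ (Y s).filter (fun y => y / 2 ^ (T.scale - s) ≠ T.pos), wt ((i : ℝ) - y))
      (fun i => Finset.sum_nonneg fun _ _ => (wt_pos _).le)).trans ?_
    · intro P hP
      obtain ⟨h1, h2⟩ := Finset.mem_filter.mp hP
      have := (hV P h1).2
      rwa [len, h2] at this
    · refine mul_le_mul_of_nonneg_left ?_ (by positivity)
      refine sum_wt_interval_compl_le _ _ (T.pos * 2 ^ (T.scale - s))
        ((T.pos + 1) * 2 ^ (T.scale - s)) ?_ ?_
      · intro i hi
        obtain ⟨P, hP, rfl⟩ := Finset.mem_image.mp hi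
        obtain ⟨h1, h2⟩ := Finset.mem_filter.mp hP
        rw [← ediv_pow_eq_iff, ← h2]
        exact (hV P h1).1.2
      · intro y hy
        have := (Finset.mem_filter.mp hy).2
        rw [Ne, ediv_pow_eq_iff] at this
        by_contra! hc
        exact this hc
  refine (Finset.sum_le_sum key).trans ?_
  rw [← Finset.sum_mul]
  have h := sum_two_pow_le T.scale
  have hb := bumpMass_pos
  calc _ ≤ (2 * 2 ^ T.scale) * ((2 * A + 1) * (2 * bumpMass ^ 2)) := by gcongr
    _ = _ := by ring

/-- The constant in the comparable-scale part of the interaction. -/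
noncomputable def nearConst (B : ℝ) (J : ℕ) : ℝ :=
  (2 * J + 1) * ((2 * (B * 2 ^ J) + 1) * bumpMass)

/-- The constant in the separated-scale part of the interaction. -/
noncomputable def farConst (A B : ℝ) (J : ℕ) : ℝ :=
  ((J + 1) * (2 * B + 1)) * (4 * (2 * A + 1) * bumpMass ^ 2)

lemma nearConst_pos {B : ℝ} (hB : 0 ≤ B) (J : ℕ) : 0 < nearConst B J := by
  unfold nearConst
  have := bumpMass_pos
  positivity

lemma farConst_pos {A B : ℝ} (hA : 0 ≤ A) (hB : 0 ≤ B) (J : ℕ) : 0 < farConst A B J := by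
  unfold farConst
  have := bumpMass_pos
  positivity

open scoped Classical in
lemma sum_near_pairs_le {B d : ℝ} (hB : 0 ≤ B) (J : ℕ) (F : Tile → ℝ) (V : Finset Tile) :
    ∑ P ∈ V, ∑ P' ∈ V.filter (fun P' => Near B d P P' ∧
        (P'.scale ≤ P.scale + J ∧ P.scale ≤ P'.scale + J)),
      P.len * P'.len * F P * F P' * kern P P' ≤ nearConst B J * energy F V := by
  set R : Tile → Tile → Prop := fun P P' => Near B d P P' ∧
        (P'.scale ≤ P.scale + J ∧ P.scale ≤ P'.scale + J) with hR
  have hsymm : ∀ P P', R P P' → R P' P := fun P P' h => ⟨h.1.symm, h.2.2, h.2.1⟩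
  have hrow : ∀ P ∈ V, ∑ P' ∈ V.filter (fun P' => R P P'), P'.len * kern P P' ≤ nearConst B J := by
    intro P _
    exact sum_near_scale_le hB J P _ (fun P' h => (Finset.mem_filter.mp h).2.1)
      (fun P' h => (Finset.mem_filter.mp h).2.2.1) (fun P' h => (Finset.mem_filter.mp h).2.2.2)
  have half : ∑ P ∈ V, ∑ P' ∈ V.filter (fun P' => R P P'),
      P.len * P'.len * F P ^ 2 * kern P P' ≤ nearConst B J * energy F V := by
    rw [energy, Finset.mul_sum]
    refine Finset.sum_le_sum fun P hP => ?_
    have e : ∑ P' ∈ V.filter (fun P' => R P P'), P.len * P'.len * F P ^ 2 * kern P P'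
        = (P.len * F P ^ 2) * ∑ P' ∈ V.filter (fun P' => R P P'), P'.len * kern P P' := by
      rw [Finset.mul_sum]
      exact Finset.sum_congr rfl fun _ _ => by ring
    rw [e, mul_comm]
    exact mul_le_mul_of_nonneg_right (hrow P hP) (mul_nonneg P.len_pos.le (sq_nonneg _))
  have half' : ∑ P ∈ V, ∑ P' ∈ V.filter (fun P' => R P P'),
      P.len * P'.len * F P' ^ 2 * kern P P' ≤ nearConst B J * energy F V := by
    refine le_trans (le_of_eq ?_) half
    rw [Finset.sum_comm' (t' := V) (s' := fun P' => V.filter (fun P => R P' P))]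
    · refine Finset.sum_congr rfl fun P _ => Finset.sum_congr rfl fun P' _ => ?_
      rw [kern_comm]; ring
    · intro P P'
      simp only [Finset.mem_filter]
      exact ⟨fun h => ⟨⟨h.1, hsymm _ _ h.2.2⟩, h.2.1⟩, fun h => ⟨h.1.1, h.2, hsymm _ _ h.1.2⟩⟩
  have hle : ∑ P ∈ V, ∑ P' ∈ V.filter (fun P' => R P P'),
      P.len * P'.len * F P * F P' * kern P P' ≤
      (1 / 2) * (∑ P ∈ V, ∑ P' ∈ V.filter (fun P' => R P P'),
        P.len * P'.len * F P ^ 2 * kern P P' + ∑ P ∈ V, ∑ P' ∈ V.filter (fun P' => R P P'),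
        P.len * P'.len * F P' ^ 2 * kern P P') := by
    rw [← Finset.sum_add_distrib, Finset.mul_sum]
    refine Finset.sum_le_sum fun P _ => ?_
    rw [← Finset.sum_add_distrib, Finset.mul_sum]
    refine Finset.sum_le_sum fun P' _ => ?_
    have h0 : 0 ≤ P.len * P'.len * kern P P' :=
      mul_nonneg (mul_nonneg P.len_pos.le P'.len_pos.le) (kern_pos _ _).le
    nlinarith [mul_nonneg h0 (sq_nonneg (F P - F P'))]
  linarith

open scoped Classical in
/-- The interaction sum over a strongly disjoint family of trees. -/
lemma pairSum_le {A B d μ : ℝ} (hA : 0 ≤ A) (hB : 0 ≤ B) (hμ : 0 ≤ μ) {J : ℕ}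
    {V : Finset Tile} {ι : Type*} (𝒯 : Finset ι) (top : ι → TreeTop) (tr : Tile → ι)
    (htr : ∀ P ∈ V, tr P ∈ 𝒯) (hin : ∀ P ∈ V, InTree A (top (tr P)) P)
    (hsd : StronglyDisjoint (2 * B) d J V (fun P => top (tr P)))
    (F : Tile → ℝ) (hF : ∀ P, 0 ≤ F P) (hFμ : ∀ P ∈ V, F P ≤ μ) :
    pairSum B d F V ≤ nearConst B J * energy F V +
      2 * μ ^ 2 * farConst A B J * ∑ t ∈ 𝒯, 2 ^ (top t).scale := by
  set Y : ℕ → Finset ℤ := fun s => (V.biUnion pts).image (fun x => x / 2 ^ s)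
  set ext : Tile → ℝ := fun P => ∑ y ∈ (Y P.scale).filter
    (fun y => y / 2 ^ ((top (tr P)).scale - P.scale) ≠ (top (tr P)).pos), wt ((P.pos : ℝ) - y)
  have hext : ∑ P ∈ V, P.len * ext P ≤ (4 * (2 * A + 1) * bumpMass ^ 2) *
      ∑ t ∈ 𝒯, 2 ^ (top t).scale := by
    rw [← Finset.sum_fiberwise_of_maps_to htr, Finset.mul_sum]
    refine Finset.sum_le_sum fun t _ => ?_
    refine le_trans (le_of_eq ?_) (sum_tree_exterior_le hA (top t)
      (V.filter (fun P => tr P = t)) ?_ Y)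
    · refine Finset.sum_congr rfl fun P hP => ?_
      have := (Finset.mem_filter.mp hP).2
      simp only [ext, this]
    · intro P hP
      obtain ⟨h1, h2⟩ := Finset.mem_filter.mp hP
      exact h2 ▸ hin P h1
  have hfar : ∑ P ∈ V, ∑ P' ∈ V.filter (fun P' => Near B d P P' ∧ P'.scale + J < P.scale),
      P.len * P'.len * F P * F P' * kern P P' ≤
      μ ^ 2 * farConst A B J * ∑ t ∈ 𝒯, 2 ^ (top t).scale := by
    have h1 : ∀ P ∈ V, ∑ P' ∈ V.filter (fun P' => Near B d P P' ∧ P'.scale + J < P.scale),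
        P.len * P'.len * F P * F P' * kern P P' ≤
        (μ ^ 2 * ((J + 1) * (2 * B + 1))) * (P.len * ext P) := by
      intro P hP
      have hf := sum_far_le hB hsd (fun P h => (hin P h).1) P hP
      calc _ ≤ ∑ P' ∈ V.filter (fun P' => Near B d P P' ∧ P'.scale + J < P.scale),
              (μ ^ 2 * P.len) * (P'.len * kern P P') := by
            refine Finset.sum_le_sum fun P' hP' => ?_
            have h0 : 0 ≤ P.len * P'.len * kern P P' :=
              mul_nonneg (mul_nonneg P.len_pos.le P'.len_pos.le) (kern_pos _ _).le
            have h2 : F P * F P' ≤ μ ^ 2 := by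
              rw [pow_two]
              exact mul_le_mul (hFμ P hP) (hFμ P' (Finset.mem_filter.mp hP').1) (hF _) hμ
            nlinarith [mul_le_mul_of_nonneg_left h2 h0]
        _ = (μ ^ 2 * P.len) * ∑ P' ∈ V.filter (fun P' => Near B d P P' ∧ P'.scale + J < P.scale),
              (P'.len * kern P P') := by rw [Finset.mul_sum]
        _ ≤ (μ ^ 2 * P.len) * (((J + 1) * (2 * B + 1)) * ext P) :=
            mul_le_mul_of_nonneg_left hf (mul_nonneg (sq_nonneg _) P.len_pos.le)
        _ = _ := by ring
    refine (Finset.sum_le_sum h1).trans ?_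
    rw [← Finset.mul_sum]
    calc _ ≤ (μ ^ 2 * ((J + 1) * (2 * B + 1))) * ((4 * (2 * A + 1) * bumpMass ^ 2) *
      ∑ t ∈ 𝒯, 2 ^ (top t).scale) := by gcongr
      _ = _ := by rw [farConst]; ring
  have hfar' : ∑ P ∈ V, ∑ P' ∈ V.filter (fun P' => Near B d P P' ∧ P.scale + J < P'.scale),
      P.len * P'.len * F P * F P' * kern P P' ≤
      μ ^ 2 * farConst A B J * ∑ t ∈ 𝒯, 2 ^ (top t).scale := by
    refine le_trans (le_of_eq ?_) hfar
    rw [Finset.sum_comm' (t' := V) (s' := fun P' => V.filter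
      (fun P => Near B d P' P ∧ P.scale + J < P'.scale))]
    · refine Finset.sum_congr rfl fun P _ => Finset.sum_congr rfl fun P' _ => ?_
      rw [kern_comm]; ring
    · intro P P'
      simp only [Finset.mem_filter]
      exact ⟨fun h => ⟨⟨h.1, h.2.2.1.symm, h.2.2.2⟩, h.2.1⟩,
        fun h => ⟨h.1.1, h.2, h.1.2.1.symm, h.1.2.2⟩⟩
  have hnear := sum_near_pairs_le (d := d) hB J F V
  have hsplit : pairSum B d F V =
      ∑ P ∈ V, ∑ P' ∈ V.filter (fun P' => Near B d P P' ∧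
        (P'.scale ≤ P.scale + J ∧ P.scale ≤ P'.scale + J)),
        P.len * P'.len * F P * F P' * kern P P' +
      ∑ P ∈ V, ∑ P' ∈ V.filter (fun P' => Near B d P P' ∧ P'.scale + J < P.scale),
        P.len * P'.len * F P * F P' * kern P P' +
      ∑ P ∈ V, ∑ P' ∈ V.filter (fun P' => Near B d P P' ∧ P.scale + J < P'.scale),
        P.len * P'.len * F P * F P' * kern P P' := by
    rw [pairSum, ← Finset.sum_add_distrib, ← Finset.sum_add_distrib]
    refine Finset.sum_congr rfl fun P _ => ?_
    simp only [Finset.sum_filter]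
    rw [← Finset.sum_add_distrib, ← Finset.sum_add_distrib]
    refine Finset.sum_congr rfl fun P' _ => ?_
    by_cases hN : Near B d P P'
    · rcases lt_or_ge (P'.scale + J) P.scale with h | h
      · have h' : ¬ (P.scale + J < P'.scale) := by omega
        simp [hN, h, h', not_le.mpr h]
      · rcases lt_or_ge (P.scale + J) P'.scale with h' | h'
        · have h'' : ¬ (P'.scale + J < P.scale) := by omega
          simp [hN, h', h'', not_le.mpr h']
        · simp [hN, h, h', not_lt.mpr h, not_lt.mpr h']
    · simp [hN]
  rw [hsplit]
  linarith

end Tile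

namespace Tile

/-- `P` is a `σ`-lacunary member of the tree with top `T`. -/
def Lac (A C d σ : ℝ) (T : TreeTop) (P : Tile) : Prop :=
  InTree A T P ∧ C ≤ σ * ((P.freq : ℝ) + d - P.len * T.freq)

open scoped Classical in
/-- The size of `F` on `S` in direction `σ` is at most `s`. -/
def SizeLE (A C d σ : ℝ) (F : Tile → ℝ) (I : Finset (ℕ × ℤ)) (S : Finset Tile) (s : ℝ) : Prop :=
  ∀ T : TreeTop, (T.scale, T.pos) ∈ I →
    energy F (S.filter (fun P => Lac A C d σ T P)) ≤ s ^ 2 * 2 ^ T.scale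

/-- Compatibility of the tree parameters. -/
structure Admissible (A B C d : ℝ) (J : ℕ) : Prop where
  B_nonneg : 0 ≤ B
  C_ge : 2 * B + 2 ≤ C
  A_ge : C + |d| ≤ A
  J_ge : A + |d| ≤ 2 ^ J

lemma SizeLE.mono {A C d σ s : ℝ} {F : Tile → ℝ} {I : Finset (ℕ × ℤ)} {S S' : Finset Tile}
    (h : SizeLE A C d σ F I S s) (hS : S' ⊆ S) : SizeLE A C d σ F I S' s := by
  classical
  exact fun T hT => (energy_mono F (Finset.filter_subset_filter _ hS)).trans (h T hT)

/-- The top frequency for which `P` is extremally lacunary. -/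
noncomputable def extFreq (C d σ : ℝ) (P : Tile) : ℝ := ((P.freq : ℝ) + d - σ * C) / P.len

lemma lac_iff {A C d σ : ℝ} (hσ : σ = 1 ∨ σ = -1) (T : TreeTop) (P : Tile) :
    Lac A C d σ T P ↔ InTree A T P ∧ σ * T.freq ≤ σ * extFreq C d σ P := by
  have hp := P.len_pos
  have hσ2 : σ * σ = 1 := by rcases hσ with rfl | rfl <;> norm_num
  have e : σ * extFreq C d σ P = (σ * ((P.freq : ℝ) + d) - C) / P.len := by
    rw [extFreq, mul_div_assoc', mul_sub, ← mul_assoc, hσ2, one_mul]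
  rw [Lac, e, le_div_iff₀ hp]
  constructor <;> rintro ⟨h1, h2⟩ <;> exact ⟨h1, by linarith⟩

lemma lac_of_interval {A B C d σ : ℝ} {J : ℕ} (hadm : Admissible A B C d J)
    (hσ : σ = 1 ∨ σ = -1) (P : Tile) :
    Lac A C d σ ⟨P.scale, P.pos, extFreq C d σ P⟩ P := by
  rw [lac_iff hσ]
  refine ⟨⟨⟨le_rfl, by simp⟩, ?_⟩, le_rfl⟩
  have hp := P.len_pos
  have hC : 0 ≤ C := by linarith [hadm.B_nonneg, hadm.C_ge]
  have e : (P.freq : ℝ) - P.len * extFreq C d σ P = σ * C - d := by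
    rw [extFreq, mul_div_cancel₀ _ hp.ne']; ring
  have e1 : |σ * C| = C := by
    rcases hσ with rfl | rfl
    · rw [one_mul, abs_of_nonneg hC]
    · rw [neg_one_mul, abs_neg, abs_of_nonneg hC]
  calc _ = |σ * C - d| := by rw [← e]
    _ ≤ |σ * C| + |d| := abs_sub _ _
    _ ≤ A := by rw [e1]; exact hadm.A_ge

lemma SizeLE.apply_le {A B C d σ s : ℝ} {J : ℕ} (hadm : Admissible A B C d J)
    (hσ : σ = 1 ∨ σ = -1) {F : Tile → ℝ} {I : Finset (ℕ × ℤ)} {S : Finset Tile}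
    (hs : 0 ≤ s) (h : SizeLE A C d σ F I S s) {P : Tile} (hP : P ∈ S)
    (hI : (P.scale, P.pos) ∈ I) : F P ≤ s := by
  classical
  have h1 := h ⟨P.scale, P.pos, extFreq C d σ P⟩ hI
  have h2 : P.len * F P ^ 2 ≤
      energy F (S.filter (Lac A C d σ ⟨P.scale, P.pos, extFreq C d σ P⟩)) := by
    refine Finset.single_le_sum (f := fun P => P.len * F P ^ 2)
      (fun P _ => mul_nonneg P.len_pos.le (sq_nonneg _)) ?_
    exact Finset.mem_filter.mpr ⟨hP, lac_of_interval hadm hσ P⟩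
  have h3 : P.len * F P ^ 2 ≤ P.len * s ^ 2 := by
    rw [mul_comm P.len (s ^ 2)]; exact h2.trans h1
  exact le_of_sq_le_sq₀ hs (le_of_mul_le_mul_left h3 P.len_pos)
where
  le_of_sq_le_sq₀ {a b : ℝ} (hb : 0 ≤ b) (h : a ^ 2 ≤ b ^ 2) : a ≤ b :=
    le_of_sq_le_sq h hb
  le_of_sq_le_sq {a b : ℝ} (h : a ^ 2 ≤ b ^ 2) (hb : 0 ≤ b) : a ≤ b :=
    (abs_le_of_sq_le_sq' h hb).2

open scoped Classical in
/-- It suffices to test sizes on extremal top frequencies. -/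
lemma sizeLE_of_extFreq {A B C d σ s : ℝ} {J : ℕ} (hadm : Admissible A B C d J)
    (hσ : σ = 1 ∨ σ = -1) {F : Tile → ℝ} {I : Finset (ℕ × ℤ)} {S : Finset Tile}
    (h : ∀ i ∈ I, ∀ P ∈ S, energy F (S.filter (Lac A C d σ ⟨i.1, i.2, extFreq C d σ P⟩)) ≤
      s ^ 2 * 2 ^ i.1) : SizeLE A C d σ F I S s := by
  intro T hT
  rcases (S.filter (fun P => Lac A C d σ T P)).eq_empty_or_nonempty with he | hne
  · rw [he, energy, Finset.sum_empty]; positivity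
  obtain ⟨P₀, hP₀, hmin⟩ := (S.filter (fun P => Lac A C d σ T P)).exists_min_image
    (fun P => σ * extFreq C d σ P) hne
  obtain ⟨hP₀S, hP₀L⟩ := Finset.mem_filter.mp hP₀
  refine (energy_mono F ?_).trans (h (T.scale, T.pos) hT P₀ hP₀S)
  intro P hP
  obtain ⟨hPS, hPL⟩ := Finset.mem_filter.mp hP
  refine Finset.mem_filter.mpr ⟨hPS, ?_⟩
  have hm := hmin P hP
  have h0 := ((lac_iff hσ T P₀).mp hP₀L).2
  have hL : Lac A C d σ ⟨T.scale, T.pos, extFreq C d σ P₀⟩ P ↔ _ := lac_iff hσ _ P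
  rw [hL]
  refine ⟨⟨hPL.1.1, ?_⟩, hm⟩
  have hA := hPL.1.2
  have hp := P.len_pos
  have hσ2 : σ * σ = 1 := by rcases hσ with rfl | rfl <;> norm_num
  have h1 : σ * (P.len * T.freq) ≤ σ * (P.len * extFreq C d σ P₀) := by
    have := mul_le_mul_of_nonneg_left h0 hp.le
    linarith
  have h2 : σ * (P.len * extFreq C d σ P₀) ≤ σ * (P.freq : ℝ) + σ * d - C := by
    have := mul_le_mul_of_nonneg_left hm hp.le
    have e : P.len * (σ * extFreq C d σ P) = σ * (P.freq : ℝ) + σ * d - C := by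
      rw [extFreq]; field_simp; linear_combination (-C) * hσ2
    linarith
  have hC := hadm.A_ge
  have hC2 := hadm.C_ge
  have hB := hadm.B_nonneg
  have hd := abs_le.mp (le_refl |d|)
  have hA' := abs_le.mp hA
  rw [abs_le]
  rcases hσ with rfl | rfl <;> constructor <;> simp only at * <;> linarith [abs_nonneg d]

open scoped Classical in
/-- Greedy selection of trees, extremal top frequencies first. -/
lemma exists_greedy {A B C d σ s : ℝ} {J : ℕ} (hadm : Admissible A B C d J)
    (hσ : σ = 1 ∨ σ = -1) (hs : 0 < s) (F : Tile → ℝ) (I : Finset (ℕ × ℤ)) (S : Finset Tile) :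
    ∃ (N : ℕ) (top : ℕ → TreeTop),
      (∀ k < N, ∀ i < k, σ * (top k).freq ≤ σ * (top i).freq) ∧
      (∀ i < N, ((top i).scale, (top i).pos) ∈ I ∧
        (∃ P ∈ S, (top i).freq = extFreq C d σ P) ∧
        s ^ 2 * 2 ^ (top i).scale < energy F (S.filter (fun P =>
          Lac A C d σ (top i) P ∧ ∀ k < i, ¬ InTree A (top k) P))) ∧
      SizeLE A C d σ F I (S.filter (fun P => ∀ i < N, ¬ InTree A (top i) P)) s := by
  induction hn : S.card using Nat.strong_induction_on generalizing S with
  | _ n ih =>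
  by_cases hsz : SizeLE A C d σ F I S s
  · exact ⟨0, fun _ => ⟨0, 0, 0⟩, by simp, by simp, hsz.mono (Finset.filter_subset _ _)⟩
  set cand : Finset ((ℕ × ℤ) × Tile) := (I ×ˢ S).filter (fun c => s ^ 2 * 2 ^ c.1.1 <
    energy F (S.filter (Lac A C d σ ⟨c.1.1, c.1.2, extFreq C d σ c.2⟩))) with hcand
  have hne : cand.Nonempty := by
    by_contra hemp
    rw [Finset.not_nonempty_iff_eq_empty] at hemp
    refine hsz (sizeLE_of_extFreq hadm hσ fun i hi P hP => ?_)
    by_contra! hlt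
    have : ((i, P) : (ℕ × ℤ) × Tile) ∈ cand :=
      Finset.mem_filter.mpr ⟨Finset.mem_product.mpr ⟨hi, hP⟩, hlt⟩
    simp [hemp] at this
  obtain ⟨c, hc, hmax⟩ := cand.exists_max_image (fun c => σ * extFreq C d σ c.2) hne
  obtain ⟨hcm, hcv⟩ := Finset.mem_filter.mp hc
  obtain ⟨hcI, hcS⟩ := Finset.mem_product.mp hcm
  set T₀ : TreeTop := ⟨c.1.1, c.1.2, extFreq C d σ c.2⟩ with hT₀
  set S' := S.filter (fun P => ¬ InTree A T₀ P) with hS'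
  have hS'S : S' ⊆ S := Finset.filter_subset _ _
  have hlt : S'.card < n := by
    rw [← hn]
    refine Finset.card_lt_card (Finset.ssubset_iff_subset_ne.mpr ⟨hS'S, fun heq => ?_⟩)
    have hempty : S.filter (Lac A C d σ T₀) = ∅ := by
      refine Finset.filter_eq_empty_iff.mpr fun P hP hL => ?_
      rw [← heq] at hP
      exact (Finset.mem_filter.mp hP).2 hL.1
    rw [hempty, energy, Finset.sum_empty] at hcv
    have : 0 < s ^ 2 * 2 ^ c.1.1 := by positivity
    linarith
  obtain ⟨N, top, hord, htop, hrem⟩ := ih _ hlt S' rfl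
  refine ⟨N + 1, fun k => Nat.casesOn k T₀ top, ?_, ?_, ?_⟩
  · intro k hk i hi
    obtain ⟨k, rfl⟩ : ∃ m, k = m + 1 := ⟨k - 1, by omega⟩
    have hk' : k < N := by omega
    rcases i with _ | i
    · obtain ⟨h1, ⟨P, hP, hPe⟩, h3⟩ := htop k hk'
      have : (((top k).scale, (top k).pos), P) ∈ cand := by
        refine Finset.mem_filter.mpr ⟨Finset.mem_product.mpr ⟨h1, hS'S hP⟩, h3.trans_le ?_⟩
        refine energy_mono F fun Q hQ => ?_
        obtain ⟨hQ1, hQ2⟩ := Finset.mem_filter.mp hQ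
        refine Finset.mem_filter.mpr ⟨hS'S hQ1, ?_⟩
        have := hQ2.1
        rw [← hPe]
        exact this
      have h4 := hmax _ this
      simp only at h4 ⊢
      rw [hPe]
      exact h4
    · exact hord k hk' i (by omega)
  · intro i hi
    rcases i with _ | i
    · refine ⟨hcI, ⟨c.2, hcS, rfl⟩, ?_⟩
      simpa using hcv
    · obtain ⟨h1, ⟨P, hP, hPe⟩, h3⟩ := htop i (by omega)
      refine ⟨h1, ⟨P, hS'S hP, hPe⟩, h3.trans_le (energy_mono F fun Q hQ => ?_)⟩
      obtain ⟨hQ1, hQ2, hQ3⟩ := Finset.mem_filter.mp hQ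
      obtain ⟨hQ4, hQ5⟩ := Finset.mem_filter.mp hQ1
      refine Finset.mem_filter.mpr ⟨hQ4, hQ2, fun k hk => ?_⟩
      rcases k with _ | k
      · exact hQ5
      · exact hQ3 k (by omega)
  · refine hrem.mono fun Q hQ => ?_
    obtain ⟨hQ1, hQ2⟩ := Finset.mem_filter.mp hQ
    refine Finset.mem_filter.mpr ⟨Finset.mem_filter.mpr ⟨hQ1, hQ2 0 (by omega)⟩, fun i hi => ?_⟩
    exact hQ2 (i + 1) (by omega)

/-- Total length of the tree tops in a list. -/
noncomputable def mass (L : List TreeTop) : ℝ := (L.map fun T => (2 : ℝ) ^ T.scale).sum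

lemma mass_append (L L' : List TreeTop) : mass (L ++ L') = mass L + mass L' := by
  simp [mass]

/-- The constant in the tree selection. -/
noncomputable def selConst (A B : ℝ) (J : ℕ) : ℝ := nearConst B J + 8 * farConst A B J

/-- Tiles of two trees chosen in extremal order are separated. -/
lemma lac_near_contra {A B C d σ : ℝ} {J : ℕ} (hadm : Admissible A B C d J)
    (hσ : σ = 1 ∨ σ = -1) {T : TreeTop} {P P' : Tile} (hP : InTree A T P)
    (hs : P'.scale + J < P.scale)
    (hnear : |((P'.freq : ℝ) + d) - ((P.freq : ℝ) + d) * (P'.len / P.len)| ≤ 2 * B) :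
    |(P'.freq : ℝ) - P'.len * T.freq| ≤ A ∧
      σ * ((P'.freq : ℝ) + d - P'.len * T.freq) < C := by
  have hp := P.len_pos
  have hp' := P'.len_pos
  set ρ := P'.len / P.len with hρ
  have hρ0 : 0 < ρ := div_pos hp' hp
  have hD := abs_nonneg d
  have hA0 : 0 ≤ A := by
    linarith [hadm.A_ge, hadm.C_ge, hadm.B_nonneg]
  have hρ1 : ρ * (A + |d|) ≤ 1 := by
    have h1 : P'.len * 2 ^ J ≤ P.len := by
      rw [len, len, ← pow_add]; exact pow_le_pow_right₀ (by norm_num) (by omega)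
    rw [hρ, div_mul_eq_mul_div, div_le_one hp]
    exact (mul_le_mul_of_nonneg_left hadm.J_ge hp'.le).trans h1
  have h2 : |((P.freq : ℝ) + d) - P.len * T.freq| ≤ A + |d| := by
    have e : ((P.freq : ℝ) + d) - P.len * T.freq = (P.freq - P.len * T.freq) + d := by ring
    rw [e]
    exact (abs_add_le _ _).trans (by linarith [hP.2])
  have h3 : |((P'.freq : ℝ) + d) - P'.len * T.freq| ≤ 2 * B + 1 := by
    have e : ((P'.freq : ℝ) + d) - P'.len * T.freq =
        (((P'.freq : ℝ) + d) - ((P.freq : ℝ) + d) * ρ) +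
          ρ * (((P.freq : ℝ) + d) - P.len * T.freq) := by
      rw [hρ]; field_simp; ring
    rw [e]
    refine (abs_add_le _ _).trans ?_
    rw [abs_mul, abs_of_pos hρ0]
    have := mul_le_mul_of_nonneg_left h2 hρ0.le
    linarith
  constructor
  · have e : (P'.freq : ℝ) - P'.len * T.freq = (((P'.freq : ℝ) + d) - P'.len * T.freq) - d := by
      ring
    rw [e]
    refine (abs_sub _ _).trans ?_
    linarith [hadm.A_ge, hadm.C_ge]
  · have h4 := abs_le.mp h3
    rcases hσ with rfl | rfl <;> linarith [hadm.C_ge]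

lemma le_of_sq_le_mul {x K : ℝ} (hK : 0 ≤ K) (h : x ^ 2 ≤ K * x) : x ≤ K := by
  rcases le_or_gt x 0 with hx | hx
  · exact hx.trans hK
  · rw [pow_two] at h; exact le_of_mul_le_mul_right h hx

open scoped Classical in
/-- Energy of a single tree. -/
lemma energy_lac_le {A B C d σ E : ℝ} {J : ℕ} (hadm : Admissible A B C d J)
    (hσ : σ = 1 ∨ σ = -1) {F : Tile → ℝ} {S : Finset Tile} (hE : 0 ≤ E)
    (htt : TTStar B d F S E) (T : TreeTop) (hlac : ∀ P ∈ S, Lac A C d σ T P) :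
    energy F S ≤ nearConst B J * E := by
  have hfil : ∀ P ∈ S, S.filter (fun P' => Near B d P P') = S.filter (fun P' => Near B d P P' ∧
        (P'.scale ≤ P.scale + J ∧ P.scale ≤ P'.scale + J)) := by
    intro P hP
    refine Finset.filter_congr fun P' hP' => ⟨fun hN => ⟨hN, ?_, ?_⟩, fun h => h.1⟩
    · by_contra! hlt
      have := (lac_near_contra hadm hσ (hlac P' hP').1 hlt
        ((hN.symm.abs_sub_le (by omega)).trans (by linarith [hadm.B_nonneg]))).2
      linarith [(hlac P hP).2]
    · by_contra! hlt
      have := (lac_near_contra hadm hσ (hlac P hP).1 hlt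
        ((hN.abs_sub_le (by omega)).trans (by linarith [hadm.B_nonneg]))).2
      linarith [(hlac P' hP').2]
  have h1 : pairSum B d F S ≤ nearConst B J * energy F S := by
    refine le_trans (le_of_eq ?_) (sum_near_pairs_le (d := d) hadm.B_nonneg J F S)
    exact Finset.sum_congr rfl fun P hP => by rw [hfil P hP]
  have h2 := htt S le_rfl
  have hn := (nearConst_pos hadm.B_nonneg J).le
  refine le_of_sq_le_mul (mul_nonneg hn hE) ?_
  calc _ ≤ _ := h2
    _ ≤ E * (nearConst B J * energy F S) := by gcongr
    _ = _ := by ring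

lemma sizeLE_of_ttStar {A B C d σ s : ℝ} {J : ℕ} (hadm : Admissible A B C d J)
    (hσ : σ = 1 ∨ σ = -1) {F : Tile → ℝ} {I : Finset (ℕ × ℤ)} {S : Finset Tile}
    (E : TreeTop → ℝ) (hE : ∀ T, 0 ≤ E T)
    (htt : ∀ T, ∀ V ⊆ S, (∀ P ∈ V, Below T.scale T.pos P) → TTStar B d F V (E T))
    (hEs : ∀ T, nearConst B J * E T ≤ s ^ 2 * 2 ^ T.scale) :
    SizeLE A C d σ F I S s := by
  classical
  intro T _
  refine (energy_lac_le hadm hσ (hE T) (htt T _ (Finset.filter_subset _ _) ?_) T ?_).trans (hEs T)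
  · exact fun P hP => (Finset.mem_filter.mp hP).2.1.1
  · exact fun P hP => (Finset.mem_filter.mp hP).2

open scoped Classical in
/-- One step of the size decomposition: halving the size. -/
lemma exists_halve_size {A B C d σ s E : ℝ} {J : ℕ} (hadm : Admissible A B C d J)
    (hσ : σ = 1 ∨ σ = -1) (hs : 0 < s) (hE : 0 ≤ E) {F : Tile → ℝ} (hF : ∀ P, 0 ≤ F P)
    {I : Finset (ℕ × ℤ)} {S : Finset Tile}
    (hSI : ∀ P ∈ S, (P.scale, P.pos) ∈ I) (htt : TTStar B d F S E)
    (hsz : SizeLE A C d σ F I S (2 * s)) :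
    ∃ L : List TreeTop, (∀ T ∈ L, (T.scale, T.pos) ∈ I) ∧
      s ^ 2 * mass L ≤ selConst A B J * E ∧
      SizeLE A C d σ F I (S.filter (fun P => ∀ T ∈ L, ¬ InTree A T P)) s := by
  obtain ⟨N, top, hord, htop, hrem⟩ := exists_greedy hadm hσ hs F I S
  refine ⟨(List.range N).map top, ?_, ?_, ?_⟩
  · intro T hT
    obtain ⟨i, hi, rfl⟩ := List.mem_map.mp hT
    exact (htop i (List.mem_range.mp hi)).1
  · have hmass : mass ((List.range N).map top) = ∑ i ∈ Finset.range N, (2 : ℝ) ^ (top i).scale := by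
      rw [mass, List.map_map, ← List.sum_toFinset _ List.nodup_range, List.toFinset_range]
      rfl
    rw [hmass]
    set piece : ℕ → Finset Tile := fun i => S.filter (fun P =>
      Lac A C d σ (top i) P ∧ ∀ k < i, ¬ InTree A (top k) P) with hpiece
    set V : Finset Tile := (Finset.range N).biUnion piece with hV
    set tr : Tile → ℕ := fun P => if h : ∃ i, InTree A (top i) P then Nat.find h else 0 with htrd
    have htr : ∀ i, ∀ P ∈ piece i, tr P = i := by
      intro i P hP
      obtain ⟨_, h1, h2⟩ := Finset.mem_filter.mp hP
      have hex : ∃ i, InTree A (top i) P := ⟨i, h1.1⟩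
      simp only [htrd, dif_pos hex]
      exact (Nat.find_eq_iff hex).mpr ⟨h1.1, h2⟩
    have hVp : ∀ P ∈ V, tr P < N ∧ P ∈ piece (tr P) := by
      intro P hP
      obtain ⟨i, hi, hPi⟩ := Finset.mem_biUnion.mp hP
      rw [htr i P hPi]
      exact ⟨Finset.mem_range.mp hi, hPi⟩
    have hVS : V ⊆ S := fun P hP => (Finset.mem_filter.mp (hVp P hP).2).1
    have hVL : ∀ P ∈ V, Lac A C d σ (top (tr P)) P := fun P hP =>
      (Finset.mem_filter.mp (hVp P hP).2).2.1
    have hA0 : 0 ≤ A := by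
      linarith [hadm.A_ge, hadm.C_ge, hadm.B_nonneg, abs_nonneg d]
    have hsd : StronglyDisjoint (2 * B) d J V (fun P => top (tr P)) := by
      intro P hP P' hP' hsc hnear hbel
      obtain ⟨h1, h2⟩ := lac_near_contra hadm hσ (hVL P hP).1 hsc hnear
      have hle : tr P' ≤ tr P := by
        by_contra! hlt
        exact (Finset.mem_filter.mp (hVp P' hP').2).2.2 _ hlt ⟨hbel, h1⟩
      have hfr : σ * (top (tr P)).freq ≤ σ * (top (tr P')).freq := by
        rcases hle.eq_or_lt with h | h
        · rw [h]
        · exact hord _ (hVp P hP).1 _ h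
      have h3 := (hVL P' hP').2
      have h4 := mul_le_mul_of_nonneg_left hfr P'.len_pos.le
      linarith
    have hpair := pairSum_le hA0 hadm.B_nonneg (by positivity : 0 ≤ 2 * s) (Finset.range N) top tr
      (fun P hP => Finset.mem_range.mpr (hVp P hP).1) (fun P hP => (hVL P hP).1) hsd F hF
      (fun P hP => hsz.apply_le hadm hσ (by positivity) (hVS hP) (hSI P (hVS hP)))
    have hen : energy F V = ∑ i ∈ Finset.range N, energy F (piece i) := by
      rw [energy, hV, Finset.sum_biUnion]
      · rfl
      · intro i _ k _ hik
        refine Finset.disjoint_left.mpr fun P hP hP' => hik ?_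
        rw [← htr i P hP, htr k P hP']
    have hX : s ^ 2 * ∑ i ∈ Finset.range N, (2 : ℝ) ^ (top i).scale ≤ energy F V := by
      rw [hen, Finset.mul_sum]
      exact Finset.sum_le_sum fun i hi => (htop i (Finset.mem_range.mp hi)).2.2.le
    have hK : 0 ≤ selConst A B J := by
      have := nearConst_pos hadm.B_nonneg J
      have := farConst_pos hA0 hadm.B_nonneg J
      unfold selConst; linarith
    refine hX.trans (le_of_sq_le_mul (mul_nonneg hK hE) ?_)
    have hfc := (farConst_pos hA0 hadm.B_nonneg J).le
    calc _ ≤ E * pairSum B d F V := htt V hVS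
      _ ≤ E * (nearConst B J * energy F V +
        2 * (2 * s) ^ 2 * farConst A B J * ∑ t ∈ Finset.range N, 2 ^ (top t).scale) := by gcongr
      _ = E * (nearConst B J * energy F V + 8 * farConst A B J *
          (s ^ 2 * ∑ t ∈ Finset.range N, 2 ^ (top t).scale)) := by ring
      _ ≤ E * (nearConst B J * energy F V + 8 * farConst A B J * energy F V) := by gcongr
      _ = _ := by rw [selConst]; ring
  · refine hrem.mono fun P hP => ?_
    obtain ⟨h1, h2⟩ := Finset.mem_filter.mp hP
    refine Finset.mem_filter.mpr ⟨h1, fun i hi => h2 _ ?_⟩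
    exact List.mem_map.mpr ⟨i, List.mem_range.mpr hi, rfl⟩

open scoped Classical in
lemma exists_reduce_size_pow {A B C d σ s E : ℝ} {J : ℕ} (hadm : Admissible A B C d J)
    (hσ : σ = 1 ∨ σ = -1) (hs : 0 < s) (hE : 0 ≤ E) {F : Tile → ℝ} (hF : ∀ P, 0 ≤ F P)
    {I : Finset (ℕ × ℤ)} (n : ℕ) {S : Finset Tile}
    (hSI : ∀ P ∈ S, (P.scale, P.pos) ∈ I) (htt : TTStar B d F S E)
    (hsz : SizeLE A C d σ F I S (2 ^ n * s)) :
    ∃ L : List TreeTop, (∀ T ∈ L, (T.scale, T.pos) ∈ I) ∧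
      s ^ 2 * mass L ≤ selConst A B J * E * (4 / 3 * (1 - (1 / 4) ^ n)) ∧
      SizeLE A C d σ F I (S.filter (fun P => ∀ T ∈ L, ¬ InTree A T P)) s := by
  induction n generalizing S with
  | zero =>
    exact ⟨[], by simp, by simp [mass], by simpa using hsz⟩
  | succ n ih =>
    have hsz' : SizeLE A C d σ F I S (2 * (2 ^ n * s)) := by
      rwa [pow_succ, mul_comm ((2 : ℝ) ^ n) 2, mul_assoc] at hsz
    obtain ⟨L₁, h1, h2, h3⟩ := exists_halve_size hadm hσ (by positivity) hE hF hSI htt hsz'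
    have hsub := Finset.filter_subset (fun P => ∀ T ∈ L₁, ¬ InTree A T P) S
    obtain ⟨L₂, g1, g2, g3⟩ := ih (fun P hP => hSI P (hsub hP)) (htt.mono hsub) h3
    refine ⟨L₁ ++ L₂, ?_, ?_, ?_⟩
    · intro T hT
      rcases List.mem_append.mp hT with h | h
      exacts [h1 T h, g1 T h]
    · rw [mass_append, mul_add]
      have h4 : s ^ 2 * mass L₁ ≤ selConst A B J * E * (1 / 4) ^ n := by
        have h5 : s ^ 2 * mass L₁ * 4 ^ n ≤ selConst A B J * E := by
          refine le_trans (le_of_eq ?_) h2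
          have : (4 : ℝ) ^ n = (2 ^ n) ^ 2 := by rw [← pow_mul, mul_comm, pow_mul]; norm_num
          rw [this]; ring
        have h6 : (0 : ℝ) < 4 ^ n := by positivity
        rw [one_div, inv_pow, ← div_eq_mul_inv, le_div_iff₀ h6]
        exact h5
      calc _ ≤ _ := add_le_add h4 g2
        _ = _ := by ring
    · refine g3.mono fun P hP => ?_
      obtain ⟨k1, k2⟩ := Finset.mem_filter.mp hP
      refine Finset.mem_filter.mpr ⟨Finset.mem_filter.mpr ⟨k1, fun T hT => ?_⟩, fun T hT => ?_⟩
      · exact k2 T (List.mem_append_left _ hT)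
      · exact k2 T (List.mem_append_right _ hT)

open scoped Classical in
/-- Trees of controlled total length whose removal makes the size at most `s`. -/
lemma exists_reduce_size {A B C d σ s E : ℝ} {J : ℕ} (hadm : Admissible A B C d J)
    (hσ : σ = 1 ∨ σ = -1) (hs : 0 < s) (hE : 0 ≤ E) {F : Tile → ℝ} (hF : ∀ P, 0 ≤ F P)
    {I : Finset (ℕ × ℤ)} {S : Finset Tile}
    (hSI : ∀ P ∈ S, (P.scale, P.pos) ∈ I) (htt : TTStar B d F S E) :
    ∃ L : List TreeTop, (∀ T ∈ L, (T.scale, T.pos) ∈ I) ∧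
      s ^ 2 * mass L ≤ 2 * selConst A B J * E ∧
      SizeLE A C d σ F I (S.filter (fun P => ∀ T ∈ L, ¬ InTree A T P)) s := by
  obtain ⟨n, hn⟩ := pow_unbounded_of_one_lt (Real.sqrt (energy F S) / s) (one_lt_two : (1 : ℝ) < 2)
  rw [div_lt_iff₀ hs] at hn
  have hsz : SizeLE A C d σ F I S (2 ^ n * s) := by
    intro T _
    have h1 : energy F S ≤ (2 ^ n * s) ^ 2 := by
      rw [← Real.sq_sqrt (energy_nonneg F S)]
      gcongr
    have h2 : (1 : ℝ) ≤ 2 ^ T.scale := one_le_pow₀ (by norm_num)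
    have h3 := energy_mono F (Finset.filter_subset (Lac A C d σ T) S)
    have h4 : 0 ≤ (2 ^ n * s) ^ 2 := sq_nonneg _
    nlinarith
  obtain ⟨L, h1, h2, h3⟩ := exists_reduce_size_pow hadm hσ hs hE hF n hSI htt hsz
  refine ⟨L, h1, h2.trans ?_, h3⟩
  have hA0 : 0 ≤ A := by
    linarith [hadm.A_ge, hadm.C_ge, hadm.B_nonneg, abs_nonneg d]
  have hK : 0 ≤ selConst A B J := by
    have := nearConst_pos hadm.B_nonneg J
    have := farConst_pos hA0 hadm.B_nonneg J
    unfold selConst; linarith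
  have hp : (0 : ℝ) ≤ (1 / 4) ^ n := by positivity
  nlinarith [mul_nonneg hK hE]

open scoped Classical in
/-- Both directions at once. -/
lemma exists_reduce_size_both {A B C d s E : ℝ} {J : ℕ} (hadm : Admissible A B C d J)
    (hs : 0 < s) (hE : 0 ≤ E) {F : Tile → ℝ} (hF : ∀ P, 0 ≤ F P)
    {I : Finset (ℕ × ℤ)} {S : Finset Tile}
    (hSI : ∀ P ∈ S, (P.scale, P.pos) ∈ I) (htt : TTStar B d F S E) :
    ∃ L : List TreeTop, (∀ T ∈ L, (T.scale, T.pos) ∈ I) ∧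
      s ^ 2 * mass L ≤ 4 * selConst A B J * E ∧
      ∀ σ : ℝ, σ = 1 ∨ σ = -1 →
        SizeLE A C d σ F I (S.filter (fun P => ∀ T ∈ L, ¬ InTree A T P)) s := by
  obtain ⟨L₁, h1, h2, h3⟩ := exists_reduce_size (C := C) (σ := 1) hadm (Or.inl rfl) hs hE hF hSI htt
  have hsub := Finset.filter_subset (fun P => ∀ T ∈ L₁, ¬ InTree A T P) S
  obtain ⟨L₂, g1, g2, g3⟩ := exists_reduce_size (C := C) (σ := -1) hadm (Or.inr rfl) hs hE hF
    (fun P hP => hSI P (hsub hP)) (htt.mono hsub)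
  have hsub2 : S.filter (fun P => ∀ T ∈ L₁ ++ L₂, ¬ InTree A T P) ⊆
      (S.filter (fun P => ∀ T ∈ L₁, ¬ InTree A T P)).filter
        (fun P => ∀ T ∈ L₂, ¬ InTree A T P) := by
    intro P hP
    obtain ⟨k1, k2⟩ := Finset.mem_filter.mp hP
    exact Finset.mem_filter.mpr ⟨Finset.mem_filter.mpr
      ⟨k1, fun T hT => k2 T (List.mem_append_left _ hT)⟩,
      fun T hT => k2 T (List.mem_append_right _ hT)⟩
  refine ⟨L₁ ++ L₂, ?_, ?_, ?_⟩
  · intro T hT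
    rcases List.mem_append.mp hT with h | h
    exacts [h1 T h, g1 T h]
  · rw [mass_append, mul_add]; linarith
  · rintro σ (rfl | rfl)
    · exact h3.mono (hsub2.trans (Finset.filter_subset _ _))
    · exact g3.mono hsub2

end Tile

namespace Tile

open scoped Classical in
/-- The restriction of `F` to the tiles that are lacunary with respect to the top `T`. -/
noncomputable def lacPart (C d : ℝ) (T : TreeTop) (F : Tile → ℝ) (P : Tile) : ℝ :=
  if C ≤ |(P.freq : ℝ) + d - P.len * T.freq| then F P else 0

lemma energy_lacPart_le {A C d s : ℝ} {F : Tile → ℝ} {I : Finset (ℕ × ℤ)} {S : Finset Tile}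
    (T : TreeTop) (hT : (T.scale, T.pos) ∈ I) (hin : ∀ P ∈ S, InTree A T P)
    (hsz : ∀ σ : ℝ, σ = 1 ∨ σ = -1 → SizeLE A C d σ F I S s) :
    energy (lacPart C d T F) S ≤ 2 * s ^ 2 * 2 ^ T.scale := by
  classical
  have h1 := hsz 1 (Or.inl rfl) T hT
  have h2 := hsz (-1) (Or.inr rfl) T hT
  have h3 : energy (lacPart C d T F) S ≤
      energy F (S.filter (fun P => Lac A C d 1 T P)) +
      energy F (S.filter (fun P => Lac A C d (-1) T P)) := by
    rw [energy, energy, energy, Finset.sum_filter, Finset.sum_filter, ← Finset.sum_add_distrib]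
    refine Finset.sum_le_sum fun P hP => ?_
    have hp := P.len_pos
    have h0 : 0 ≤ P.len * F P ^ 2 := by positivity
    unfold lacPart
    split_ifs with a b c c
    · linarith
    · linarith
    · linarith
    · exfalso
      rcases le_abs.mp a with h | h
      · exact b ⟨hin P hP, by linarith⟩
      · exact c ⟨hin P hP, by linarith⟩
    all_goals (simp; try positivity)
  linarith

lemma mul_le_of_sq_le {s t x y : ℝ} (hs : 0 < s) (ht : 0 < t) :
    x * y ≤ 1 / 2 * (t / s * x ^ 2 + s / t * y ^ 2) := by
  have e : 1 / 2 * (t / s * x ^ 2 + s / t * y ^ 2) - x * y =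
      (t * x - s * y) ^ 2 / (2 * s * t) := by field_simp; ring
  have : 0 ≤ (t * x - s * y) ^ 2 / (2 * s * t) := by positivity
  linarith

lemma sum_len_mul_le {S : Finset Tile} {G H : Tile → ℝ} {s t X : ℝ} (hs : 0 < s) (ht : 0 < t)
    (hG : energy G S ≤ 2 * s ^ 2 * X) (hH : energy H S ≤ 2 * t ^ 2 * X) :
    ∑ P ∈ S, P.len * (G P * H P) ≤ 2 * s * t * X := by
  have h1 : ∑ P ∈ S, P.len * (G P * H P) ≤
      1 / 2 * (t / s * energy G S + s / t * energy H S) := by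
    rw [energy, energy, Finset.mul_sum, Finset.mul_sum, ← Finset.sum_add_distrib, Finset.mul_sum]
    refine Finset.sum_le_sum fun P _ => ?_
    have := mul_le_mul_of_nonneg_left (mul_le_of_sq_le (x := G P) (y := H P) hs ht) P.len_pos.le
    linarith
  calc _ ≤ _ := h1
    _ ≤ 1 / 2 * (t / s * (2 * s ^ 2 * X) + s / t * (2 * t ^ 2 * X)) := by gcongr
    _ = _ := by field_simp; ring

/-- The trilinear estimate on a single tree. -/
lemma tree_estimate {A B C : ℝ} {d : Fin 3 → ℝ} {J : ℕ} (hadm : ∀ i, Admissible A B C (d i) J)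
    (hd : ∀ i i', i ≠ i' → 2 * C ≤ |d i - d i'|) {F : Fin 3 → Tile → ℝ} (hF : ∀ i P, 0 ≤ F i P)
    {I : Finset (ℕ × ℤ)} {S : Finset Tile} (hSI : ∀ P ∈ S, (P.scale, P.pos) ∈ I)
    (T : TreeTop) (hT : (T.scale, T.pos) ∈ I) (hin : ∀ P ∈ S, InTree A T P)
    {s : Fin 3 → ℝ} (hs : ∀ i, 0 < s i)
    (hsz : ∀ i, ∀ σ : ℝ, σ = 1 ∨ σ = -1 → SizeLE A C (d i) σ (F i) I S (s i)) :
    ∑ P ∈ S, P.len * (F 0 P * F 1 P * F 2 P) ≤ 6 * (s 0 * s 1 * s 2) * 2 ^ T.scale := by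
  set G : Fin 3 → Tile → ℝ := fun i => lacPart C (d i) T (F i) with hG
  have hen : ∀ i, energy (G i) S ≤ 2 * s i ^ 2 * 2 ^ T.scale := fun i =>
    energy_lacPart_le T hT hin (hsz i)
  have hG0 : ∀ i P, 0 ≤ G i P := by
    intro i P; simp only [hG, lacPart]; split_ifs; exacts [hF i P, le_rfl]
  have hGF : ∀ i P, G i P = F i P ∨ |(P.freq : ℝ) + d i - P.len * T.freq| < C := by
    intro i P; simp only [hG, lacPart]; split_ifs with h
    exacts [Or.inl rfl, Or.inr (not_le.mp h)]
  have htwo : ∀ i i' P, i ≠ i' → G i P = F i P ∨ G i' P = F i' P := by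
    intro i i' P hne
    rcases hGF i P with h | h
    · exact Or.inl h
    rcases hGF i' P with h' | h'
    · exact Or.inr h'
    exfalso
    have h1 := hd i i' hne
    have e : d i - d i' = ((P.freq : ℝ) + d i - P.len * T.freq) -
      ((P.freq : ℝ) + d i' - P.len * T.freq) := by ring
    have h2 := abs_sub ((P.freq : ℝ) + d i - P.len * T.freq)
      ((P.freq : ℝ) + d i' - P.len * T.freq)
    rw [← e] at h2
    linarith
  have hFs : ∀ i, ∀ P ∈ S, F i P ≤ s i := fun i P hP =>
    (hsz i 1 (Or.inl rfl)).apply_le (hadm i) (Or.inl rfl) (hs i).le hP (hSI P hP)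
  have hpt : ∀ P ∈ S, P.len * (F 0 P * F 1 P * F 2 P) ≤
      s 2 * (P.len * (G 0 P * G 1 P)) + s 1 * (P.len * (G 0 P * G 2 P)) +
        s 0 * (P.len * (G 1 P * G 2 P)) := by
    intro P hP
    have hp := P.len_pos.le
    have a0 := hF 0 P; have a1 := hF 1 P; have a2 := hF 2 P
    have g0 := hG0 0 P; have g1 := hG0 1 P; have g2 := hG0 2 P
    have b0 := hFs 0 P hP; have b1 := hFs 1 P hP; have b2 := hFs 2 P hP
    have n01 : 0 ≤ s 2 * (P.len * (G 0 P * G 1 P)) := mul_nonneg (hs 2).le (by positivity)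
    have n02 : 0 ≤ s 1 * (P.len * (G 0 P * G 2 P)) := mul_nonneg (hs 1).le (by positivity)
    have n12 : 0 ≤ s 0 * (P.len * (G 1 P * G 2 P)) := mul_nonneg (hs 0).le (by positivity)
    have case01 : G 0 P = F 0 P → G 1 P = F 1 P → P.len * (F 0 P * F 1 P * F 2 P) ≤
        s 2 * (P.len * (G 0 P * G 1 P)) := by
      intro h h'; rw [h, h']
      calc _ = (P.len * (F 0 P * F 1 P)) * F 2 P := by ring
        _ ≤ (P.len * (F 0 P * F 1 P)) * s 2 := by gcongr
        _ = _ := by ring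
    have case02 : G 0 P = F 0 P → G 2 P = F 2 P → P.len * (F 0 P * F 1 P * F 2 P) ≤
        s 1 * (P.len * (G 0 P * G 2 P)) := by
      intro h h'; rw [h, h']
      calc _ = (P.len * (F 0 P * F 2 P)) * F 1 P := by ring
        _ ≤ (P.len * (F 0 P * F 2 P)) * s 1 := by gcongr
        _ = _ := by ring
    have case12 : G 1 P = F 1 P → G 2 P = F 2 P → P.len * (F 0 P * F 1 P * F 2 P) ≤
        s 0 * (P.len * (G 1 P * G 2 P)) := by
      intro h h'; rw [h, h']
      calc _ = (P.len * (F 1 P * F 2 P)) * F 0 P := by ring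
        _ ≤ (P.len * (F 1 P * F 2 P)) * s 0 := by gcongr
        _ = _ := by ring
    rcases htwo 0 1 P (by decide) with h | h
    · rcases htwo 1 2 P (by decide) with h' | h'
      · linarith [case01 h h']
      · linarith [case02 h h']
    · rcases htwo 0 2 P (by decide) with h' | h'
      · linarith [case01 h' h]
      · linarith [case12 h h']
  refine (Finset.sum_le_sum hpt).trans ?_
  rw [Finset.sum_add_distrib, Finset.sum_add_distrib, ← Finset.mul_sum, ← Finset.mul_sum,
    ← Finset.mul_sum]
  have e01 := mul_le_mul_of_nonneg_left (sum_len_mul_le (hs 0) (hs 1) (hen 0) (hen 1)) (hs 2).le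
  have e02 := mul_le_mul_of_nonneg_left (sum_len_mul_le (hs 0) (hs 2) (hen 0) (hen 2)) (hs 1).le
  have e12 := mul_le_mul_of_nonneg_left (sum_len_mul_le (hs 1) (hs 2) (hen 1) (hen 2)) (hs 0).le
  linarith

open scoped Classical in
lemma sum_exists_inTree_le {A : ℝ} (S : Finset Tile) (f : Tile → ℝ) (hf : ∀ P ∈ S, 0 ≤ f P)
    (L : List TreeTop) :
    ∑ P ∈ S.filter (fun P => ∃ T ∈ L, InTree A T P), f P ≤
      (L.map fun T => ∑ P ∈ S.filter (fun P => InTree A T P), f P).sum := by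
  induction L with
  | nil => simp
  | cons T L ih =>
    rw [List.map_cons, List.sum_cons]
    refine le_trans ?_ (add_le_add le_rfl ih)
    rw [Finset.sum_filter, Finset.sum_filter, Finset.sum_filter, ← Finset.sum_add_distrib]
    refine Finset.sum_le_sum fun P hP => ?_
    have := hf P hP
    by_cases h1 : InTree A T P <;> by_cases h2 : ∃ T ∈ L, InTree A T P <;>
      simp [h1, h2, this]

open scoped Classical in
/-- Summation of the tree estimates over a decomposition of the tiles into trees of
controlled size and total length. -/
lemma sum_tiles_le {A B C : ℝ} {d : Fin 3 → ℝ} {J : ℕ} (hadm : ∀ i, Admissible A B C (d i) J)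
    (hd : ∀ i i', i ≠ i' → 2 * C ≤ |d i - d i'|) {F : Fin 3 → Tile → ℝ} (hF : ∀ i P, 0 ≤ F i P)
    {I : Finset (ℕ × ℤ)} {S : Finset Tile} (hSI : ∀ P ∈ S, (P.scale, P.pos) ∈ I)
    {p : Fin 3 → ℝ} (hp : ∀ i, 0 < p i) (hp1 : 1 / p 0 + 1 / p 1 + 1 / p 2 = 1)
    (L : Fin 3 → ℤ → List TreeTop) (hLI : ∀ i k, ∀ T ∈ L i k, (T.scale, T.pos) ∈ I)
    (hsz : ∀ i k, ∀ σ : ℝ, σ = 1 ∨ σ = -1 → SizeLE A C (d i) σ (F i) I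
      (S.filter (fun P => ∀ T ∈ L i k, ¬ InTree A T P)) (2 ^ ((k : ℝ) / p i)))
    (M : Fin 3 → ℝ) (hM : ∀ i, ∀ K : Finset ℤ, ∑ k ∈ K, (2 : ℝ) ^ (k : ℝ) * mass (L i k) ≤ M i) :
    ∑ P ∈ S, P.len * (F 0 P * F 1 P * F 2 P) ≤ 12 * (M 0 + M 1 + M 2) := by
  have hlen : ∀ P : Tile, 0 < P.len := fun P => P.len_pos
  set S₁ := S.filter (fun P => ∀ i, F i P ≠ 0) with hS₁
  set f : Tile → ℝ := fun P => P.len * (F 0 P * F 1 P * F 2 P) with hf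
  have hf0 : ∀ P, 0 ≤ f P := fun P =>
    mul_nonneg P.len_pos.le (mul_nonneg (mul_nonneg (hF _ _) (hF _ _)) (hF _ _))
  have hred : ∑ P ∈ S, f P = ∑ P ∈ S₁, f P := by
    rw [hS₁]
    refine (Finset.sum_filter_of_ne fun P _ hne i hi => hne ?_).symm
    fin_cases i <;> simp_all
  set bad : Tile → ℤ → Prop := fun P k => ∃ i, ∃ T ∈ L i k, InTree A T P with hbad
  have hk : ∀ P ∈ S₁, ∃ k, bad P k ∧ ¬ bad P (k + 1) := by
    intro P hP
    obtain ⟨hPS, hPF⟩ := Finset.mem_filter.mp hP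
    have hbdd : ∃ b : ℤ, ∀ z, bad P z → z ≤ b := by
      obtain ⟨n, hn⟩ := pow_unbounded_of_one_lt (max (M 0) (max (M 1) (M 2)))
        (one_lt_two : (1 : ℝ) < 2)
      refine ⟨n, fun z ⟨i, T, hT, _⟩ => ?_⟩
      by_contra! hlt
      have h1 := hM i {z}
      rw [Finset.sum_singleton] at h1
      have h2 : 1 ≤ mass (L i z) := by
        have : (2 : ℝ) ^ T.scale ≤ mass (L i z) := by
          refine List.single_le_sum ?_ _ (List.mem_map_of_mem hT)
          intro x hx
          obtain ⟨T, _, rfl⟩ := List.mem_map.mp hx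
          positivity
        exact (one_le_pow₀ (by norm_num)).trans this
      have h3 : (2 : ℝ) ^ n ≤ 2 ^ (z : ℝ) := by
        rw [← Real.rpow_natCast]
        exact Real.rpow_le_rpow_of_exponent_le (by norm_num) (by exact_mod_cast hlt.le)
      have h4 : M i ≤ max (M 0) (max (M 1) (M 2)) := by
        fin_cases i
        · exact le_max_left _ _
        · exact le_max_of_le_right (le_max_left _ _)
        · exact le_max_of_le_right (le_max_right _ _)
      have h5 : (0 : ℝ) < 2 ^ (z : ℝ) := by positivity
      nlinarith
    have hne : ∃ z, bad P z := by
      have hpos : 0 < F 0 P := lt_of_le_of_ne (hF 0 P) (Ne.symm (hPF 0))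
      obtain ⟨n, hn⟩ := exists_pow_lt_of_lt_one hpos
        (show (2 : ℝ) ^ (-(1 / p 0)) < 1 from
          Real.rpow_lt_one_of_one_lt_of_neg one_lt_two (by have := hp 0; simp [this]))
      refine ⟨-(n : ℤ), 0, ?_⟩
      by_contra! hno
      have h1 := (hsz 0 (-(n : ℤ)) 1 (Or.inl rfl)).apply_le (hadm 0) (Or.inl rfl) (by positivity)
        (Finset.mem_filter.mpr ⟨hPS, hno⟩) (hSI P hPS)
      have h2 : (2 : ℝ) ^ (((-(n : ℤ) : ℤ) : ℝ) / p 0) = (2 ^ (-(1 / p 0))) ^ n := by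
        rw [← Real.rpow_natCast, ← Real.rpow_mul (by norm_num)]
        congr 1; push_cast; ring
      rw [h2] at h1
      linarith
    obtain ⟨k, hk1, hk2⟩ := Int.exists_greatest_of_bdd hbdd hne
    exact ⟨k, hk1, fun h => by have := hk2 _ h; omega⟩
  choose! κ hκ using hk
  rw [hred, ← Finset.sum_fiberwise_of_maps_to
    (t := S₁.image κ) (g := κ) (fun P hP => Finset.mem_image_of_mem _ hP)]
  have hlevel : ∀ k, ∑ P ∈ S₁.filter (fun P => κ P = k), f P ≤
      ∑ i, 12 * ((2 : ℝ) ^ (k : ℝ) * mass (L i k)) := by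
    intro k
    set R := S₁.filter (fun P => ¬ bad P (k + 1)) with hR
    have hRS : R ⊆ S := (Finset.filter_subset _ _).trans (Finset.filter_subset _ _)
    have h1 : ∑ P ∈ S₁.filter (fun P => κ P = k), f P ≤
        ∑ i, ∑ P ∈ R.filter (fun P => ∃ T ∈ L i k, InTree A T P), f P := by
      have e : ∑ i, ∑ P ∈ R.filter (fun P => ∃ T ∈ L i k, InTree A T P), f P =
          ∑ P ∈ R, ∑ i, (if ∃ T ∈ L i k, InTree A T P then f P else 0) := by
        rw [Finset.sum_comm]
        exact Finset.sum_congr rfl fun i _ => Finset.sum_filter _ _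
      have l1 : ∑ P ∈ S₁.filter (fun P => κ P = k), f P =
          ∑ P ∈ S₁, (if κ P = k then f P else 0) := Finset.sum_filter _ _
      have l2 : ∑ P ∈ R, ∑ i, (if ∃ T ∈ L i k, InTree A T P then f P else 0) =
          ∑ P ∈ S₁, (if ¬ bad P (k + 1) then
            ∑ i, (if ∃ T ∈ L i k, InTree A T P then f P else 0) else 0) :=
        Finset.sum_filter _ _
      rw [e, l1, l2]
      apply Finset.sum_le_sum
      intro P hP
      by_cases hPk : κ P = k
      · obtain ⟨⟨i, hi⟩, h2⟩ := hκ P hP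
        rw [hPk] at hi h2
        rw [if_pos hPk, if_pos h2]
        set g : Fin 3 → ℝ := fun j => if ∃ T ∈ L j k, InTree A T P then f P else 0 with hg
        have hg0 : ∀ j ∈ Finset.univ, 0 ≤ g j := by
          intro j _
          simp only [hg]
          split_ifs
          exacts [hf0 P, le_rfl]
        have hgi : g i = f P := if_pos hi
        exact hgi.symm.le.trans (Finset.single_le_sum hg0 (Finset.mem_univ i))
      · rw [if_neg hPk]
        have hg0 : 0 ≤ ∑ i, (if ∃ T ∈ L i k, InTree A T P then f P else 0) := by
          apply Finset.sum_nonneg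
          intro j _
          split_ifs
          exacts [hf0 P, le_rfl]
        by_cases hb : bad P (k + 1)
        · rw [if_neg (not_not.mpr hb)]
        · rw [if_pos hb]; exact hg0
    refine h1.trans (Finset.sum_le_sum fun i _ => ?_)
    refine (sum_exists_inTree_le R f (fun P _ => hf0 P) (L i k)).trans ?_
    have h2 : ∀ T ∈ L i k, ∑ P ∈ R.filter (fun P => InTree A T P), f P ≤
        12 * ((2 : ℝ) ^ (k : ℝ) * 2 ^ T.scale) := by
      intro T hT
      have hsub : ∀ i, ∀ P ∈ R.filter (fun P => InTree A T P),
          P ∈ S ∧ ∀ T ∈ L i (k + 1), ¬ InTree A T P := by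
        intro i P hP
        have hPR := (Finset.mem_filter.mp hP).1
        exact ⟨hRS hPR, fun T hT hin => (Finset.mem_filter.mp hPR).2 ⟨i, T, hT, hin⟩⟩
      have h3 := tree_estimate hadm hd hF (S := R.filter (fun P => InTree A T P))
        (fun P hP => hSI P (hRS (Finset.mem_filter.mp hP).1)) T (hLI i k T hT)
        (fun P hP => (Finset.mem_filter.mp hP).2)
        (s := fun i => 2 ^ (((k + 1 : ℤ) : ℝ) / p i)) (fun i => by positivity)
        (fun i σ hσ => (hsz i (k + 1) σ hσ).mono
          fun P hP => Finset.mem_filter.mpr (hsub i P hP))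
      refine h3.trans (le_of_eq ?_)
      have h4 : (2 : ℝ) ^ (((k + 1 : ℤ) : ℝ) / p 0) * 2 ^ (((k + 1 : ℤ) : ℝ) / p 1) *
          2 ^ (((k + 1 : ℤ) : ℝ) / p 2) = 2 * 2 ^ (k : ℝ) := by
        rw [← Real.rpow_add (by norm_num), ← Real.rpow_add (by norm_num)]
        have : ((k + 1 : ℤ) : ℝ) / p 0 + ((k + 1 : ℤ) : ℝ) / p 1 + ((k + 1 : ℤ) : ℝ) / p 2
            = 1 + k := by
          have : ((k + 1 : ℤ) : ℝ) * (1 / p 0 + 1 / p 1 + 1 / p 2) = 1 + k := by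
            rw [hp1]; push_cast; ring
          rw [← this]; ring
        rw [this, Real.rpow_add (by norm_num), Real.rpow_one]
      rw [h4]; ring
    calc _ ≤ ((L i k).map fun T => 12 * ((2 : ℝ) ^ (k : ℝ) * 2 ^ T.scale)).sum :=
          List.sum_le_sum h2
      _ = _ := by
        rw [mass, List.sum_map_mul_left, List.sum_map_mul_left]
  refine (Finset.sum_le_sum fun k _ => hlevel k).trans ?_
  rw [Finset.sum_comm]
  have h6 : ∀ i, ∑ k ∈ S₁.image κ, 12 * ((2 : ℝ) ^ (k : ℝ) * mass (L i k)) ≤ 12 * M i := by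
    intro i
    rw [← Finset.mul_sum]
    linarith [hM i (S₁.image κ)]
  refine (Finset.sum_le_sum fun i _ => h6 i).trans (le_of_eq ?_)
  rw [Fin.sum_univ_three]; ring

end Tile

section WavePackets

open scoped FourierTransform SchwartzMap

lemma fourier_linear_combination (a b : ℂ) (B₁ B₂ : 𝓢(ℝ, ℂ)) (y : ℝ) :
    𝓕 ((a • B₁ + b • B₂ : 𝓢(ℝ, ℂ)) : ℝ → ℂ) y =
      a * 𝓕 (B₁ : ℝ → ℂ) y + b * 𝓕 (B₂ : ℝ → ℂ) y := by
  have h := congrArg (fun F : 𝓢(ℝ, ℂ) => F y)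
    ((SchwartzMap.fourierTransformCLM ℂ (V := ℝ) (E := ℂ)).map_add (a • B₁) (b • B₂))
  rw [map_smul, map_smul] at h
  exact h

lemma exists_fourier_mul_sub (B : 𝓢(ℝ, ℂ)) (y₀ : ℝ) :
    ∃ B' : 𝓢(ℝ, ℂ), tsupport B' ⊆ tsupport B ∧
      ∀ y, 𝓕 (B' : ℝ → ℂ) y = ((y - y₀ : ℝ) : ℂ) * 𝓕 (B : ℝ → ℂ) y := by
  have hc : (2 * π * Complex.I : ℂ) ≠ 0 := by
    simp [Real.pi_ne_zero]
  refine ⟨(2 * π * Complex.I : ℂ)⁻¹ • SchwartzMap.derivCLM ℂ ℂ B + (-y₀ : ℂ) • B, ?_, fun y => ?_⟩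
  · refine closure_minimal (fun η hη => ?_) (isClosed_tsupport _)
    by_contra hn
    apply hη
    have h1 : B η = 0 := image_eq_zero_of_notMem_tsupport hn
    have h2 : deriv (B : ℝ → ℂ) η = 0 := by
      by_contra h
      exact hn (support_deriv_subset h)
    simp [h1, h2]
  · have h3 : 𝓕 (SchwartzMap.derivCLM ℂ ℂ B : ℝ → ℂ) y = (2 * π * Complex.I * y) * 𝓕 (B : ℝ → ℂ) y := by
      have h4 : (SchwartzMap.derivCLM ℂ ℂ B : ℝ → ℂ) = deriv (B : ℝ → ℂ) := by ext; simp
      have h5 : Integrable (deriv (B : ℝ → ℂ)) := by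
        rw [← h4]; exact (SchwartzMap.derivCLM ℂ ℂ B).integrable
      rw [h4, Real.fourier_deriv B.integrable B.differentiable h5]
      simp
    rw [fourier_linear_combination, h3]
    push_cast
    field_simp
    ring

lemma exists_fourier_mul_quadratic (B : 𝓢(ℝ, ℂ)) (ε y₀ : ℝ) :
    ∃ B' : 𝓢(ℝ, ℂ), tsupport B' ⊆ tsupport B ∧
      ∀ y, 𝓕 (B' : ℝ → ℂ) y = ((1 + ε * (y - y₀) ^ 2 : ℝ) : ℂ) * 𝓕 (B : ℝ → ℂ) y := by
  obtain ⟨B₁, hs₁, h₁⟩ := exists_fourier_mul_sub B y₀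
  obtain ⟨B₂, hs₂, h₂⟩ := exists_fourier_mul_sub B₁ y₀
  refine ⟨(1 : ℂ) • B + (ε : ℂ) • B₂, ?_, fun y => ?_⟩
  · refine closure_minimal (fun η hη => ?_) (isClosed_tsupport _)
    by_contra hn
    apply hη
    have e1 : B η = 0 := image_eq_zero_of_notMem_tsupport hn
    have e2 : B₂ η = 0 := image_eq_zero_of_notMem_tsupport fun h => hn (hs₁ (hs₂ h))
    simp [e1, e2]
  · rw [fourier_linear_combination, h₂, h₁]
    push_cast; ring

/-- The frequency side of a wave packet at scale `2^j`, frequency `k 2^{-j}` and position `x`. -/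
noncomputable def packet (χ : ℝ → ℂ) (j : ℕ) (k : ℤ) (x η : ℝ) : ℂ :=
  χ (2 ^ j * η - k) * Complex.exp (((2 * π * x * η : ℝ) : ℂ) * Complex.I)

/-- The wave packet coefficient of `f`. -/
noncomputable def coef (χ f : ℝ → ℂ) (j : ℕ) (k : ℤ) (x : ℝ) : ℂ :=
  ∫ y, f y * 𝓕 (packet χ j k x) y

lemma exists_schwartz_packet (χ : 𝓢(ℝ, ℂ)) {ρ : ℝ} (hχ : ∀ η, ρ < |η| → χ η = 0)
    (j : ℕ) (k : ℤ) (x : ℝ) :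
    ∃ B : 𝓢(ℝ, ℂ), (B : ℝ → ℂ) = packet χ j k x ∧
      tsupport B ⊆ {η | |2 ^ j * η - k| ≤ ρ} := by
  have hcl : IsClosed {η : ℝ | |2 ^ j * η - k| ≤ ρ} :=
    isClosed_le (by fun_prop) continuous_const
  have hsub : Function.support (packet χ j k x) ⊆ {η | |2 ^ j * η - k| ≤ ρ} := by
    intro η hη
    by_contra hn
    apply hη
    rw [packet, hχ _ (not_le.mp hn), zero_mul]
  have hts : tsupport (packet χ j k x) ⊆ {η | |2 ^ j * η - k| ≤ ρ} := closure_minimal hsub hcl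
  have hcomp : HasCompactSupport (packet χ j k x) := by
    refine HasCompactSupport.of_support_subset_isCompact
      (K := Icc ((k - ρ) / 2 ^ j) ((k + ρ) / 2 ^ j)) isCompact_Icc fun η hη => ?_
    have h := abs_le.mp (show |2 ^ j * η - k| ≤ ρ from hsub hη)
    have h2 : (0 : ℝ) < 2 ^ j := by positivity
    constructor
    · rw [div_le_iff₀ h2]; linarith [h.1]
    · rw [le_div_iff₀ h2]; linarith [h.2]
  have hsm : ContDiff ℝ (⊤ : ℕ∞) (packet χ j k x) := by
    unfold packet
    have h1 : ContDiff ℝ (⊤ : ℕ∞) (fun η : ℝ => χ (2 ^ j * η - k)) :=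
      (χ.smooth _).comp (by fun_prop)
    have h2 : ContDiff ℝ (⊤ : ℕ∞) (fun η : ℝ => (((2 * π * x * η : ℝ) : ℂ) * Complex.I)) :=
      (Complex.ofRealCLM.contDiff.comp (contDiff_const.mul contDiff_id)).mul contDiff_const
    exact h1.mul h2.cexp
  exact ⟨hcomp.toSchwartzMap hsm, rfl, hts⟩

lemma fourier_packet (χ : ℝ → ℂ) (j : ℕ) (k : ℤ) (x y : ℝ) :
    ‖𝓕 (packet χ j k x) y‖ = (2 ^ j : ℝ)⁻¹ * ‖𝓕 χ ((2 ^ j : ℝ)⁻¹ * (y - x))‖ := by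
  have h2 : (0 : ℝ) < 2 ^ j := by positivity
  set θ : ℝ := (2 ^ j : ℝ)⁻¹ * (y - x) with hθ
  have e : 𝓕 (packet χ j k x) y = Complex.exp (((-(2 * π * k * θ) : ℝ) : ℂ) * Complex.I) *
      (((2 ^ j : ℝ)⁻¹ : ℝ) * 𝓕 χ θ) := by
    rw [Real.fourier_real_eq_integral_exp_smul, Real.fourier_real_eq_integral_exp_smul]
    have h3 := Measure.integral_comp_mul_left
      (fun u : ℝ => Complex.exp (((-(2 * π * k * θ) : ℝ) : ℂ) * Complex.I) *
        (Complex.exp (((-2 * π * (u - k) * θ : ℝ) : ℂ) * Complex.I) • χ (u - k))) ((2 : ℝ) ^ j)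
    have h4 : ∫ u : ℝ, Complex.exp (((-(2 * π * k * θ) : ℝ) : ℂ) * Complex.I) *
        (Complex.exp (((-2 * π * (u - k) * θ : ℝ) : ℂ) * Complex.I) • χ (u - k)) =
        Complex.exp (((-(2 * π * k * θ) : ℝ) : ℂ) * Complex.I) *
          ∫ u : ℝ, Complex.exp (((-2 * π * u * θ : ℝ) : ℂ) * Complex.I) • χ u := by
      rw [integral_const_mul]
      congr 1
      exact integral_sub_right_eq_self
        (fun u : ℝ => Complex.exp (((-2 * π * u * θ : ℝ) : ℂ) * Complex.I) • χ u) (k : ℝ)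
    rw [h4, abs_of_pos (inv_pos.mpr h2), Complex.real_smul] at h3
    rw [← mul_assoc, mul_comm (Complex.exp _) (((2 ^ j : ℝ)⁻¹ : ℝ) : ℂ), mul_assoc, ← h3]
    congr 1
    ext η
    rw [packet, smul_eq_mul, smul_eq_mul, mul_comm (χ _), ← mul_assoc, ← mul_assoc,
      ← Complex.exp_add, ← Complex.exp_add]
    congr 2
    rw [← add_mul, ← add_mul, ← Complex.ofReal_add, ← Complex.ofReal_add]
    congr 2
    rw [hθ]
    field_simp
    ring
  rw [e, norm_mul, Complex.norm_exp_ofReal_mul_I, one_mul, norm_mul, Complex.norm_real,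
    Real.norm_of_nonneg (inv_nonneg.mpr h2.le)]

lemma exists_schwartz_decay (Φ : 𝓢(ℝ, ℂ)) :
    ∃ C : ℝ, 0 < C ∧ ∀ v, ‖Φ v‖ ≤ C * bump v ^ 4 := by
  set C := 2 ^ 8 * (Finset.Iic ((8 : ℕ), (0 : ℕ))).sup
    (fun m => SchwartzMap.seminorm ℂ m.1 m.2) Φ with hC
  refine ⟨|C| + 1, by positivity, fun v => ?_⟩
  have h := SchwartzMap.one_add_le_sup_seminorm_apply (𝕜 := ℂ) (m := (8, 0)) (k := 8) (n := 0)
    le_rfl le_rfl Φ v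
  rw [norm_iteratedFDeriv_zero] at h
  have h1 : (1 + v ^ 2) ^ 4 ≤ (1 + ‖v‖) ^ 8 := by
    have : 1 + v ^ 2 ≤ (1 + ‖v‖) ^ 2 := by
      rw [Real.norm_eq_abs]; nlinarith [abs_nonneg v, sq_abs v]
    calc (1 + v ^ 2) ^ 4 ≤ ((1 + ‖v‖) ^ 2) ^ 4 := by gcongr
      _ = _ := by ring
  have h2 : (1 + v ^ 2) ^ 4 * ‖Φ v‖ ≤ |C| + 1 := by
    calc (1 + v ^ 2) ^ 4 * ‖Φ v‖ ≤ (1 + ‖v‖) ^ 8 * ‖Φ v‖ := by gcongr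
      _ ≤ C := h
      _ ≤ |C| + 1 := by linarith [le_abs_self C]
  have h3 : (0 : ℝ) < (1 + v ^ 2) ^ 4 := by positivity
  rw [bump, inv_pow, ← div_eq_mul_inv, le_div_iff₀ h3]
  linarith

end WavePackets

namespace Tile

/-- The point `x` lies in the time interval of `P`. -/
def InTime (P : Tile) (x : ℝ) : Prop :=
  P.pos * (2 : ℝ) ^ P.scale ≤ x ∧ x ≤ (P.pos + 1) * (2 : ℝ) ^ P.scale

lemma integrable_scaled_bump (j : ℕ) (x : ℝ) :
    Integrable fun y : ℝ => (2 ^ j : ℝ)⁻¹ * bump ((2 ^ j : ℝ)⁻¹ * (y - x)) := by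
  have h : Integrable bump := integrable_inv_one_add_sq
  exact ((h.comp_mul_left' (by positivity : (2 ^ j : ℝ)⁻¹ ≠ 0)).comp_sub_right x).const_mul _

lemma integral_scaled_bump (j : ℕ) (x : ℝ) :
    ∫ y : ℝ, (2 ^ j : ℝ)⁻¹ * bump ((2 ^ j : ℝ)⁻¹ * (y - x)) = π := by
  rw [integral_const_mul,
    integral_sub_right_eq_self (fun y : ℝ => bump ((2 ^ j : ℝ)⁻¹ * y)) x,
    Measure.integral_comp_mul_left bump]
  have h2 : (0 : ℝ) < 2 ^ j := by positivity
  rw [inv_inv, abs_of_pos h2, smul_eq_mul, ← mul_assoc, inv_mul_cancel₀ h2.ne', one_mul]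
  exact integral_univ_inv_one_add_sq

lemma InTime.abs_sub_le {P P' : Tile} (hs : P'.scale ≤ P.scale) {x x' : ℝ} (hx : P.InTime x)
    (hx' : P'.InTime x') :
    |(P.pos : ℝ) - ((P'.pos / 2 ^ (P.scale - P'.scale) : ℤ) : ℝ)| ≤
      |(2 ^ P.scale : ℝ)⁻¹ * (x - x')| + 1 := by
  set m : ℤ := P'.pos / 2 ^ (P.scale - P'.scale) with hm
  have hL : (0 : ℝ) < 2 ^ P.scale := by positivity
  have hL' : (0 : ℝ) < 2 ^ P'.scale := by positivity
  have hD : (0 : ℤ) < 2 ^ (P.scale - P'.scale) := by positivity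
  have e : (2 : ℝ) ^ P.scale = 2 ^ (P.scale - P'.scale) * 2 ^ P'.scale := by
    rw [← pow_add, Nat.sub_add_cancel hs]
  have h1 : m * 2 ^ (P.scale - P'.scale) ≤ P'.pos := Int.ediv_mul_le _ hD.ne'
  have h2 : P'.pos + 1 ≤ (m + 1) * 2 ^ (P.scale - P'.scale) :=
    Int.lt_ediv_add_one_mul_self _ hD
  have h1' : (m : ℝ) * 2 ^ (P.scale - P'.scale) ≤ P'.pos := by exact_mod_cast h1
  have h2' : (P'.pos : ℝ) + 1 ≤ (m + 1) * 2 ^ (P.scale - P'.scale) := by exact_mod_cast h2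
  have a1 : m * (2 : ℝ) ^ P.scale ≤ x' := by
    rw [e, ← mul_assoc]
    exact (mul_le_mul_of_nonneg_right h1' hL'.le).trans hx'.1
  have a2 : x' ≤ (m + 1) * (2 : ℝ) ^ P.scale := by
    rw [e, ← mul_assoc]
    exact hx'.2.trans (mul_le_mul_of_nonneg_right h2' hL'.le)
  set u := (2 ^ P.scale : ℝ)⁻¹ * x with hu
  set u' := (2 ^ P.scale : ℝ)⁻¹ * x' with hu'
  have ex : x = u * 2 ^ P.scale := by rw [hu]; field_simp
  have ex' : x' = u' * 2 ^ P.scale := by rw [hu']; field_simp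
  have b1 : (P.pos : ℝ) ≤ u := by
    have := hx.1; rw [ex] at this; exact le_of_mul_le_mul_right this hL
  have b2 : u ≤ P.pos + 1 := by
    have := hx.2; rw [ex] at this; exact le_of_mul_le_mul_right this hL
  have b3 : (m : ℝ) ≤ u' := by rw [ex'] at a1; exact le_of_mul_le_mul_right a1 hL
  have b4 : u' ≤ m + 1 := by rw [ex'] at a2; exact le_of_mul_le_mul_right a2 hL
  rw [mul_sub]
  have := neg_abs_le (u - u'); have := le_abs_self (u - u')
  rw [abs_le]
  constructor <;> linarith

lemma bump_mul_bump_le {P P' : Tile} (hs : P'.scale ≤ P.scale) {x x' : ℝ} (hx : P.InTime x)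
    (hx' : P'.InTime x') (y : ℝ) :
    bump ((2 ^ P.scale : ℝ)⁻¹ * (y - x)) * bump ((2 ^ P'.scale : ℝ)⁻¹ * (y - x')) ≤
      4 * bump ((P.pos : ℝ) - ((P'.pos / 2 ^ (P.scale - P'.scale) : ℤ) : ℝ)) := by
  have h := InTime.abs_sub_le hs hx hx'
  set D := (P.pos : ℝ) - ((P'.pos / 2 ^ (P.scale - P'.scale) : ℤ) : ℝ)
  set v := (2 ^ P.scale : ℝ)⁻¹ * (y - x) with hv
  set v' := (2 ^ P'.scale : ℝ)⁻¹ * (y - x') with hv'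
  have hle : (2 ^ P.scale : ℝ)⁻¹ ≤ (2 ^ P'.scale : ℝ)⁻¹ :=
    inv_anti₀ (by positivity) (pow_le_pow_right₀ (by norm_num) hs)
  have h1 : |(2 ^ P.scale : ℝ)⁻¹ * (x - x')| ≤ |v| + |v'| := by
    have e : (2 ^ P.scale : ℝ)⁻¹ * (x - x') =
        (2 ^ P.scale : ℝ)⁻¹ * (y - x') - (2 ^ P.scale : ℝ)⁻¹ * (y - x) := by ring
    have e2 : |(2 ^ P.scale : ℝ)⁻¹ * (y - x')| ≤ |v'| := by
      rw [hv', abs_mul, abs_mul, abs_of_pos (by positivity : (0 : ℝ) < (2 ^ P.scale)⁻¹),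
        abs_of_pos (by positivity : (0 : ℝ) < (2 ^ P'.scale)⁻¹)]
      gcongr
    rw [e]
    exact (abs_sub _ _).trans (by rw [← hv]; linarith)
  have h2 : D ^ 2 ≤ (|v| + |v'| + 1) ^ 2 := by
    rw [← sq_abs D]; exact pow_le_pow_left₀ (abs_nonneg _) (by linarith) 2
  have h3 : 1 + D ^ 2 ≤ 4 * ((1 + v ^ 2) * (1 + v' ^ 2)) := by
    have := sq_abs v; have := sq_abs v'
    nlinarith [sq_nonneg (|v| - |v'|), sq_nonneg (|v| - 1), sq_nonneg (|v'| - 1),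
      mul_nonneg (sq_nonneg v) (sq_nonneg v')]
  unfold bump
  rw [← mul_inv, ← div_eq_mul_inv, le_div_iff₀ (by positivity), inv_mul_le_iff₀ (by positivity)]
  linarith

lemma integral_mul_le_kern {K : ℝ} {P P' : Tile} {x x' : ℝ} (hx : P.InTime x)
    (hx' : P'.InTime x') {Φ Φ' : ℝ → ℂ}
    (h : ∀ y, ‖Φ y‖ ≤ K * ((2 ^ P.scale : ℝ)⁻¹ * bump ((2 ^ P.scale : ℝ)⁻¹ * (y - x)) ^ 3))
    (h' : ∀ y, ‖Φ' y‖ ≤ K * ((2 ^ P'.scale : ℝ)⁻¹ * bump ((2 ^ P'.scale : ℝ)⁻¹ * (y - x')) ^ 3)) :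
    ‖∫ y, inner ℂ (Φ y) (Φ' y)‖ ≤ 16 * π * K ^ 2 * kern P P' := by
  have hnn : 0 ≤ K := by
    have := (norm_nonneg _).trans (h 0)
    exact nonneg_of_mul_nonneg_left this (mul_pos (by positivity) (pow_pos (bump_pos _) 3))
  wlog hs : P'.scale ≤ P.scale generalizing P P' x x' Φ Φ'
  · have := this hx' hx h' h (not_le.mp hs).le
    rw [kern_comm]
    refine le_trans (le_of_eq ?_) this
    have e : (∫ y, inner ℂ (Φ y) (Φ' y)) = starRingEnd ℂ (∫ y, inner ℂ (Φ' y) (Φ y)) := by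
      rw [← integral_conj]; congr 1; ext y; rw [inner_conj_symm]
    rw [e, RCLike.norm_conj]
  set w := wt ((P.pos : ℝ) - ((P'.pos / 2 ^ (P.scale - P'.scale) : ℤ) : ℝ)) with hw
  have hb : ∀ y, ‖inner ℂ (Φ y) (Φ' y)‖ ≤ (16 * K ^ 2 * (P.len⁻¹ * w)) *
      ((2 ^ P'.scale : ℝ)⁻¹ * bump ((2 ^ P'.scale : ℝ)⁻¹ * (y - x'))) := by
    intro y
    have h1 := bump_mul_bump_le hs hx hx' y
    have b0 := bump_pos ((2 ^ P.scale : ℝ)⁻¹ * (y - x))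
    have b0' := bump_pos ((2 ^ P'.scale : ℝ)⁻¹ * (y - x'))
    have b1 := bump_le_one ((2 ^ P.scale : ℝ)⁻¹ * (y - x))
    set b := bump ((2 ^ P.scale : ℝ)⁻¹ * (y - x))
    set b' := bump ((2 ^ P'.scale : ℝ)⁻¹ * (y - x'))
    have h2 : (b * b') ^ 2 ≤ 16 * w := by
      calc (b * b') ^ 2 ≤ (4 * bump _) ^ 2 := pow_le_pow_left₀ (by positivity) h1 2
        _ = 16 * w := by rw [hw, wt]; ring
    have h3 : b ^ 3 * b' ^ 3 ≤ 16 * w * b' := by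
      calc b ^ 3 * b' ^ 3 = (b * b') ^ 2 * (b * b') := by ring
        _ ≤ 16 * w * (1 * b') := by
          refine mul_le_mul h2 ?_ (by positivity) ((sq_nonneg _).trans h2)
          gcongr
        _ = 16 * w * b' := by ring
    calc ‖inner ℂ (Φ y) (Φ' y)‖ ≤ ‖Φ y‖ * ‖Φ' y‖ := norm_inner_le_norm _ _
      _ ≤ (K * ((2 ^ P.scale : ℝ)⁻¹ * b ^ 3)) * (K * ((2 ^ P'.scale : ℝ)⁻¹ * b' ^ 3)) :=
        mul_le_mul (h y) (h' y) (norm_nonneg _) ((norm_nonneg _).trans (h y))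
      _ = K ^ 2 * (2 ^ P.scale : ℝ)⁻¹ * (2 ^ P'.scale : ℝ)⁻¹ * (b ^ 3 * b' ^ 3) := by ring
      _ ≤ K ^ 2 * (2 ^ P.scale : ℝ)⁻¹ * (2 ^ P'.scale : ℝ)⁻¹ * (16 * w * b') := by gcongr
      _ = _ := by rw [len]; ring
  refine (norm_integral_le_of_norm_le ((integrable_scaled_bump P'.scale x').const_mul _)
    (Filter.Eventually.of_forall hb)).trans (le_of_eq ?_)
  rw [integral_const_mul, integral_scaled_bump, kern, if_pos hs]
  ring

end Tile

section Hilbert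

variable {H : Type*} [NormedAddCommGroup H] [InnerProductSpace ℂ H]

lemma sq_sum_inner_le {ι : Type*} (X : Finset ι) {w : ι → ℝ} (hw : ∀ t, 0 ≤ w t) (F : H)
    (e : ι → H) :
    (∑ t ∈ X, w t * ‖inner ℂ F (e t)‖ ^ 2) ^ 2 ≤ ‖F‖ ^ 2 * ∑ t ∈ X, ∑ t' ∈ X,
      w t * w t' * (‖inner ℂ F (e t)‖ * ‖inner ℂ F (e t')‖ * ‖inner ℂ (e t) (e t')‖) := by
  set c : ι → ℂ := fun t => inner ℂ F (e t) with hc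
  set G : H := ∑ t ∈ X, ((w t : ℂ) * starRingEnd ℂ (c t)) • e t with hG
  have h1 : inner ℂ F G = ((∑ t ∈ X, w t * ‖c t‖ ^ 2 : ℝ) : ℂ) := by
    rw [hG, inner_sum, Complex.ofReal_sum]
    refine Finset.sum_congr rfl fun t _ => ?_
    rw [inner_smul_right, mul_assoc]
    have : starRingEnd ℂ (c t) * c t = ((‖c t‖ ^ 2 : ℝ) : ℂ) := by
      rw [mul_comm, Complex.mul_conj, Complex.normSq_eq_norm_sq]
    rw [show inner ℂ F (e t) = c t from rfl, this]
    push_cast; ring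
  have hS : 0 ≤ ∑ t ∈ X, w t * ‖c t‖ ^ 2 :=
    Finset.sum_nonneg fun t _ => mul_nonneg (hw t) (sq_nonneg _)
  have h2 : ∑ t ∈ X, w t * ‖c t‖ ^ 2 ≤ ‖F‖ * ‖G‖ := by
    have := norm_inner_le_norm (𝕜 := ℂ) F G
    rwa [h1, Complex.norm_real, Real.norm_of_nonneg hS] at this
  have h3 : ‖G‖ ^ 2 ≤ ∑ t ∈ X, ∑ t' ∈ X,
      w t * w t' * (‖c t‖ * ‖c t'‖ * ‖inner ℂ (e t) (e t')‖) := by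
    have e1 : ‖G‖ ^ 2 = ‖inner ℂ G G‖ := by
      rw [inner_self_eq_norm_sq_to_K, norm_pow]; simp
    have e2 : inner ℂ G G = ∑ t ∈ X, ∑ t' ∈ X, (starRingEnd ℂ ((w t : ℂ) * starRingEnd ℂ (c t))) *
        (((w t' : ℂ) * starRingEnd ℂ (c t')) * inner ℂ (e t) (e t')) := by
      rw [hG, sum_inner]
      refine Finset.sum_congr rfl fun t _ => ?_
      rw [inner_smul_left, inner_sum, Finset.mul_sum]
      refine Finset.sum_congr rfl fun t' _ => ?_
      rw [inner_smul_right]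
    rw [e1, e2]
    refine (norm_sum_le _ _).trans (Finset.sum_le_sum fun t _ => (norm_sum_le _ _).trans
      (Finset.sum_le_sum fun t' _ => le_of_eq ?_))
    simp only [norm_mul, RCLike.norm_conj, Complex.norm_real, Real.norm_of_nonneg (hw _)]
    ring
  calc (∑ t ∈ X, w t * ‖c t‖ ^ 2) ^ 2 ≤ (‖F‖ * ‖G‖) ^ 2 := pow_le_pow_left₀ hS h2 2
    _ = ‖F‖ ^ 2 * ‖G‖ ^ 2 := by ring
    _ ≤ _ := by gcongr

lemma sq_sum_inner_fintype_le {Ω : Type*} [Fintype Ω] [DecidableEq Ω] {ι : Type*} (X : Finset ι)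
    {w : ι → ℝ} (hw : ∀ t, 0 ≤ w t) (o : ι → Ω) (F : Ω → H) (e : ι → H) :
    (∑ t ∈ X, w t * ‖inner ℂ (F (o t)) (e t)‖ ^ 2) ^ 2 ≤ (∑ ω, ‖F ω‖ ^ 2) *
      ∑ t ∈ X, ∑ t' ∈ X, if o t = o t' then w t * w t' * (‖inner ℂ (F (o t)) (e t)‖ *
        ‖inner ℂ (F (o t')) (e t')‖ * ‖inner ℂ (e t) (e t')‖) else 0 := by
  have h1 := fun ω => sq_sum_inner_le (X.filter fun t => o t = ω) hw (F ω) e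
  have h2 := Finset.sum_sq_le_sum_mul_sum_of_sq_le_mul Finset.univ
    (fun ω _ => sq_nonneg ‖F ω‖) (fun ω _ => ?_) (fun ω _ => h1 ω)
  · have e1 : ∑ ω, ∑ t ∈ X.filter (fun t => o t = ω), w t * ‖inner ℂ (F ω) (e t)‖ ^ 2 =
        ∑ t ∈ X, w t * ‖inner ℂ (F (o t)) (e t)‖ ^ 2 := by
      rw [← Finset.sum_fiberwise X o]
      refine Finset.sum_congr rfl fun ω _ => Finset.sum_congr rfl fun t ht => ?_
      rw [(Finset.mem_filter.mp ht).2]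
    rw [e1] at h2
    refine h2.trans (mul_le_mul_of_nonneg_left (le_of_eq ?_)
      (Finset.sum_nonneg fun ω _ => sq_nonneg _))
    rw [← Finset.sum_fiberwise X o]
    refine Finset.sum_congr rfl fun ω _ => Finset.sum_congr rfl fun t ht => ?_
    rw [(Finset.mem_filter.mp ht).2, Finset.sum_filter]
    refine Finset.sum_congr rfl fun t' _ => ?_
    by_cases h : o t' = ω
    · rw [if_pos h, if_pos h.symm, h]
    · rw [if_neg h, if_neg (Ne.symm h)]
  · exact Finset.sum_nonneg fun t _ => Finset.sum_nonneg fun t' _ => mul_nonneg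
      (mul_nonneg (hw _) (hw _)) (by positivity)

lemma sq_sum_integral_le {Ω : Type*} [Fintype Ω] [DecidableEq Ω] {ι : Type*} (X : Finset ι)
    {w : ι → ℝ} (hw : ∀ t, 0 ≤ w t) (o : ι → Ω) {f : Ω → ℝ → ℂ} (hf : ∀ ω, MemLp (f ω) 2)
    {Φ : ι → ℝ → ℂ} (hΦ : ∀ t, MemLp (Φ t) 2) :
    (∑ t ∈ X, w t * ‖∫ y, f (o t) y * Φ t y‖ ^ 2) ^ 2 ≤ (∑ ω, ∫ y, ‖f ω y‖ ^ 2) *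
      ∑ t ∈ X, ∑ t' ∈ X, if o t = o t' then w t * w t' * (‖∫ y, f (o t) y * Φ t y‖ *
        ‖∫ y, f (o t') y * Φ t' y‖ * ‖∫ y, inner ℂ (Φ t y) (Φ t' y)‖) else 0 := by
  have hf' : ∀ ω, MemLp (fun y => starRingEnd ℂ (f ω y)) 2 := fun ω => (hf ω).star
  have h := sq_sum_inner_fintype_le X hw o (fun ω => (hf' ω).toLp) (fun t => (hΦ t).toLp)
  have e1 : ∀ ω t, inner ℂ ((hf' ω).toLp) ((hΦ t).toLp) = ∫ y, f ω y * Φ t y := by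
    intro ω t
    rw [L2.inner_def]
    refine integral_congr_ae ?_
    filter_upwards [(hf' ω).coeFn_toLp, (hΦ t).coeFn_toLp] with y h1 h2
    rw [h1, h2, RCLike.inner_apply, starRingEnd_self_apply, mul_comm]
  have e2 : ∀ t t', inner ℂ ((hΦ t).toLp) ((hΦ t').toLp) = ∫ y, inner ℂ (Φ t y) (Φ t' y) := by
    intro t t'
    rw [L2.inner_def]
    refine integral_congr_ae ?_
    filter_upwards [(hΦ t).coeFn_toLp, (hΦ t').coeFn_toLp] with y h1 h2
    rw [h1, h2]
  have e3 : ∀ ω, ‖(hf' ω).toLp‖ ^ 2 = ∫ y, ‖f ω y‖ ^ 2 := by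
    intro ω
    have h1 : ((‖(hf' ω).toLp‖ ^ 2 : ℝ) : ℂ) = ((∫ y, ‖f ω y‖ ^ 2 : ℝ) : ℂ) := by
      have := inner_self_eq_norm_sq_to_K (𝕜 := ℂ) ((hf' ω).toLp)
      rw [L2.inner_def] at this
      push_cast
      rw [show ((‖(hf' ω).toLp‖ : ℂ)) = ((‖(hf' ω).toLp‖ : ℝ) : ℂ) from rfl]
      rw [← integral_complex_ofReal]
      refine Eq.trans this.symm (integral_congr_ae ?_)
      filter_upwards [(hf' ω).coeFn_toLp] with y h1
      rw [h1, inner_self_eq_norm_sq_to_K]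
      simp
    exact_mod_cast h1
  simp only [e1, e2, e3] at h
  exact h

end Hilbert

lemma sum_sum_ite_mul_le {α β : Type*} (s : Finset α) (s' : Finset β) (R : α → β → Prop)
    [∀ a b, Decidable (R a b)] (n : ℕ)
    (h₁ : ∀ a ∈ s, (s'.filter (fun b => R a b)).card ≤ n)
    (h₂ : ∀ b ∈ s', (s.filter (fun a => R a b)).card ≤ n) (u : α → ℝ) (v : β → ℝ) :
    ∑ a ∈ s, ∑ b ∈ s', (if R a b then u a * v b else 0) ≤
      n * (√(∑ a ∈ s, u a ^ 2) * √(∑ b ∈ s', v b ^ 2)) := by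
  have hcs := Finset.sum_mul_sq_le_sq_mul_sq (s ×ˢ s')
    (fun t => if R t.1 t.2 then u t.1 else 0) (fun t => if R t.1 t.2 then v t.2 else 0)
  have e0 : ∑ t ∈ s ×ˢ s', (if R t.1 t.2 then u t.1 else 0) * (if R t.1 t.2 then v t.2 else 0) =
      ∑ a ∈ s, ∑ b ∈ s', (if R a b then u a * v b else 0) := by
    rw [Finset.sum_product]
    refine Finset.sum_congr rfl fun a _ => Finset.sum_congr rfl fun b _ => ?_
    split_ifs <;> simp
  have e1 : ∑ t ∈ s ×ˢ s', (if R t.1 t.2 then u t.1 else 0) ^ 2 ≤ n * ∑ a ∈ s, u a ^ 2 := by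
    rw [Finset.sum_product, Finset.mul_sum]
    refine Finset.sum_le_sum fun a ha => ?_
    have : ∑ b ∈ s', (if R a b then u a else 0) ^ 2 =
        ((s'.filter (fun b => R a b)).card : ℝ) * u a ^ 2 := by
      rw [← nsmul_eq_mul, ← Finset.sum_const, Finset.sum_filter]
      refine Finset.sum_congr rfl fun b _ => ?_
      split_ifs <;> simp
    rw [this]
    exact mul_le_mul_of_nonneg_right (by exact_mod_cast h₁ a ha) (sq_nonneg _)
  have e2 : ∑ t ∈ s ×ˢ s', (if R t.1 t.2 then v t.2 else 0) ^ 2 ≤ n * ∑ b ∈ s', v b ^ 2 := by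
    rw [Finset.sum_product_right, Finset.mul_sum]
    refine Finset.sum_le_sum fun b hb => ?_
    have : ∑ a ∈ s, (if R a b then v b else 0) ^ 2 =
        ((s.filter (fun a => R a b)).card : ℝ) * v b ^ 2 := by
      rw [← nsmul_eq_mul, ← Finset.sum_const, Finset.sum_filter]
      refine Finset.sum_congr rfl fun a _ => ?_
      split_ifs <;> simp
    rw [this]
    exact mul_le_mul_of_nonneg_right (by exact_mod_cast h₂ b hb) (sq_nonneg _)
  rw [e0] at hcs
  have hU : 0 ≤ ∑ a ∈ s, u a ^ 2 := Finset.sum_nonneg fun _ _ => sq_nonneg _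
  have hV : 0 ≤ ∑ b ∈ s', v b ^ 2 := Finset.sum_nonneg fun _ _ => sq_nonneg _
  refine abs_le_of_sq_le_sq' ?_ (by positivity) |>.2
  refine hcs.trans ((mul_le_mul e1 e2 (Finset.sum_nonneg fun _ _ => sq_nonneg _)
    (by positivity)).trans (le_of_eq ?_))
  rw [mul_pow, mul_pow, Real.sq_sqrt hU, Real.sq_sqrt hV]
  ring

/-- A choice, for every tile, of finitely many wave packets adapted to it. -/
structure Sampling (α Ω : Type*) where
  /-- The wave packets attached to a tile. -/
  atoms : Tile → Finset α
  /-- The function which is tested. -/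
  idx : α → Ω
  /-- The normalised frequency. -/
  freq : α → ℤ
  /-- The sampling point. -/
  pt : Tile → α → ℝ

namespace Sampling

variable {α Ω : Type*} (D : Sampling α Ω)

/-- Two wave packets of the same function whose frequency supports may intersect. -/
def Rel (ρ : ℝ) (P : Tile) (a : α) (P' : Tile) (a' : α) : Prop :=
  D.idx a = D.idx a' ∧
    ∃ η : ℝ, |2 ^ P.scale * η - D.freq a| ≤ ρ ∧ |2 ^ P'.scale * η - D.freq a'| ≤ ρ

variable {D} in
lemma Rel.symm {ρ : ℝ} {P P' : Tile} {a a' : α} (h : D.Rel ρ P a P' a') : D.Rel ρ P' a' P a :=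
  ⟨h.1.symm, h.2.imp fun _ h => h.symm⟩

open scoped Classical in
/-- The geometric hypotheses on a sampling. -/
structure Valid (ρ B d : ℝ) (n₀ : ℕ) (U : Finset Tile) : Prop where
  inTime : ∀ P ∈ U, ∀ a ∈ D.atoms P, P.InTime (D.pt P a)
  near : ∀ P ∈ U, ∀ P' ∈ U, ∀ a ∈ D.atoms P, ∀ a' ∈ D.atoms P', D.Rel ρ P a P' a' →
    Tile.Near B d P P'
  count : ∀ P ∈ U, ∀ P' ∈ U, ∀ a ∈ D.atoms P,
    ((D.atoms P').filter (fun a' => D.Rel ρ P a P' a')).card ≤ n₀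

variable {D} in
lemma Valid.mono {ρ B d : ℝ} {n₀ : ℕ} {U U' : Finset Tile} (h : D.Valid ρ B d n₀ U)
    (hU : U' ⊆ U) : D.Valid ρ B d n₀ U' := by
  classical
  exact ⟨fun P hP => h.inTime P (hU hP), fun P hP P' hP' => h.near P (hU hP) P' (hU hP'),
    fun P hP P' hP' => h.count P (hU hP) P' (hU hP')⟩

/-- The wave packet coefficient at an atom. -/
noncomputable def atomCoef (χ : ℝ → ℂ) (f : Ω → ℝ → ℂ) (P : Tile) (a : α) : ℂ :=
  coef χ (f (D.idx a)) P.scale (D.freq a) (D.pt P a)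

/-- The square function of the wave packet coefficients on a tile. -/
noncomputable def amp (χ : ℝ → ℂ) (f : Ω → ℝ → ℂ) (P : Tile) : ℝ :=
  √(∑ a ∈ D.atoms P, ‖D.atomCoef χ f P a‖ ^ 2)

lemma amp_nonneg (χ : ℝ → ℂ) (f : Ω → ℝ → ℂ) (P : Tile) : 0 ≤ D.amp χ f P := Real.sqrt_nonneg _

lemma amp_sq (χ : ℝ → ℂ) (f : Ω → ℝ → ℂ) (P : Tile) :
    D.amp χ f P ^ 2 = ∑ a ∈ D.atoms P, ‖D.atomCoef χ f P a‖ ^ 2 :=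
  Real.sq_sqrt (Finset.sum_nonneg fun _ _ => sq_nonneg _)

end Sampling

open scoped FourierTransform SchwartzMap

/-- The constant in the `TT*` inequality. -/
noncomputable def ttConst (n₀ : ℕ) (K : ℝ) : ℝ := n₀ * (16 * π * (3 * K) ^ 2)

lemma quadratic_le {ε s x y y₀ : ℝ} (hε : 0 ≤ ε) (hs : 0 < s) (h₁ : ε ≤ s ^ 2)
    (h₂ : ε * (x - y₀) ^ 2 ≤ 1) :
    1 + ε * (y - y₀) ^ 2 ≤ 3 * (1 + (s * (y - x)) ^ 2) := by
  have e : (y - y₀) ^ 2 ≤ 2 * (y - x) ^ 2 + 2 * (x - y₀) ^ 2 := by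
    nlinarith [sq_nonneg ((y - x) - (x - y₀))]
  have e2 := mul_le_mul_of_nonneg_left e hε
  have e3 := mul_le_mul_of_nonneg_right h₁ (sq_nonneg (y - x))
  rw [mul_pow]
  nlinarith [mul_nonneg (sq_nonneg s) (sq_nonneg (y - x))]

theorem Sampling.ttStar {α Ω : Type*} [Fintype Ω] (D : Sampling α Ω) {χ : 𝓢(ℝ, ℂ)}
    {ρ K : ℝ} (hχ : ∀ η, ρ < |η| → χ η = 0)
    (hK : ∀ v, ‖𝓕 (χ : ℝ → ℂ) v‖ ≤ K * bump v ^ 4) {B d : ℝ} {n₀ : ℕ} {U : Finset Tile}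
    (hD : D.Valid ρ B d n₀ U) {f : Ω → ℝ → ℂ} (hf : ∀ ω, MemLp (f ω) 2) {ε y₀ : ℝ} (hε : 0 ≤ ε)
    (hε₁ : ∀ P ∈ U, ε ≤ ((2 ^ P.scale : ℝ)⁻¹) ^ 2)
    (hε₂ : ∀ P ∈ U, ∀ a ∈ D.atoms P, ε * (D.pt P a - y₀) ^ 2 ≤ 1) :
    Tile.TTStar B d (D.amp χ f) U
      (ttConst n₀ K * ∑ ω, ∫ y, ‖f ω y‖ ^ 2 * ((1 + ε * (y - y₀) ^ 2)⁻¹) ^ 2) := by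
  classical
  intro V hV
  have hD' := hD.mono hV
  set q : ℝ → ℝ := fun y => 1 + ε * (y - y₀) ^ 2 with hq
  have hq1 : ∀ y, 1 ≤ q y := fun y => by
    have := mul_nonneg hε (sq_nonneg (y - y₀)); simp only [hq]; linarith
  have hq0 : ∀ y, (q y : ℂ) ≠ 0 := fun y => by
    exact_mod_cast (zero_lt_one.trans_le (hq1 y)).ne'
  have hchoose : ∀ t : (_ : Tile) × α, ∃ B' : 𝓢(ℝ, ℂ),
      tsupport B' ⊆ {η | |2 ^ t.1.scale * η - D.freq t.2| ≤ ρ} ∧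
      ∀ y, 𝓕 (B' : ℝ → ℂ) y =
        (q y : ℂ) * 𝓕 (packet χ t.1.scale (D.freq t.2) (D.pt t.1 t.2)) y := by
    intro t
    obtain ⟨B₀, h1, h2⟩ := exists_schwartz_packet χ hχ t.1.scale (D.freq t.2) (D.pt t.1 t.2)
    obtain ⟨B', h3, h4⟩ := exists_fourier_mul_quadratic B₀ ε y₀
    exact ⟨B', h3.trans h2, fun y => by rw [h4, h1]⟩
  choose Bt hBs hBF using hchoose
  set Φ : (_ : Tile) × α → ℝ → ℂ := fun t => 𝓕 (Bt t : ℝ → ℂ) with hΦ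
  have hΦL : ∀ t, MemLp (Φ t) 2 := fun t => (𝓕 (Bt t) : 𝓢(ℝ, ℂ)).memLp 2 volume
  set g : Ω → ℝ → ℂ := fun ω y => f ω y * (q y : ℂ)⁻¹ with hg
  have hgL : ∀ ω, MemLp (g ω) 2 := by
    intro ω
    refine (hf ω).of_le ((hf ω).1.mul ?_) (Filter.Eventually.of_forall fun y => ?_)
    · refine Continuous.aestronglyMeasurable (Continuous.inv₀ ?_ hq0)
      exact Complex.continuous_ofReal.comp (by simp only [hq]; fun_prop)
    · rw [hg, norm_mul, norm_inv, Complex.norm_real,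
        Real.norm_of_nonneg (zero_le_one.trans (hq1 y))]
      exact mul_le_of_le_one_right (norm_nonneg _) (inv_le_one_of_one_le₀ (hq1 y))
  have hcoef : ∀ t : (_ : Tile) × α, ∫ y, g (D.idx t.2) y * Φ t y = D.atomCoef χ f t.1 t.2 := by
    intro t
    rw [Sampling.atomCoef, coef]
    congr 1
    ext y
    simp only [hg, hΦ]
    rw [hBF, mul_assoc, inv_mul_cancel_left₀ (hq0 y)]
  have hg2 : ∀ ω, ∫ y, ‖g ω y‖ ^ 2 = ∫ y, ‖f ω y‖ ^ 2 * ((1 + ε * (y - y₀) ^ 2)⁻¹) ^ 2 := by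
    intro ω
    congr 1
    ext y
    simp only [hg]
    rw [norm_mul, norm_inv, Complex.norm_real, Real.norm_of_nonneg (zero_le_one.trans (hq1 y)),
      mul_pow]
  have key := sq_sum_integral_le (V.sigma D.atoms) (w := fun t => t.1.len)
    (fun t => t.1.len_pos.le) (fun t => D.idx t.2) hgL hΦL
  simp only [hcoef, hg2] at key
  rw [Finset.sum_sigma] at key
  have e1 : ∑ P ∈ V, ∑ a ∈ D.atoms P, P.len * ‖D.atomCoef χ f P a‖ ^ 2 =
      Tile.energy (D.amp χ f) V := by
    refine Finset.sum_congr rfl fun P _ => ?_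
    rw [D.amp_sq, Finset.mul_sum]
  simp only [] at key
  rw [e1] at key
  refine key.trans ?_
  rw [mul_comm (ttConst n₀ K), mul_assoc]
  refine mul_le_mul_of_nonneg_left ?_
    (Finset.sum_nonneg fun ω _ => integral_nonneg fun y => by positivity)
  set L := 16 * π * (3 * K) ^ 2 with hL
  have hL0 : 0 ≤ L := by positivity
  have hdecay : ∀ P ∈ V, ∀ a ∈ D.atoms P, ∀ y, ‖Φ ⟨P, a⟩ y‖ ≤
      3 * K * ((2 ^ P.scale : ℝ)⁻¹ * bump ((2 ^ P.scale : ℝ)⁻¹ * (y - D.pt P a)) ^ 3) := by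
    intro P hP a ha y
    simp only [hΦ]
    rw [hBF, norm_mul, fourier_packet, Complex.norm_real,
      Real.norm_of_nonneg (zero_le_one.trans (hq1 y))]
    have h1 := hK ((2 ^ P.scale : ℝ)⁻¹ * (y - D.pt P a))
    have h2 : q y ≤ _ := quadratic_le (x := D.pt P a) (y := y) hε
      (by positivity : (0 : ℝ) < (2 ^ P.scale)⁻¹) (hε₁ P (hV hP)) (hε₂ P (hV hP) a ha)
    set v := (2 ^ P.scale : ℝ)⁻¹ * (y - D.pt P a)
    have h3 : (1 + v ^ 2) * bump v = 1 := mul_inv_cancel₀ (by positivity)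
    calc q y * ((2 ^ P.scale : ℝ)⁻¹ * ‖𝓕 (χ : ℝ → ℂ) v‖)
        ≤ (3 * (1 + v ^ 2)) * ((2 ^ P.scale : ℝ)⁻¹ * (K * bump v ^ 4)) := by gcongr
      _ = 3 * K * ((2 ^ P.scale : ℝ)⁻¹ * bump v ^ 3) * ((1 + v ^ 2) * bump v) := by ring
      _ = _ := by rw [h3, mul_one]
  have hterm : ∀ P ∈ V, ∀ P' ∈ V, ∀ a ∈ D.atoms P, ∀ a' ∈ D.atoms P',
      (if D.idx a = D.idx a' then P.len * P'.len * (‖D.atomCoef χ f P a‖ *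
        ‖D.atomCoef χ f P' a'‖ * ‖∫ y, inner ℂ (Φ ⟨P, a⟩ y) (Φ ⟨P', a'⟩ y)‖) else 0) ≤
      P.len * P'.len * (L * Tile.kern P P') * (if D.Rel ρ P a P' a' then
        ‖D.atomCoef χ f P a‖ * ‖D.atomCoef χ f P' a'‖ else 0) := by
    intro P hP P' hP' a ha a' ha'
    have hp := P.len_pos
    have hp' := P'.len_pos
    have hk := Tile.kern_pos P P'
    by_cases hR : D.Rel ρ P a P' a'
    · rw [if_pos hR, if_pos hR.1]
      have h1 := Tile.integral_mul_le_kern (hD'.inTime P hP a ha) (hD'.inTime P' hP' a' ha')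
        (hdecay P hP a ha) (hdecay P' hP' a' ha')
      calc _ ≤ P.len * P'.len * (‖D.atomCoef χ f P a‖ * ‖D.atomCoef χ f P' a'‖ *
            (L * Tile.kern P P')) := by gcongr
        _ = _ := by ring
    · rw [if_neg hR, mul_zero]
      split_ifs with hidx
      · have h1 : ∫ y, inner ℂ (Φ ⟨P, a⟩ y) (Φ ⟨P', a'⟩ y) = 0 := by
          have h2 := SchwartzMap.integral_inner_fourier_fourier (Bt ⟨P, a⟩) (Bt ⟨P', a'⟩)
          refine Eq.trans h2 ?_
          rw [← integral_zero ℝ ℂ]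
          congr 1
          ext η
          by_cases m1 : η ∈ tsupport (Bt ⟨P, a⟩)
          · by_cases m2 : η ∈ tsupport (Bt ⟨P', a'⟩)
            · exact absurd ⟨hidx, η, hBs _ m1, hBs _ m2⟩ hR
            · rw [image_eq_zero_of_notMem_tsupport m2, inner_zero_right]
          · rw [image_eq_zero_of_notMem_tsupport m1, inner_zero_left]
        rw [h1]; simp
      · exact le_rfl
  have hpair : ∀ P ∈ V, ∀ P' ∈ V, ∑ a ∈ D.atoms P, ∑ a' ∈ D.atoms P',
      (if D.idx a = D.idx a' then P.len * P'.len * (‖D.atomCoef χ f P a‖ *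
        ‖D.atomCoef χ f P' a'‖ * ‖∫ y, inner ℂ (Φ ⟨P, a⟩ y) (Φ ⟨P', a'⟩ y)‖) else 0) ≤
      if Tile.Near B d P P' then n₀ * L * (P.len * P'.len * D.amp χ f P * D.amp χ f P' *
        Tile.kern P P') else 0 := by
    intro P hP P' hP'
    have hp := P.len_pos
    have hp' := P'.len_pos
    have hk := Tile.kern_pos P P'
    have h1 := Finset.sum_le_sum fun a ha => Finset.sum_le_sum fun a' ha' =>
      hterm P hP P' hP' a ha a' ha'
    refine h1.trans ?_
    simp only [← Finset.mul_sum]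
    split_ifs with hN
    · have h2 := sum_sum_ite_mul_le (D.atoms P) (D.atoms P') (fun a a' => D.Rel ρ P a P' a') n₀
        (fun a ha => hD'.count P hP P' hP' a ha)
        (fun a' ha' => by
          have := hD'.count P' hP' P hP a' ha'
          refine le_trans (Finset.card_le_card fun a h => ?_) this
          have h := Finset.mem_filter.mp h
          exact Finset.mem_filter.mpr ⟨h.1, h.2.symm⟩)
        (fun a => ‖D.atomCoef χ f P a‖) (fun a' => ‖D.atomCoef χ f P' a'‖)
      calc _ ≤ P.len * P'.len * (L * Tile.kern P P') * (n₀ * (D.amp χ f P * D.amp χ f P')) :=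
            mul_le_mul_of_nonneg_left h2 (by positivity)
        _ = _ := by ring
    · refine le_of_eq (mul_eq_zero_of_right _ ?_)
      refine Finset.sum_eq_zero fun a ha => Finset.sum_eq_zero fun a' ha' => if_neg fun hR => ?_
      exact hN (hD'.near P hP P' hP' a ha a' ha' hR)
  rw [Finset.sum_sigma]
  have e2 : ∀ P ∈ V, ∑ a ∈ D.atoms P, ∑ t' ∈ V.sigma D.atoms,
      (if D.idx a = D.idx t'.2 then P.len * t'.1.len * (‖D.atomCoef χ f P a‖ *
        ‖D.atomCoef χ f t'.1 t'.2‖ * ‖∫ y, inner ℂ (Φ ⟨P, a⟩ y) (Φ t' y)‖) else 0) ≤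
      n₀ * L * ∑ P' ∈ V.filter (Tile.Near B d P), P.len * P'.len * D.amp χ f P * D.amp χ f P' *
        Tile.kern P P' := by
    intro P hP
    rw [Finset.sum_comm, Finset.sum_sigma, Finset.mul_sum, Finset.sum_filter]
    refine Finset.sum_le_sum fun P' hP' => ?_
    rw [Finset.sum_comm]
    exact hpair P hP P' hP'
  refine (Finset.sum_le_sum e2).trans (le_of_eq ?_)
  rw [← Finset.mul_sum, ttConst, Tile.pairSum]

lemma sum_geometric_le {p y : ℝ} (hp : 2 < p) (hy : 0 ≤ y) (K : Finset ℤ) :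
    ∑ k ∈ K, (if (2 : ℝ) ^ ((k : ℝ) / p) < y then (2 : ℝ) ^ ((k : ℝ) * (1 - 2 / p)) else 0) ≤
      (1 - (2 : ℝ) ^ (-(1 - 2 / p)))⁻¹ * y ^ (p - 2) := by
  have hγ : 0 < 1 - 2 / p := by rw [sub_pos, div_lt_one (by linarith)]; exact hp
  set γ := 1 - 2 / p with hγd
  set b : ℝ := 2 ^ (-γ) with hb
  have hb0 : 0 < b := by positivity
  have hb1 : b < 1 := Real.rpow_lt_one_of_one_lt_of_neg one_lt_two (by linarith)
  have hb2 : 0 ≤ (1 - b)⁻¹ := inv_nonneg.mpr (by linarith)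
  rw [← Finset.sum_filter]
  set K' := K.filter (fun k : ℤ => (2 : ℝ) ^ ((k : ℝ) / p) < y) with hK'
  rcases K'.eq_empty_or_nonempty with he | hne
  · rw [he, Finset.sum_empty]; positivity
  set k₀ := K'.max' hne with hk₀
  have hk₀y : (2 : ℝ) ^ ((k₀ : ℝ) / p) < y := (Finset.mem_filter.mp (K'.max'_mem hne)).2
  have h1 : ∀ k ∈ K', (2 : ℝ) ^ ((k : ℝ) * γ) = 2 ^ ((k₀ : ℝ) * γ) * b ^ (k₀ - k).toNat := by
    intro k hk
    have hle : k ≤ k₀ := K'.le_max' k hk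
    rw [hb, ← Real.rpow_natCast, ← Real.rpow_mul (by norm_num), ← Real.rpow_add (by norm_num)]
    congr 1
    have : (((k₀ - k).toNat : ℕ) : ℝ) = (k₀ : ℝ) - k := by
      have : (((k₀ - k).toNat : ℕ) : ℤ) = k₀ - k := Int.toNat_of_nonneg (by omega)
      exact_mod_cast this
    rw [this]; ring
  have h2 : ∑ k ∈ K', b ^ (k₀ - k).toNat ≤ (1 - b)⁻¹ := by
    have hinj : Set.InjOn (fun k : ℤ => (k₀ - k).toNat) K' := by
      intro k hk k' hk' h
      have := K'.le_max' k hk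
      have := K'.le_max' k' hk'
      simp only at h
      omega
    rw [← Finset.sum_image (f := fun n : ℕ => b ^ n) hinj, ← tsum_geometric_of_lt_one hb0.le hb1]
    exact (summable_geometric_of_lt_one hb0.le hb1).sum_le_tsum _ (fun _ _ => by positivity)
  rw [Finset.sum_congr rfl h1, ← Finset.mul_sum]
  have h3 : (2 : ℝ) ^ ((k₀ : ℝ) * γ) ≤ y ^ (p - 2) := by
    have : (2 : ℝ) ^ ((k₀ : ℝ) * γ) = (2 ^ ((k₀ : ℝ) / p)) ^ (p - 2) := by
      rw [← Real.rpow_mul (by norm_num)]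
      congr 1
      rw [hγd]; field_simp
    rw [this]
    exact Real.rpow_le_rpow (by positivity) hk₀y.le (by linarith)
  calc _ ≤ y ^ (p - 2) * (1 - b)⁻¹ := mul_le_mul h3 h2
        (Finset.sum_nonneg fun _ _ => by positivity) (by positivity)
    _ = _ := mul_comm _ _

namespace Tile

lemma pairSum_nonneg {B d : ℝ} {F : Tile → ℝ} (hF : ∀ P, 0 ≤ F P) (V : Finset Tile) :
    0 ≤ pairSum B d F V := by
  classical
  refine Finset.sum_nonneg fun P _ => Finset.sum_nonneg fun P' _ => ?_
  have := P.len_pos; have := P'.len_pos; have := hF P; have := hF P'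
  have := kern_pos P P'
  positivity

lemma TTStar.mono_const {B d : ℝ} {F : Tile → ℝ} (hF : ∀ P, 0 ≤ F P) {U : Finset Tile}
    {E E' : ℝ} (h : TTStar B d F U E) (hE : E ≤ E') : TTStar B d F U E' :=
  fun V hV => (h V hV).trans (mul_le_mul_of_nonneg_right hE (pairSum_nonneg hF V))

lemma Below.sub_sq_le {j : ℕ} {i : ℤ} {P : Tile} (h : Below j i P) {x : ℝ} (hx : P.InTime x) :
    ((2 ^ j : ℝ)⁻¹) ^ 2 * (x - i * 2 ^ j) ^ 2 ≤ 1 := by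
  have hL : (0 : ℝ) < 2 ^ j := by positivity
  have hL' : (0 : ℝ) < 2 ^ P.scale := by positivity
  have hD : (0 : ℤ) < 2 ^ (j - P.scale) := by positivity
  have e : (2 : ℝ) ^ j = 2 ^ (j - P.scale) * 2 ^ P.scale := by
    rw [← pow_add, Nat.sub_add_cancel h.1]
  have h1 : i * 2 ^ (j - P.scale) ≤ P.pos := by
    rw [← h.2]; exact Int.ediv_mul_le _ hD.ne'
  have h2 : P.pos + 1 ≤ (i + 1) * 2 ^ (j - P.scale) := by
    rw [← h.2]; exact Int.lt_ediv_add_one_mul_self _ hD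
  have h1' : (i : ℝ) * 2 ^ (j - P.scale) ≤ P.pos := by exact_mod_cast h1
  have h2' : (P.pos : ℝ) + 1 ≤ (i + 1) * 2 ^ (j - P.scale) := by exact_mod_cast h2
  have a1 : i * (2 : ℝ) ^ j ≤ x := by
    rw [e, ← mul_assoc]
    exact (mul_le_mul_of_nonneg_right h1' hL'.le).trans hx.1
  have a2 : x ≤ (i + 1) * (2 : ℝ) ^ j := by
    rw [e, ← mul_assoc]
    exact hx.2.trans (mul_le_mul_of_nonneg_right h2' hL'.le)
  rw [← mul_pow]
  have b1 : 0 ≤ (2 ^ j : ℝ)⁻¹ * (x - i * 2 ^ j) := mul_nonneg (by positivity) (by linarith)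
  have b2 : (2 ^ j : ℝ)⁻¹ * (x - i * 2 ^ j) ≤ 1 := by
    rw [inv_mul_le_iff₀ hL]; linarith
  exact pow_le_one₀ b1 b2

lemma Below.inv_sq_le {j : ℕ} {i : ℤ} {P : Tile} (h : Below j i P) :
    ((2 ^ j : ℝ)⁻¹) ^ 2 ≤ ((2 ^ P.scale : ℝ)⁻¹) ^ 2 := by
  refine pow_le_pow_left₀ (by positivity) (inv_anti₀ (by positivity) ?_) 2
  exact pow_le_pow_right₀ (by norm_num) h.1

end Tile

namespace Sampling

variable {α Ω : Type*} [Fintype Ω] (D : Sampling α Ω)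

lemma integrable_sq {f : ℝ → ℂ} (hf : MemLp f 2) : Integrable fun y => ‖f y‖ ^ 2 :=
  (memLp_two_iff_integrable_sq_norm hf.1).mp hf

lemma integrable_sum_sq {f : Ω → ℝ → ℂ} (hf : ∀ ω, MemLp (f ω) 2) :
    Integrable fun y => ∑ ω, ‖f ω y‖ ^ 2 :=
  integrable_finsetSum _ fun ω _ => integrable_sq (hf ω)

/-- Bounded functions have bounded size. -/
lemma sizeLE_of_bounded {χ : 𝓢(ℝ, ℂ)} {ρ K : ℝ} (hχ : ∀ η, ρ < |η| → χ η = 0)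
    (hK : ∀ v, ‖𝓕 (χ : ℝ → ℂ) v‖ ≤ K * bump v ^ 4) {A B C d σ s H : ℝ} {n₀ J : ℕ}
    (hadm : Tile.Admissible A B C d J) (hσ : σ = 1 ∨ σ = -1) {S : Finset Tile}
    (hD : D.Valid ρ B d n₀ S) {f : Ω → ℝ → ℂ} (hf : ∀ ω, MemLp (f ω) 2)
    (hH : ∀ y, ∑ ω, ‖f ω y‖ ^ 2 ≤ H ^ 2)
    (hs : Tile.nearConst B J * (ttConst n₀ K * (π * H ^ 2)) ≤ s ^ 2) (I : Finset (ℕ × ℤ)) :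
    Tile.SizeLE A C d σ (D.amp χ f) I S s := by
  have htc : 0 ≤ ttConst n₀ K := by unfold ttConst; positivity
  refine Tile.sizeLE_of_ttStar hadm hσ
    (fun T => ttConst n₀ K * (π * H ^ 2 * 2 ^ T.scale)) (fun T => by positivity) ?_ ?_
  · intro T V hV hbelow
    have hDV := hD.mono hV
    refine (D.ttStar (ε := ((2 ^ T.scale : ℝ)⁻¹) ^ 2) (y₀ := T.pos * 2 ^ T.scale) hχ hK hDV hf
      (by positivity) (fun P hP => (hbelow P hP).inv_sq_le)
      (fun P hP a ha => (hbelow P hP).sub_sq_le (hDV.inTime P hP a ha))).mono_const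
      (D.amp_nonneg χ f) (mul_le_mul_of_nonneg_left ?_ htc)
    set q : ℝ → ℝ := fun y =>
      (1 + ((2 ^ T.scale : ℝ)⁻¹) ^ 2 * (y - T.pos * 2 ^ T.scale) ^ 2)⁻¹ with hq
    have hq0 : ∀ y, 0 ≤ q y := fun y => by simp only [hq]; positivity
    have hq1 : ∀ y, q y ≤ 1 := fun y => by
      simp only [hq]
      refine inv_le_one_of_one_le₀ ?_
      have : 0 ≤ ((2 ^ T.scale : ℝ)⁻¹) ^ 2 * (y - T.pos * 2 ^ T.scale) ^ 2 := by positivity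
      linarith
    have hqm : Continuous q := by
      simp only [hq]
      exact Continuous.inv₀ (by fun_prop) (fun y => by positivity)
    have h_integ : ∀ ω, Integrable fun y => ‖f ω y‖ ^ 2 * q y ^ 2 := by
      intro ω
      refine (integrable_sq (hf ω)).mono (((integrable_sq (hf ω)).1).mul
        (hqm.pow 2).aestronglyMeasurable) (Filter.Eventually.of_forall fun y => ?_)
      rw [norm_mul, Real.norm_of_nonneg (sq_nonneg (q y))]
      exact mul_le_of_le_one_right (norm_nonneg _) (pow_le_one₀ (hq0 y) (hq1 y))
    rw [← integral_finsetSum _ fun ω _ => h_integ ω]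
    have hqe : ∀ y, q y = 2 ^ T.scale * ((2 ^ T.scale : ℝ)⁻¹ *
        bump ((2 ^ T.scale : ℝ)⁻¹ * (y - T.pos * 2 ^ T.scale))) := by
      intro y
      rw [← mul_assoc, mul_inv_cancel₀ (by positivity), one_mul, bump, mul_pow]
    have hqi : ∫ y, q y = 2 ^ T.scale * π := by
      simp only [hqe]
      rw [integral_const_mul, Tile.integral_scaled_bump]
    have hqI : Integrable q := by
      rw [show q = _ from funext hqe]
      exact (Tile.integrable_scaled_bump _ _).const_mul _
    calc ∫ y, ∑ ω, ‖f ω y‖ ^ 2 * q y ^ 2 ≤ ∫ y, H ^ 2 * q y := by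
          refine integral_mono (integrable_finsetSum _ fun ω _ => h_integ ω) (hqI.const_mul _)
            fun y => ?_
          simp only
          rw [← Finset.sum_mul]
          refine mul_le_mul (hH y) ?_ (sq_nonneg _) (sq_nonneg _)
          nlinarith [hq0 y, hq1 y]
      _ = _ := by rw [integral_const_mul, hqi]; ring
  · intro T
    have h2 : (0 : ℝ) < 2 ^ T.scale := by positivity
    calc _ = Tile.nearConst B J * (ttConst n₀ K * (π * H ^ 2)) * 2 ^ T.scale := by ring
      _ ≤ _ := mul_le_mul_of_nonneg_right hs h2.le

lemma amp_sq_add_le {χ : 𝓢(ℝ, ℂ)} {ρ : ℝ} (hχ : ∀ η, ρ < |η| → χ η = 0)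
    {f g h : Ω → ℝ → ℂ} (hf : ∀ ω, MemLp (f ω) 2) (hg : ∀ ω, MemLp (g ω) 2)
    (hfg : ∀ ω y, h ω y = f ω y + g ω y) (P : Tile) :
    D.amp χ h P ^ 2 ≤ 2 * D.amp χ f P ^ 2 + 2 * D.amp χ g P ^ 2 := by
  rw [amp_sq, amp_sq, amp_sq, Finset.mul_sum, Finset.mul_sum, ← Finset.sum_add_distrib]
  refine Finset.sum_le_sum fun a _ => ?_
  have hpk : MemLp (𝓕 (packet χ P.scale (D.freq a) (D.pt P a))) 2 := by
    obtain ⟨B, hB, _⟩ := exists_schwartz_packet χ hχ P.scale (D.freq a) (D.pt P a)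
    rw [← hB]
    exact (𝓕 B : 𝓢(ℝ, ℂ)).memLp 2 volume
  have e : D.atomCoef χ h P a = D.atomCoef χ f P a + D.atomCoef χ g P a := by
    simp only [atomCoef, coef]
    have i1 : Integrable (fun y => f (D.idx a) y *
        𝓕 (packet χ P.scale (D.freq a) (D.pt P a)) y) := (hf _).integrable_mul hpk
    have i2 : Integrable (fun y => g (D.idx a) y *
        𝓕 (packet χ P.scale (D.freq a) (D.pt P a)) y) := (hg _).integrable_mul hpk
    rw [← integral_add i1 i2]
    congr 1
    ext y
    rw [hfg, add_mul]
  rw [e]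
  have := norm_add_le (D.atomCoef χ f P a) (D.atomCoef χ g P a)
  have h1 := pow_le_pow_left₀ (norm_nonneg _) this 2
  nlinarith [sq_nonneg (‖D.atomCoef χ f P a‖ - ‖D.atomCoef χ g P a‖)]

end Sampling

namespace Sampling

variable {α Ω : Type*} [Fintype Ω] (D : Sampling α Ω)

open scoped Classical in
/-- Trees covering the tiles of size at least `v`. -/
lemma exists_trees_level {χ : 𝓢(ℝ, ℂ)} {ρ K : ℝ} (hχ : ∀ η, ρ < |η| → χ η = 0)
    (hK : ∀ v, ‖𝓕 (χ : ℝ → ℂ) v‖ ≤ K * bump v ^ 4) {A B C d h v : ℝ} {n₀ J : ℕ}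
    (hadm : Tile.Admissible A B C d J) (hv : 0 < v)
    (hN : Tile.nearConst B J * (ttConst n₀ K * π) * h ^ 2 ≤ 1 / 4)
    {S : Finset Tile} (hD : D.Valid ρ B d n₀ S) {f : Ω → ℝ → ℂ} (hf : ∀ ω, MemLp (f ω) 2)
    (hfm : ∀ ω, Measurable (f ω)) {I : Finset (ℕ × ℤ)} (hSI : ∀ P ∈ S, (P.scale, P.pos) ∈ I) :
    ∃ L : List TreeTop, (∀ T ∈ L, (T.scale, T.pos) ∈ I) ∧
      v ^ 2 * Tile.mass L ≤ 16 * Tile.selConst A B J * ttConst n₀ K *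
        ∫ y, {y | (h * v) ^ 2 < ∑ ω, ‖f ω y‖ ^ 2}.indicator (fun y => ∑ ω, ‖f ω y‖ ^ 2) y ∧
      ∀ σ : ℝ, σ = 1 ∨ σ = -1 → Tile.SizeLE A C d σ (D.amp χ f) I
        (S.filter (fun P => ∀ T ∈ L, ¬ Tile.InTree A T P)) v := by
  set G : ℝ → ℝ := fun y => ∑ ω, ‖f ω y‖ ^ 2 with hG
  have hGm : Measurable G := by
    simp only [hG]
    exact Finset.measurable_sum _ fun ω _ => (hfm ω).norm.pow_const 2
  set X : Set ℝ := {y | (h * v) ^ 2 < G y} with hX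
  have hXm : MeasurableSet X := measurableSet_lt measurable_const hGm
  set f₁ : Ω → ℝ → ℂ := fun ω => Xᶜ.indicator (f ω) with hf₁
  set f₂ : Ω → ℝ → ℂ := fun ω => X.indicator (f ω) with hf₂
  have h₁ : ∀ ω, MemLp (f₁ ω) 2 := fun ω => (hf ω).indicator hXm.compl
  have h₂ : ∀ ω, MemLp (f₂ ω) 2 := fun ω => (hf ω).indicator hXm
  have hG₁ : ∀ y, ∑ ω, ‖f₁ ω y‖ ^ 2 ≤ (h * v) ^ 2 := by
    intro y
    by_cases hy : y ∈ X
    · simp [hf₁, hy, sq_nonneg]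
    · have : ∀ ω, f₁ ω y = f ω y := fun ω => Set.indicator_of_mem (by exact hy) _
      simp only [this]
      exact not_lt.mp hy
  have hG₂ : ∀ y, ∑ ω, ‖f₂ ω y‖ ^ 2 = X.indicator G y := by
    intro y
    by_cases hy : y ∈ X
    · simp [hf₂, hy, hG]
    · simp [hf₂, hy]
  have htc : 0 ≤ ttConst n₀ K := by unfold ttConst; positivity
  have hE : ttConst n₀ K * ∑ ω, ∫ y, ‖f₂ ω y‖ ^ 2 * ((1 + 0 * (y - 0) ^ 2)⁻¹) ^ 2 =
      ttConst n₀ K * ∫ y, X.indicator G y := by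
    congr 1
    rw [← integral_finsetSum]
    · refine integral_congr_ae (Filter.Eventually.of_forall fun y => ?_)
      simp [← hG₂]
    · intro ω _
      simpa using integrable_sq (h₂ ω)
  have htt := D.ttStar (ε := 0) (y₀ := 0) hχ hK hD h₂ le_rfl (fun P _ => by positivity)
    (fun P _ a _ => by simp)
  rw [hE] at htt
  have hE0 : 0 ≤ ∫ y, X.indicator G y := integral_nonneg fun y =>
    Set.indicator_nonneg (fun y _ => Finset.sum_nonneg fun _ _ => sq_nonneg _) y
  obtain ⟨L, hL1, hL2, hL3⟩ := Tile.exists_reduce_size_both (C := C) hadm (half_pos hv)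
    (mul_nonneg htc hE0) (D.amp_nonneg χ f₂) hSI htt
  refine ⟨L, hL1, by nlinarith, fun σ hσ => ?_⟩
  have s1 := (D.sizeLE_of_bounded (s := v / 2) hχ hK hadm hσ hD h₁ hG₁ (by nlinarith [sq_nonneg v]) I)
  intro T hT
  have e2 := hL3 σ hσ T hT
  have e1 := (s1.mono (Finset.filter_subset (fun P => ∀ T ∈ L, ¬ Tile.InTree A T P) S)) T hT
  have key : ∀ W : Finset Tile, Tile.energy (D.amp χ f) W ≤
      2 * Tile.energy (D.amp χ f₁) W + 2 * Tile.energy (D.amp χ f₂) W := by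
    intro W
    unfold Tile.energy
    rw [Finset.mul_sum, Finset.mul_sum, ← Finset.sum_add_distrib]
    refine Finset.sum_le_sum fun P _ => ?_
    have := D.amp_sq_add_le hχ h₁ h₂ (h := f) (fun ω y => by
      simp only [hf₁, hf₂]
      exact (congrFun (Set.indicator_compl_add_self X (f ω)) y).symm) P
    nlinarith [P.len_pos, mul_le_mul_of_nonneg_left this P.len_pos.le]
  refine (key _).trans ?_
  nlinarith

open scoped Classical in
/-- The family of trees for a function in `L^p`. -/
lemma exists_trees {χ : 𝓢(ℝ, ℂ)} {ρ K : ℝ} (hχ : ∀ η, ρ < |η| → χ η = 0)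
    (hK : ∀ v, ‖𝓕 (χ : ℝ → ℂ) v‖ ≤ K * bump v ^ 4) {A B C d p : ℝ} {n₀ J : ℕ}
    (hadm : Tile.Admissible A B C d J) (hp : 2 < p) :
    ∃ M : ℝ, 0 ≤ M ∧ ∀ {α Ω : Type} [Fintype Ω] (D : Sampling α Ω) (S : Finset Tile),
      D.Valid ρ B d n₀ S → ∀ f : Ω → ℝ → ℂ, (∀ ω, MemLp (f ω) 2) → (∀ ω, Measurable (f ω)) →
      (Integrable fun y => (∑ ω, ‖f ω y‖ ^ 2) ^ (p / 2)) →
      ∀ I : Finset (ℕ × ℤ), (∀ P ∈ S, (P.scale, P.pos) ∈ I) →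
      ∃ L : ℤ → List TreeTop, (∀ k, ∀ T ∈ L k, (T.scale, T.pos) ∈ I) ∧
        (∀ k, ∀ σ : ℝ, σ = 1 ∨ σ = -1 → Tile.SizeLE A C d σ (D.amp χ f) I
          (S.filter (fun P => ∀ T ∈ L k, ¬ Tile.InTree A T P)) (2 ^ ((k : ℝ) / p))) ∧
        ∀ Q : Finset ℤ, ∑ k ∈ Q, (2 : ℝ) ^ (k : ℝ) * Tile.mass (L k) ≤
          M * ∫ y, (∑ ω, ‖f ω y‖ ^ 2) ^ (p / 2) := by
  have htc : 0 ≤ ttConst n₀ K := by unfold ttConst; positivity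
  have hnc : 0 < Tile.nearConst B J := Tile.nearConst_pos hadm.B_nonneg J
  have hsc : 0 ≤ Tile.selConst A B J := by
    have := Tile.farConst_pos (A := A)
      (by have := hadm.A_ge; have := hadm.C_ge; have := hadm.B_nonneg
          have := abs_nonneg d; linarith) hadm.B_nonneg J
    unfold Tile.selConst; linarith
  set N := Tile.nearConst B J * (ttConst n₀ K * π) with hN
  have hN0 : 0 ≤ N := by positivity
  set h : ℝ := √(1 / (4 * (N + 1))) with hh
  have hh0 : 0 < h := Real.sqrt_pos.mpr (by positivity)
  have hNh : N * h ^ 2 ≤ 1 / 4 := by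
    rw [hh, Real.sq_sqrt (by positivity), mul_one_div, div_le_div_iff₀ (by positivity) (by norm_num)]
    linarith
  set c := 16 * Tile.selConst A B J * ttConst n₀ K with hc
  have hc0 : 0 ≤ c := by positivity
  set g := (1 - (2 : ℝ) ^ (-(1 - 2 / p)))⁻¹ * (h⁻¹) ^ (p - 2) with hg
  have hg0 : 0 ≤ g := by
    refine mul_nonneg (inv_nonneg.mpr (sub_nonneg.mpr ?_)) (by positivity)
    refine Real.rpow_le_one_of_one_le_of_nonpos one_le_two ?_
    have : 2 / p < 1 := by rw [div_lt_one (by linarith)]; exact hp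
    linarith
  refine ⟨c * g, by positivity, fun {α Ω} _ D S hD f hf hfm hfi I hSI => ?_⟩
  have hlev := fun k : ℤ => D.exists_trees_level hχ hK (v := (2 : ℝ) ^ ((k : ℝ) / p)) hadm
    (by positivity) hNh hD hf hfm hSI
  choose L hL1 hL2 hL3 using hlev
  refine ⟨L, hL1, hL3, fun Q => ?_⟩
  set G : ℝ → ℝ := fun y => ∑ ω, ‖f ω y‖ ^ 2 with hG
  have hG0 : ∀ y, 0 ≤ G y := fun y => Finset.sum_nonneg fun _ _ => sq_nonneg _
  have hGm : Measurable G := by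
    simp only [hG]
    exact Finset.measurable_sum _ fun ω _ => (hfm ω).norm.pow_const 2
  have hGi : Integrable G := integrable_sum_sq hf
  set X : ℤ → Set ℝ := fun k => {y | (h * (2 : ℝ) ^ ((k : ℝ) / p)) ^ 2 < G y} with hX
  have hXm : ∀ k, MeasurableSet (X k) := fun k => measurableSet_lt measurable_const hGm
  have step1 : ∀ k ∈ Q, (2 : ℝ) ^ (k : ℝ) * Tile.mass (L k) ≤
      ∫ y, c * ((2 : ℝ) ^ ((k : ℝ) * (1 - 2 / p)) * (X k).indicator G y) := by
    intro k _
    rw [integral_const_mul, integral_const_mul]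
    have e : (2 : ℝ) ^ (k : ℝ) = 2 ^ ((k : ℝ) * (1 - 2 / p)) * (2 ^ ((k : ℝ) / p)) ^ 2 := by
      rw [← Real.rpow_natCast, ← Real.rpow_mul (by norm_num), ← Real.rpow_add (by norm_num)]
      congr 1
      push_cast
      ring
    have h2 : (0 : ℝ) ≤ 2 ^ ((k : ℝ) * (1 - 2 / p)) := by positivity
    rw [e, mul_assoc]
    calc _ ≤ (2 : ℝ) ^ ((k : ℝ) * (1 - 2 / p)) * (c * ∫ y, (X k).indicator G y) :=
          mul_le_mul_of_nonneg_left (hL2 k) h2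
      _ = _ := by ring
  refine (Finset.sum_le_sum step1).trans ?_
  rw [← integral_finsetSum _ fun k _ => ((hGi.indicator (hXm k)).const_mul _).const_mul _,
    ← integral_const_mul]
  refine integral_mono (integrable_finsetSum _ fun k _ =>
    ((hGi.indicator (hXm k)).const_mul _).const_mul _) (hfi.const_mul _) fun y => ?_
  simp only
  rw [← Finset.mul_sum, mul_assoc c g]
  refine mul_le_mul_of_nonneg_left ?_ hc0
  have hy0 : 0 ≤ √(G y) * h⁻¹ := by positivity
  have e1 : ∑ k ∈ Q, (2 : ℝ) ^ ((k : ℝ) * (1 - 2 / p)) * (X k).indicator G y =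
      (∑ k ∈ Q, (if (2 : ℝ) ^ ((k : ℝ) / p) < √(G y) * h⁻¹ then
        (2 : ℝ) ^ ((k : ℝ) * (1 - 2 / p)) else 0)) * G y := by
    rw [Finset.sum_mul]
    refine Finset.sum_congr rfl fun k _ => ?_
    have hiff : y ∈ X k ↔ (2 : ℝ) ^ ((k : ℝ) / p) < √(G y) * h⁻¹ := by
      rw [← div_eq_mul_inv, lt_div_iff₀ hh0, Real.lt_sqrt (by positivity), mul_comm _ h]
      exact Iff.rfl
    by_cases hk : y ∈ X k
    · rw [if_pos (hiff.mp hk), Set.indicator_of_mem hk]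
    · rw [if_neg (fun h => hk (hiff.mpr h)), Set.indicator_of_notMem hk]; simp
  rw [e1]
  refine (mul_le_mul_of_nonneg_right (sum_geometric_le hp hy0 Q) (hG0 y)).trans (le_of_eq ?_)
  rw [Real.mul_rpow (Real.sqrt_nonneg _) (by positivity), Real.sqrt_eq_rpow,
    ← Real.rpow_mul (hG0 y), hg]
  have e2 : G y ^ (1 / 2 * (p - 2)) * G y = G y ^ (p / 2) := by
    rcases (hG0 y).eq_or_lt with h0 | h0
    · rw [← h0, mul_zero, Real.zero_rpow (by linarith : p / 2 ≠ 0)]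
    · nth_rw 2 [← Real.rpow_one (G y)]
      rw [← Real.rpow_add h0]
      congr 1; ring
  change _ = _ * G y ^ (p / 2)
  rw [← e2]
  ring

end Sampling

lemma Sampling.amp_smul {α Ω : Type*} (D : Sampling α Ω) (χ : ℝ → ℂ) (f : Ω → ℝ → ℂ) {c : ℝ}
    (hc : 0 ≤ c) (P : Tile) : D.amp χ (fun ω y => (c : ℂ) * f ω y) P = c * D.amp χ f P := by
  have h : ∀ a, ‖D.atomCoef χ (fun ω y => (c : ℂ) * f ω y) P a‖ ^ 2 =
      c ^ 2 * ‖D.atomCoef χ f P a‖ ^ 2 := by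
    intro a
    simp only [atomCoef, coef, mul_assoc]
    rw [integral_const_mul, norm_mul, mul_pow, Complex.norm_real, Real.norm_of_nonneg hc]
  simp only [amp, h]
  rw [← Finset.mul_sum, Real.sqrt_mul (sq_nonneg c), Real.sqrt_sq hc]

lemma le_mul_rpow_of_homogeneous {p X : Fin 3 → ℝ} (hp : ∀ i, 0 < p i) (hX : ∀ i, 0 ≤ X i)
    {Λ M : ℝ} (hM : 0 ≤ M) (h : ∀ t : Fin 3 → ℝ, (∀ i, 0 < t i) →
      t 0 * t 1 * t 2 * Λ ≤ M * ∑ i, t i ^ p i * X i) :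
    Λ ≤ 3 * M * (X 0 ^ (1 / p 0) * X 1 ^ (1 / p 1) * X 2 ^ (1 / p 2)) := by
  have key : ∀ ε : ℝ, 0 < ε → Λ ≤ 3 * M * ((X 0 + ε) ^ (1 / p 0) * (X 1 + ε) ^ (1 / p 1) *
      (X 2 + ε) ^ (1 / p 2)) := by
    intro ε hε
    have hY : ∀ i, 0 < X i + ε := fun i => add_pos_of_nonneg_of_pos (hX i) hε
    have hZ : ∀ i, 0 < (X i + ε) ^ (1 / p i) := fun i => Real.rpow_pos_of_pos (hY i) _
    have ht := h (fun i => ((X i + ε) ^ (1 / p i))⁻¹) fun i => inv_pos.mpr (hZ i)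
    have hi : ∀ i, (((X i + ε) ^ (1 / p i))⁻¹) ^ p i * X i ≤ 1 := by
      intro i
      rw [Real.inv_rpow (hZ i).le, ← Real.rpow_mul (hY i).le, one_div_mul_cancel (hp i).ne',
        Real.rpow_one, inv_mul_le_iff₀ (hY i)]
      linarith
    have hsum : ∑ i, (((X i + ε) ^ (1 / p i))⁻¹) ^ p i * X i ≤ 3 :=
      (Finset.sum_le_sum fun i _ => hi i).trans (by simp)
    have h1 := ht.trans (mul_le_mul_of_nonneg_left hsum hM)
    have hprod : 0 < (X 0 + ε) ^ (1 / p 0) * (X 1 + ε) ^ (1 / p 1) * (X 2 + ε) ^ (1 / p 2) :=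
      mul_pos (mul_pos (hZ 0) (hZ 1)) (hZ 2)
    rw [← mul_inv, ← mul_inv, inv_mul_le_iff₀ hprod] at h1
    linarith
  have hc : Filter.Tendsto (fun ε : ℝ => 3 * M * ((X 0 + ε) ^ (1 / p 0) * (X 1 + ε) ^ (1 / p 1) *
      (X 2 + ε) ^ (1 / p 2))) (nhdsWithin 0 (Set.Ioi 0))
      (nhds (3 * M * ((X 0 + 0) ^ (1 / p 0) * (X 1 + 0) ^ (1 / p 1) * (X 2 + 0) ^ (1 / p 2)))) := by
    refine Filter.Tendsto.mono_left (ContinuousAt.tendsto ?_) nhdsWithin_le_nhds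
    have : ∀ i, ContinuousAt (fun ε : ℝ => (X i + ε) ^ (1 / p i)) 0 := fun i =>
      ((continuous_const.add continuous_id).continuousAt).rpow_const
        (Or.inr (by have := hp i; positivity))
    exact (((this 0).mul (this 1)).mul (this 2)).const_mul _
  simp only [add_zero] at hc
  refine ge_of_tendsto hc ?_
  filter_upwards [self_mem_nhdsWithin] with ε hε using key ε hε

namespace Tile

/-- The trilinear estimate for tile amplitudes. -/
theorem sum_amp_le {χ : Fin 3 → 𝓢(ℝ, ℂ)} {ρ K : ℝ} (hχ : ∀ i η, ρ < |η| → χ i η = 0)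
    (hK : ∀ i v, ‖𝓕 (χ i : ℝ → ℂ) v‖ ≤ K * bump v ^ 4) {A B C : ℝ} {d : Fin 3 → ℝ} {n₀ J : ℕ}
    (hadm : ∀ i, Admissible A B C (d i) J) (hd : ∀ i i', i ≠ i' → 2 * C ≤ |d i - d i'|)
    {p : Fin 3 → ℝ} (hp : ∀ i, 2 < p i) (hp1 : 1 / p 0 + 1 / p 1 + 1 / p 2 = 1) :
    ∃ M : ℝ, 0 ≤ M ∧ ∀ {α₀ α₁ α₂ Ω₀ Ω₁ Ω₂ : Type} [Fintype Ω₀] [Fintype Ω₁] [Fintype Ω₂]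
      (D₀ : Sampling α₀ Ω₀) (D₁ : Sampling α₁ Ω₁) (D₂ : Sampling α₂ Ω₂) (S : Finset Tile),
      D₀.Valid ρ B (d 0) n₀ S → D₁.Valid ρ B (d 1) n₀ S → D₂.Valid ρ B (d 2) n₀ S →
      ∀ (f₀ : Ω₀ → ℝ → ℂ) (f₁ : Ω₁ → ℝ → ℂ) (f₂ : Ω₂ → ℝ → ℂ),
      (∀ ω, MemLp (f₀ ω) 2) → (∀ ω, MemLp (f₁ ω) 2) → (∀ ω, MemLp (f₂ ω) 2) →
      (∀ ω, Measurable (f₀ ω)) → (∀ ω, Measurable (f₁ ω)) → (∀ ω, Measurable (f₂ ω)) →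
      (Integrable fun y => (∑ ω, ‖f₀ ω y‖ ^ 2) ^ (p 0 / 2)) →
      (Integrable fun y => (∑ ω, ‖f₁ ω y‖ ^ 2) ^ (p 1 / 2)) →
      (Integrable fun y => (∑ ω, ‖f₂ ω y‖ ^ 2) ^ (p 2 / 2)) →
      ∑ P ∈ S, P.len * (D₀.amp (χ 0) f₀ P * D₁.amp (χ 1) f₁ P * D₂.amp (χ 2) f₂ P) ≤
        M * ((∫ y, (∑ ω, ‖f₀ ω y‖ ^ 2) ^ (p 0 / 2)) ^ (1 / p 0) *
          (∫ y, (∑ ω, ‖f₁ ω y‖ ^ 2) ^ (p 1 / 2)) ^ (1 / p 1) *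
          (∫ y, (∑ ω, ‖f₂ ω y‖ ^ 2) ^ (p 2 / 2)) ^ (1 / p 2)) := by
  have h := fun i => Sampling.exists_trees (n₀ := n₀) (hχ i) (hK i) (hadm i) (hp i)
  choose M hM hT using h
  have hM' : 0 ≤ 12 * ∑ i, M i := mul_nonneg (by norm_num) (Finset.sum_nonneg fun i _ => hM i)
  refine ⟨3 * (12 * ∑ i, M i), mul_nonneg (by norm_num) hM', ?_⟩
  intro α₀ α₁ α₂ Ω₀ Ω₁ Ω₂ _ _ _ D₀ D₁ D₂ S hD₀ hD₁ hD₂ f₀ f₁ f₂ hf₀ hf₁ hf₂ hm₀ hm₁ hm₂ hi₀ hi₁ hi₂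
  set I : Finset (ℕ × ℤ) := S.image (fun P => (P.scale, P.pos)) with hI
  have hSI : ∀ P ∈ S, (P.scale, P.pos) ∈ I := fun P hP => Finset.mem_image_of_mem _ hP
  have hpow : ∀ {Ω : Type} [Fintype Ω] (f : Ω → ℝ → ℂ) (i : Fin 3) {c : ℝ}, 0 < c → ∀ y,
      (∑ ω, ‖(c : ℂ) * f ω y‖ ^ 2) ^ (p i / 2) =
        c ^ p i * (∑ ω, ‖f ω y‖ ^ 2) ^ (p i / 2) := by
    intro Ω _ f i c hc y
    simp only [norm_mul, mul_pow, Complex.norm_real, Real.norm_of_nonneg hc.le]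
    rw [← Finset.mul_sum, Real.mul_rpow (sq_nonneg c) (Finset.sum_nonneg fun _ _ => sq_nonneg _),
      ← Real.rpow_natCast, ← Real.rpow_mul hc.le]
    congr 2
    push_cast; ring
  have key := le_mul_rpow_of_homogeneous (p := p)
    (X := ![∫ y, (∑ ω, ‖f₀ ω y‖ ^ 2) ^ (p 0 / 2), ∫ y, (∑ ω, ‖f₁ ω y‖ ^ 2) ^ (p 1 / 2),
      ∫ y, (∑ ω, ‖f₂ ω y‖ ^ 2) ^ (p 2 / 2)])
    (Λ := ∑ P ∈ S, P.len * (D₀.amp (χ 0) f₀ P * D₁.amp (χ 1) f₁ P * D₂.amp (χ 2) f₂ P))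
    (M := 12 * ∑ i, M i) (fun i => by linarith [hp i]) ?_ hM' ?_
  · exact key
  · intro i
    fin_cases i <;> exact integral_nonneg fun y => by positivity
  intro t ht
  obtain ⟨L₀, a1, a2, a3⟩ := hT 0 D₀ S hD₀ (fun ω y => (t 0 : ℂ) * f₀ ω y)
    (fun ω => (hf₀ ω).const_mul _) (fun ω => (hm₀ ω).const_mul _)
    (by simp only [hpow f₀ 0 (ht 0)]; exact hi₀.const_mul _) I hSI
  obtain ⟨L₁, b1, b2, b3⟩ := hT 1 D₁ S hD₁ (fun ω y => (t 1 : ℂ) * f₁ ω y)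
    (fun ω => (hf₁ ω).const_mul _) (fun ω => (hm₁ ω).const_mul _)
    (by simp only [hpow f₁ 1 (ht 1)]; exact hi₁.const_mul _) I hSI
  obtain ⟨L₂, c1, c2, c3⟩ := hT 2 D₂ S hD₂ (fun ω y => (t 2 : ℂ) * f₂ ω y)
    (fun ω => (hf₂ ω).const_mul _) (fun ω => (hm₂ ω).const_mul _)
    (by simp only [hpow f₂ 2 (ht 2)]; exact hi₂.const_mul _) I hSI
  simp only [hpow f₀ 0 (ht 0), integral_const_mul] at a3
  simp only [hpow f₁ 1 (ht 1), integral_const_mul] at b3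
  simp only [hpow f₂ 2 (ht 2), integral_const_mul] at c3
  have main := sum_tiles_le hadm hd
    (F := ![D₀.amp (χ 0) fun ω y => (t 0 : ℂ) * f₀ ω y,
      D₁.amp (χ 1) fun ω y => (t 1 : ℂ) * f₁ ω y, D₂.amp (χ 2) fun ω y => (t 2 : ℂ) * f₂ ω y])
    (by intro i; fin_cases i <;> exact Sampling.amp_nonneg _ _ _) hSI
    (fun i => by linarith [hp i]) hp1 ![L₀, L₁, L₂]
    (by intro i; fin_cases i; exacts [a1, b1, c1]) (by intro i; fin_cases i; exacts [a2, b2, c2])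
    ![M 0 * (t 0 ^ p 0 * ∫ y, (∑ ω, ‖f₀ ω y‖ ^ 2) ^ (p 0 / 2)),
      M 1 * (t 1 ^ p 1 * ∫ y, (∑ ω, ‖f₁ ω y‖ ^ 2) ^ (p 1 / 2)),
      M 2 * (t 2 ^ p 2 * ∫ y, (∑ ω, ‖f₂ ω y‖ ^ 2) ^ (p 2 / 2))]
    (by intro i; fin_cases i; exacts [a3, b3, c3])
  simp only [Matrix.cons_val, Sampling.amp_smul _ _ _ (ht _).le] at main
  have e : t 0 * t 1 * t 2 * ∑ P ∈ S, P.len * (D₀.amp (χ 0) f₀ P * D₁.amp (χ 1) f₁ P *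
      D₂.amp (χ 2) f₂ P) = ∑ P ∈ S, P.len * (t 0 * D₀.amp (χ 0) f₀ P * (t 1 * D₁.amp (χ 1) f₁ P) *
      (t 2 * D₂.amp (χ 2) f₂ P)) := by
    rw [Finset.mul_sum]
    exact Finset.sum_congr rfl fun P _ => by ring
  rw [e]
  refine main.trans ?_
  rw [mul_assoc]
  refine mul_le_mul_of_nonneg_left ?_ (by norm_num)
  simp only [Fin.sum_univ_three, Matrix.cons_val]
  have z0 : 0 ≤ t 0 ^ p 0 * ∫ y, (∑ ω, ‖f₀ ω y‖ ^ 2) ^ (p 0 / 2) :=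
    mul_nonneg (Real.rpow_nonneg (ht 0).le _) (integral_nonneg fun y => by positivity)
  have z1 : 0 ≤ t 1 ^ p 1 * ∫ y, (∑ ω, ‖f₁ ω y‖ ^ 2) ^ (p 1 / 2) :=
    mul_nonneg (Real.rpow_nonneg (ht 1).le _) (integral_nonneg fun y => by positivity)
  have z2 : 0 ≤ t 2 ^ p 2 * ∫ y, (∑ ω, ‖f₂ ω y‖ ^ 2) ^ (p 2 / 2) :=
    mul_nonneg (Real.rpow_nonneg (ht 2).le _) (integral_nonneg fun y => by positivity)
  nlinarith [mul_nonneg (hM 0) z1, mul_nonneg (hM 0) z2, mul_nonneg (hM 1) z0,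
    mul_nonneg (hM 1) z2, mul_nonneg (hM 2) z0, mul_nonneg (hM 2) z1]

end Tile

namespace Sampling

/-- Wave packets whose frequencies, read on a line which is wrapped around a circle of length `q`,
lie in the frequency cell of the tile. -/
lemma valid_of_line {Ω : Type*} {D : Sampling (Ω × ℤ × ℤ) Ω} (hidx : ∀ a, D.idx a = a.1)
    (hfreq : ∀ a, D.freq a = a.2.2) {α q ρ E B : ℝ} {b : Ω → ℝ} {d : ℤ} {n₀ : ℕ} (hα : α ≠ 0)
    (hρ : 0 ≤ ρ) (hd : |(d : ℝ)| ≤ E) (hq : 4 * (E + (|α| * ρ + 1)) < q)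
    (hB : 2 * (|α| * ρ + 1) ≤ B) (hn₀ : 1 / |α| + 1 ≤ n₀) {U : Finset Tile}
    (hpt : ∀ P ∈ U, ∀ a ∈ D.atoms P, P.InTime (D.pt P a))
    (hcell : ∀ P ∈ U, ∀ a ∈ D.atoms P,
      ⌊α * a.2.2 + 2 ^ P.scale * (b a.1 - a.2.1 * q)⌋ = P.freq + d)
    (hfr : ∀ P ∈ U, 0 ≤ (P.freq : ℝ) ∧ (P.freq : ℝ) ≤ 2 ^ P.scale * (q / 2)) :
    D.Valid ρ B d n₀ U := by
  classical
  set β := |α| * ρ + 1 with hβ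
  have hβ1 : 1 ≤ β := by simp only [hβ]; have := mul_nonneg (abs_nonneg α) hρ; linarith
  have hE0 : 0 ≤ E := (abs_nonneg _).trans hd
  have hq0 : 0 < q := by linarith
  have loc : ∀ P ∈ U, ∀ a ∈ D.atoms P, ∀ η : ℝ, |2 ^ P.scale * η - D.freq a| ≤ ρ →
      |((P.freq : ℝ) + d) - 2 ^ P.scale * (α * η + b a.1 - a.2.1 * q)| ≤ β := by
    intro P hP a ha η hη
    have h1 := hcell P hP a ha
    have h2 := Int.floor_le (α * a.2.2 + 2 ^ P.scale * (b a.1 - a.2.1 * q))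
    have h3 := Int.lt_floor_add_one (α * a.2.2 + 2 ^ P.scale * (b a.1 - a.2.1 * q))
    rw [h1] at h2 h3
    push_cast at h2 h3
    rw [hfreq] at hη
    have h4 : |α * (2 ^ P.scale * η - a.2.2)| ≤ |α| * ρ := by
      rw [abs_mul]; exact mul_le_mul_of_nonneg_left hη (abs_nonneg _)
    rw [abs_le] at h4 ⊢
    constructor <;> simp only [hβ] <;> nlinarith [h4.1, h4.2]
  have loc2 : ∀ P ∈ U, ∀ a ∈ D.atoms P, ∀ η : ℝ, |2 ^ P.scale * η - D.freq a| ≤ ρ →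
      -(E + β) ≤ α * η + b a.1 - a.2.1 * q ∧ α * η + b a.1 - a.2.1 * q ≤ q / 2 + (E + β) := by
    intro P hP a ha η hη
    have h1 := abs_le.mp (loc P hP a ha η hη)
    obtain ⟨h2, h3⟩ := hfr P hP
    have h4 := abs_le.mp hd
    have hL : (1 : ℝ) ≤ 2 ^ P.scale := one_le_pow₀ one_le_two
    have hL0 : (0 : ℝ) < 2 ^ P.scale := by positivity
    have h5 : E + β ≤ 2 ^ P.scale * (E + β) := le_mul_of_one_le_left (by linarith) hL
    constructor
    · refine le_of_mul_le_mul_left ?_ hL0; nlinarith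
    · refine le_of_mul_le_mul_left ?_ hL0; nlinarith
  have hκ : ∀ P ∈ U, ∀ P' ∈ U, ∀ a ∈ D.atoms P, ∀ a' ∈ D.atoms P', a.1 = a'.1 → ∀ η : ℝ,
      |2 ^ P.scale * η - D.freq a| ≤ ρ → |2 ^ P'.scale * η - D.freq a'| ≤ ρ → a.2.1 = a'.2.1 := by
    intro P hP P' hP' a ha a' ha' hω η h h'
    obtain ⟨u1, u2⟩ := loc2 P hP a ha η h
    obtain ⟨v1, v2⟩ := loc2 P' hP' a' ha' η h'
    rw [← hω] at v1 v2
    have w1 : ((a.2.1 : ℝ) - a'.2.1) * q < 1 * q := by nlinarith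
    have w2 : ((a'.2.1 : ℝ) - a.2.1) * q < 1 * q := by nlinarith
    have w3 := lt_of_mul_lt_mul_right w1 hq0.le
    have w4 := lt_of_mul_lt_mul_right w2 hq0.le
    have w5 : a.2.1 - a'.2.1 < 1 := by exact_mod_cast w3
    have w6 : a'.2.1 - a.2.1 < 1 := by exact_mod_cast w4
    omega
  refine ⟨hpt, ?_, ?_⟩
  · rintro P hP P' hP' a ha a' ha' ⟨hω, η, h, h'⟩
    rw [hidx, hidx] at hω
    have hk := hκ P hP P' hP' a ha a' ha' hω η h h'
    have e1 := loc P hP a ha η h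
    have e2 := loc P' hP' a' ha' η h'
    rw [← hω, ← hk] at e2
    set y := α * η + b a.1 - a.2.1 * q
    have hp := P.len_pos
    have hp' := P'.len_pos
    change |((P.freq : ℝ) + d) * P'.len - (P'.freq + d) * P.len| ≤ _
    have e3 : ((P.freq : ℝ) + d) * P'.len - (P'.freq + d) * P.len =
        ((P.freq : ℝ) + d - P.len * y) * P'.len - (P'.freq + d - P'.len * y) * P.len := by ring
    rw [e3]
    have e4 : |((P.freq : ℝ) + d - P.len * y) * P'.len| ≤ β * max P.len P'.len := by
      rw [abs_mul, abs_of_pos hp']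
      exact mul_le_mul e1 (le_max_right _ _) hp'.le (by linarith)
    have e5 : |((P'.freq : ℝ) + d - P'.len * y) * P.len| ≤ β * max P.len P'.len := by
      rw [abs_mul, abs_of_pos hp]
      exact mul_le_mul e2 (le_max_left _ _) hp.le (by linarith)
    refine (abs_sub _ _).trans ?_
    have : 2 * β * max P.len P'.len ≤ B * max P.len P'.len :=
      mul_le_mul_of_nonneg_right hB (hp.le.trans (le_max_left _ _))
    linarith
  · intro P hP P' hP' a ha
    set W := (D.atoms P').filter (fun a' => D.Rel ρ P a P' a') with hW
    have hWm : ∀ a' ∈ W, a' ∈ D.atoms P' ∧ D.Rel ρ P a P' a' := fun a' h => Finset.mem_filter.mp h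
    have hfix : ∀ a' ∈ W, a'.1 = a.1 ∧ a'.2.1 = a.2.1 := by
      intro a' h
      obtain ⟨h1, h2, η, h3, h4⟩ := hWm a' h
      rw [hidx, hidx] at h2
      exact ⟨h2.symm, (hκ P hP P' hP' a ha a' h1 h2 η h3 h4).symm⟩
    have hinj : Set.InjOn (fun a' : Ω × ℤ × ℤ => a'.2.2) W := by
      intro u hu v hv huv
      obtain ⟨u1, u2⟩ := hfix u hu
      obtain ⟨v1, v2⟩ := hfix v hv
      exact Prod.ext (u1.trans v1.symm) (Prod.ext (u2.trans v2.symm) huv)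
    rw [← Finset.card_image_of_injOn hinj]
    have hα' : 0 < |α| := abs_pos.mpr hα
    have key := card_le_of_abs_sub_le (W.image fun a' : Ω × ℤ × ℤ => a'.2.2)
      (((P'.freq : ℝ) + d + 1 / 2 - 2 ^ P'.scale * (b a.1 - a.2.1 * q)) / α) (1 / (2 * |α|))
      (by positivity) (by
        intro z hz
        obtain ⟨a', ha', rfl⟩ := Finset.mem_image.mp hz
        obtain ⟨h1, h2⟩ := hfix a' ha'
        have g1 := hcell P' hP' a' (hWm a' ha').1
        have g2 := Int.floor_le (α * a'.2.2 + 2 ^ P'.scale * (b a'.1 - a'.2.1 * q))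
        have g3 := Int.lt_floor_add_one (α * a'.2.2 + 2 ^ P'.scale * (b a'.1 - a'.2.1 * q))
        rw [g1] at g2 g3
        rw [h1, h2] at g2 g3
        push_cast at g2 g3
        have e : (a'.2.2 : ℝ) - ((P'.freq : ℝ) + d + 1 / 2 - 2 ^ P'.scale * (b a.1 - a.2.1 * q)) / α
            = (α * a'.2.2 + 2 ^ P'.scale * (b a.1 - a.2.1 * q) - (P'.freq + d + 1 / 2)) / α := by
          field_simp
          ring
        rw [e, abs_div, div_le_div_iff₀ hα' (by positivity)]
        have : |α * a'.2.2 + 2 ^ P'.scale * (b a.1 - a.2.1 * q) - (P'.freq + d + 1 / 2)| ≤ 1 / 2 := by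
          rw [abs_le]; constructor <;> linarith
        nlinarith)
    have e : 2 * (1 / (2 * |α|)) + 1 = 1 / |α| + 1 := by field_simp
    rw [e] at key
    exact_mod_cast key.trans hn₀

end Sampling

lemma sum_mul_mul_le_sqrt {σ α β γ : Type*} [DecidableEq α] [DecidableEq β] [DecidableEq γ]
    (s : Finset σ) (φ₀ : σ → α) (φ₁ : σ → β) (φ₂ : σ → γ)
    (h₀₁ : Set.InjOn (fun x => (φ₀ x, φ₁ x)) s) (h₂ : Set.InjOn φ₂ s) (a : α → ℝ) (b : β → ℝ)
    (c : γ → ℝ) :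
    ∑ x ∈ s, a (φ₀ x) * b (φ₁ x) * c (φ₂ x) ≤
      √(∑ y ∈ s.image φ₀, a y ^ 2) * √(∑ y ∈ s.image φ₁, b y ^ 2) *
        √(∑ y ∈ s.image φ₂, c y ^ 2) := by
  have hcs := Finset.sum_mul_sq_le_sq_mul_sq s (fun x => a (φ₀ x) * b (φ₁ x)) (fun x => c (φ₂ x))
  have e2 : ∑ x ∈ s, c (φ₂ x) ^ 2 = ∑ y ∈ s.image φ₂, c y ^ 2 := (Finset.sum_image (f := fun y => c y ^ 2) h₂).symm
  have e1 : ∑ x ∈ s, (a (φ₀ x) * b (φ₁ x)) ^ 2 ≤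
      (∑ y ∈ s.image φ₀, a y ^ 2) * ∑ y ∈ s.image φ₁, b y ^ 2 := by
    have : ∑ x ∈ s, (a (φ₀ x) * b (φ₁ x)) ^ 2 =
        ∑ y ∈ s.image (fun x => (φ₀ x, φ₁ x)), (a y.1 * b y.2) ^ 2 :=
      (Finset.sum_image (f := fun y : α × β => (a y.1 * b y.2) ^ 2) h₀₁).symm
    rw [this, Finset.sum_mul_sum, ← Finset.sum_product']
    refine (Finset.sum_le_sum_of_subset_of_nonneg ?_ fun _ _ _ => sq_nonneg _).trans
      (le_of_eq (Finset.sum_congr rfl fun _ _ => mul_pow _ _ _))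
    intro y hy
    obtain ⟨x, hx, rfl⟩ := Finset.mem_image.mp hy
    exact Finset.mem_product.mpr ⟨Finset.mem_image_of_mem _ hx, Finset.mem_image_of_mem _ hx⟩
  have n0 : 0 ≤ ∑ y ∈ s.image φ₀, a y ^ 2 := Finset.sum_nonneg fun _ _ => sq_nonneg _
  have n1 : 0 ≤ ∑ y ∈ s.image φ₁, b y ^ 2 := Finset.sum_nonneg fun _ _ => sq_nonneg _
  have n2 : 0 ≤ ∑ y ∈ s.image φ₂, c y ^ 2 := Finset.sum_nonneg fun _ _ => sq_nonneg _
  refine (abs_le_of_sq_le_sq' ?_ (by positivity)).2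
  rw [mul_pow, mul_pow, Real.sq_sqrt n0, Real.sq_sqrt n1, Real.sq_sqrt n2, ← e2]
  exact hcs.trans (mul_le_mul_of_nonneg_right e1 (Finset.sum_nonneg fun _ _ => sq_nonneg _))

/-- The trilinear form of wave packet coefficients at the translates of a point, for a single
frequency cube. -/
noncomputable def cubeForm {Ω : Type*} (χ : Fin 3 → 𝓢(ℝ, ℂ)) (f g : ℝ → ℂ) (h : Ω → ℝ → ℂ) (u : ℝ)
    (N : Finset ℤ) (s : Ω × ℕ × ℤ × ℤ) : ℝ :=
  ∑ i ∈ N, 2 ^ s.2.1 * (‖coef (χ 0) f s.2.1 s.2.2.1 ((i + u) * 2 ^ s.2.1)‖ *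
    ‖coef (χ 1) g s.2.1 s.2.2.2 ((i + u) * 2 ^ s.2.1)‖ *
    ‖coef (χ 2) (h s.1) s.2.1 (-(s.2.2.1 + s.2.2.2)) ((i + u) * 2 ^ s.2.1)‖)

theorem exists_cubeForm_cell_bound {χ : Fin 3 → 𝓢(ℝ, ℂ)} {ρ : ℝ} (hρ : 0 ≤ ρ)
    (hχ : ∀ i η, ρ < |η| → χ i η = 0) {t E B : ℝ} (ht : t ≠ 0) (ht1 : 1 + t ≠ 0) {d₁ d₂ : ℤ}
    (hE₁ : |(d₁ : ℝ)| ≤ E) (hE₂ : |(d₂ : ℝ)| ≤ E)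
    (hB₀ : 2 * (ρ + 1) ≤ B) (hB₁ : 2 * (|1 / t| * ρ + 1) ≤ B)
    (hB₂ : 2 * (|-1 / (1 + t)| * ρ + 1) ≤ B)
    (hd₁ : 4 * B + 4 ≤ |(d₁ : ℝ)|) (hd₂ : 4 * B + 4 ≤ |(d₂ : ℝ)|)
    (hd₁₂ : 4 * B + 4 ≤ |(d₁ : ℝ) - d₂|) {p : Fin 3 → ℝ} (hp : ∀ i, 2 < p i)
    (hp1 : 1 / p 0 + 1 / p 1 + 1 / p 2 = 1) :
    ∃ M : ℝ, 0 ≤ M ∧ ∀ {Ω : Type} [Fintype Ω] (q o e : ℝ) (n : Ω → ℤ), 4 * (E + B) < q →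
      ∀ (S : Finset (Ω × ℕ × ℤ × ℤ)) (κ z : Ω × ℕ × ℤ × ℤ → ℤ),
      (∀ s ∈ S, ∀ s' ∈ S, s.2 = s'.2 → s.1 = s'.1) →
      (∀ s ∈ S, ⌊(s.2.2.1 : ℝ) + 2 ^ s.2.1 * (-o - κ s * q)⌋ = z s) →
      (∀ s ∈ S, ⌊1 / t * s.2.2.2 + 2 ^ s.2.1 * (-(e / t) - o - (κ s + n s.1) * q)⌋ = z s + d₁) →
      (∀ s ∈ S, ⌊((s.2.2.1 : ℝ) + s.2.2.2) / (1 + t) +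
        2 ^ s.2.1 * (-((e + n s.1 * (q * t)) / (1 + t)) - o - κ s * q)⌋ = z s + d₂) →
      (∀ s ∈ S, 0 ≤ (z s : ℝ) ∧ (z s : ℝ) ≤ 2 ^ s.2.1 * (q / 2)) →
      ∀ (f g : ℝ → ℂ) (h : Ω → ℝ → ℂ), MemLp f 2 → MemLp g 2 → (∀ ω, MemLp (h ω) 2) →
      Measurable f → Measurable g → (∀ ω, Measurable (h ω)) →
      (Integrable fun y => (‖f y‖ ^ 2) ^ (p 0 / 2)) →
      (Integrable fun y => (‖g y‖ ^ 2) ^ (p 1 / 2)) →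
      (Integrable fun y => (∑ ω, ‖h ω y‖ ^ 2) ^ (p 2 / 2)) →
      ∀ u : ℝ, 0 ≤ u → u ≤ 1 → ∀ N : Finset ℤ, ∑ s ∈ S, cubeForm χ f g h u N s ≤
        M * ((∫ y, (‖f y‖ ^ 2) ^ (p 0 / 2)) ^ (1 / p 0) *
          (∫ y, (‖g y‖ ^ 2) ^ (p 1 / 2)) ^ (1 / p 1) *
          (∫ y, (∑ ω, ‖h ω y‖ ^ 2) ^ (p 2 / 2)) ^ (1 / p 2)) := by
  classical
  have hdec := fun i => exists_schwartz_decay (𝓕 (χ i) : 𝓢(ℝ, ℂ))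
  choose Kd hKd0 hKd using hdec
  have hK : ∀ i v, ‖𝓕 (χ i : ℝ → ℂ) v‖ ≤ (∑ i, Kd i) * bump v ^ 4 := by
    intro i v
    refine (hKd i v).trans (mul_le_mul_of_nonneg_right ?_ (by have := bump_pos v; positivity))
    exact Finset.single_le_sum (fun i _ => (hKd0 i).le) (Finset.mem_univ i)
  have hB0 : 0 ≤ B := by linarith
  have hE0 : 0 ≤ E := (abs_nonneg _).trans hE₁
  obtain ⟨J, hJ⟩ := pow_unbounded_of_one_lt (2 * B + 2 + E + E) (one_lt_two (α := ℝ))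
  obtain ⟨n₀, hn₀⟩ := exists_nat_ge (max (1 / |(1 : ℝ)| + 1)
    (max (1 / |1 / t| + 1) (1 / |-1 / (1 + t)| + 1)))
  have hn0 := (le_max_left _ _).trans hn₀
  have hn1 := ((le_max_left _ _).trans (le_max_right _ _)).trans hn₀
  have hn2 := ((le_max_right _ _).trans (le_max_right _ _)).trans hn₀
  set d : Fin 3 → ℝ := ![((0 : ℤ) : ℝ), (d₁ : ℝ), (d₂ : ℝ)] with hd
  have hdE : ∀ i, |d i| ≤ E := by
    intro i; fin_cases i
    · simpa [hd] using hE0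
    · exact hE₁
    · exact hE₂
  have hadm : ∀ i, Tile.Admissible (2 * B + 2 + E) B (2 * B + 2) (d i) J := fun i =>
    ⟨hB0, le_rfl, by linarith [hdE i], by linarith [hdE i]⟩
  have hsep : ∀ i i', i ≠ i' → 2 * (2 * B + 2) ≤ |d i - d i'| := by
    intro i i' hne
    have e : 2 * (2 * B + 2) = 4 * B + 4 := by ring
    rw [e]
    fin_cases i <;> fin_cases i' <;> simp [hd] at hne ⊢
    · exact hd₁
    · exact hd₂
    · exact hd₁
    · exact hd₁₂
    · exact hd₂
    · rw [abs_sub_comm]; exact hd₁₂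
  obtain ⟨M, hM0, hM⟩ := Tile.sum_amp_le (n₀ := n₀) hχ hK hadm hsep hp hp1
  refine ⟨M, hM0, ?_⟩
  intro Ω _ q o e n hq S κ z huniq hc₀ hc₁ hc₂ hz f g h hf hg hh hfm hgm hhm hfi hgi hhi u hu0 hu1 N
  set cell : Tile → Finset (Ω × ℕ × ℤ × ℤ) := fun P =>
    S.filter (fun s => s.2.1 = P.scale ∧ z s = P.freq) with hcell
  have hcm : ∀ P s, s ∈ cell P → s ∈ S ∧ s.2.1 = P.scale ∧ z s = P.freq := fun P s hs =>
    Finset.mem_filter.mp hs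
  set φ₀ : Ω × ℕ × ℤ × ℤ → Unit × ℤ × ℤ := fun s => ((), κ s, s.2.2.1) with hφ₀
  set φ₁ : Ω × ℕ × ℤ × ℤ → Unit × ℤ × ℤ := fun s => ((), κ s + n s.1, s.2.2.2) with hφ₁
  set φ₂ : Ω × ℕ × ℤ × ℤ → Ω × ℤ × ℤ := fun s => (s.1, κ s, -(s.2.2.1 + s.2.2.2)) with hφ₂
  set D₀ : Sampling (Unit × ℤ × ℤ) Unit :=
    ⟨fun P => (cell P).image φ₀, Prod.fst, fun a => a.2.2, fun P _ => (P.pos + u) * 2 ^ P.scale⟩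
    with hD₀
  set D₁ : Sampling (Unit × ℤ × ℤ) Unit :=
    ⟨fun P => (cell P).image φ₁, Prod.fst, fun a => a.2.2, fun P _ => (P.pos + u) * 2 ^ P.scale⟩
    with hD₁
  set D₂ : Sampling (Ω × ℤ × ℤ) Ω :=
    ⟨fun P => (cell P).image φ₂, Prod.fst, fun a => a.2.2, fun P _ => (P.pos + u) * 2 ^ P.scale⟩
    with hD₂
  set T : (Ω × ℕ × ℤ × ℤ) × ℤ → Tile := fun x => ⟨x.1.2.1, x.2, z x.1⟩ with hT
  set U : Finset Tile := (S ×ˢ N).image T with hU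
  have htime : ∀ P : Tile, P.InTime ((P.pos + u) * 2 ^ P.scale) := fun P =>
    ⟨mul_le_mul_of_nonneg_right (by linarith) (by positivity),
      mul_le_mul_of_nonneg_right (by linarith) (by positivity)⟩
  have hfr : ∀ P ∈ U, 0 ≤ (P.freq : ℝ) ∧ (P.freq : ℝ) ≤ 2 ^ P.scale * (q / 2) := by
    intro P hP
    obtain ⟨x, hx, rfl⟩ := Finset.mem_image.mp hP
    exact hz x.1 (Finset.mem_product.mp hx).1
  have v₀ : D₀.Valid ρ B (d 0) n₀ U := by
    refine Sampling.valid_of_line (α := 1) (b := fun _ => -o) (d := 0) (E := E) (q := q) (fun _ => rfl)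
      (fun _ => rfl) one_ne_zero hρ (by simpa using hE0) (by simp; linarith) (by simpa using hB₀)
      hn0 (fun P _ a _ => htime P) ?_ hfr
    intro P _ a ha
    obtain ⟨s, hs, rfl⟩ := Finset.mem_image.mp ha
    obtain ⟨h1, h2, h3⟩ := hcm P s hs
    have := hc₀ s h1
    rw [h2, h3] at this
    rw [one_mul, add_zero]
    exact this
  have v₁ : D₁.Valid ρ B (d 1) n₀ U := by
    refine Sampling.valid_of_line (α := 1 / t) (b := fun _ => -(e / t) - o) (d := d₁) (E := E) (q := q)
      (fun _ => rfl) (fun _ => rfl) (one_div_ne_zero ht) hρ hE₁ (by linarith) hB₁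
      hn1 (fun P _ a _ => htime P) ?_ hfr
    intro P _ a ha
    obtain ⟨s, hs, rfl⟩ := Finset.mem_image.mp ha
    obtain ⟨h1, h2, h3⟩ := hcm P s hs
    have := hc₁ s h1
    rw [h2, h3] at this
    simpa [hφ₁] using this
  have v₂ : D₂.Valid ρ B (d 2) n₀ U := by
    refine Sampling.valid_of_line (α := -1 / (1 + t))
      (b := fun ω => -((e + n ω * (q * t)) / (1 + t)) - o) (d := d₂) (E := E) (q := q)
      (fun _ => rfl) (fun _ => rfl) (div_ne_zero (by norm_num) ht1) hρ hE₂ (by linarith) hB₂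
      hn2 (fun P _ a _ => htime P) ?_ hfr
    intro P _ a ha
    obtain ⟨s, hs, rfl⟩ := Finset.mem_image.mp ha
    obtain ⟨h1, h2, h3⟩ := hcm P s hs
    have := hc₂ s h1
    rw [h2, h3] at this
    rw [← this]
    congr 2
    simp only [hφ₂]
    push_cast
    ring
  have key := hM D₀ D₁ D₂ U v₀ v₁ v₂ (fun _ => f) (fun _ => g) h (fun _ => hf) (fun _ => hg) hh
    (fun _ => hfm) (fun _ => hgm) hhm (by simpa using hfi) (by simpa using hgi) hhi
  simp only [Finset.univ_unique, Finset.sum_singleton] at key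
  refine le_trans ?_ key
  set F : (Ω × ℕ × ℤ × ℤ) × ℤ → ℝ := fun x =>
    2 ^ x.1.2.1 * (‖coef (χ 0) f x.1.2.1 x.1.2.2.1 ((x.2 + u) * 2 ^ x.1.2.1)‖ *
    ‖coef (χ 1) g x.1.2.1 x.1.2.2.2 ((x.2 + u) * 2 ^ x.1.2.1)‖ *
    ‖coef (χ 2) (h x.1.1) x.1.2.1 (-(x.1.2.2.1 + x.1.2.2.2)) ((x.2 + u) * 2 ^ x.1.2.1)‖) with hF
  have e1 : ∑ s ∈ S, cubeForm χ f g h u N s = ∑ x ∈ S ×ˢ N, F x := by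
    rw [Finset.sum_product]
    rfl
  rw [e1, ← Finset.sum_fiberwise_of_maps_to (g := T) (t := U)
    (fun x hx => Finset.mem_image_of_mem _ hx)]
  refine Finset.sum_le_sum fun P hP => ?_
  obtain ⟨x₀, hx₀, hx₀P⟩ := Finset.mem_image.mp hP
  have hposN : P.pos ∈ N := by rw [← hx₀P]; exact (Finset.mem_product.mp hx₀).2
  have e2 : ∑ x ∈ S ×ˢ N with T x = P, F x = ∑ s ∈ cell P, F (s, P.pos) := by
    refine Finset.sum_nbij Prod.fst ?_ ?_ ?_ ?_
    · intro x hx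
      obtain ⟨h1, h2⟩ := Finset.mem_filter.mp hx
      refine Finset.mem_filter.mpr ⟨(Finset.mem_product.mp h1).1, ?_, ?_⟩
      · rw [← h2]
      · rw [← h2]
    · intro x hx y hy hxy
      obtain ⟨h1, h2⟩ := Finset.mem_filter.mp hx
      obtain ⟨h3, h4⟩ := Finset.mem_filter.mp hy
      refine Prod.ext hxy ?_
      have a1 : x.2 = P.pos := by rw [← h2]
      have a2 : y.2 = P.pos := by rw [← h4]
      exact a1.trans a2.symm
    · intro s hs
      obtain ⟨h1, h2, h3⟩ := hcm P s hs
      refine ⟨(s, P.pos), Finset.mem_filter.mpr ⟨Finset.mem_product.mpr ⟨h1, hposN⟩, ?_⟩, rfl⟩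
      simp only [hT, h2, h3]
    · intro x hx
      obtain ⟨h1, h2⟩ := Finset.mem_filter.mp hx
      rw [← h2]
  rw [e2]
  have inj01 : Set.InjOn (fun s => (φ₀ s, φ₁ s)) (cell P) := by
    intro s hs s' hs' hss
    obtain ⟨h1, h2, h3⟩ := hcm P s hs
    obtain ⟨h1', h2', h3'⟩ := hcm P s' hs'
    simp only [hφ₀, hφ₁, Prod.mk.injEq] at hss
    have hk : s.2 = s'.2 := Prod.ext (h2.trans h2'.symm) (Prod.ext hss.1.2.2 hss.2.2.2)
    exact Prod.ext (huniq s h1 s' h1' hk) hk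
  have inj2 : Set.InjOn φ₂ (cell P) := by
    intro s hs s' hs' hss
    obtain ⟨h1, h2, h3⟩ := hcm P s hs
    obtain ⟨h1', h2', h3'⟩ := hcm P s' hs'
    simp only [hφ₂, Prod.mk.injEq] at hss
    obtain ⟨a1, a2, a3⟩ := hss
    have b1 := hc₀ s h1
    have b2 := hc₀ s' h1'
    rw [Int.floor_intCast_add] at b1 b2
    rw [h2, h3] at b1
    rw [h2', h3', ← a2] at b2
    have hk : s.2.2.1 = s'.2.2.1 := by omega
    exact Prod.ext a1 (Prod.ext (h2.trans h2'.symm) (Prod.ext hk (by omega)))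
  have main := sum_mul_mul_le_sqrt (cell P) φ₀ φ₁ φ₂ inj01 inj2
    (fun a => ‖D₀.atomCoef (χ 0) (fun _ => f) P a‖) (fun a => ‖D₁.atomCoef (χ 1) (fun _ => g) P a‖)
    (fun a => ‖D₂.atomCoef (χ 2) h P a‖)
  have e3 : ∑ s ∈ cell P, F (s, P.pos) = P.len * ∑ s ∈ cell P,
      ‖D₀.atomCoef (χ 0) (fun _ => f) P (φ₀ s)‖ * ‖D₁.atomCoef (χ 1) (fun _ => g) P (φ₁ s)‖ *
        ‖D₂.atomCoef (χ 2) h P (φ₂ s)‖ := by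
    rw [Finset.mul_sum]
    refine Finset.sum_congr rfl fun s hs => ?_
    obtain ⟨h1, h2, h3⟩ := hcm P s hs
    simp only [hF, h2]
    rfl
  rw [e3]
  exact mul_le_mul_of_nonneg_left main P.len_pos.le

lemma abs_floor_sub_floor_sub_le {x y a : ℝ} (h : x - y = a) :
    |((⌊x⌋ - ⌊y⌋ : ℤ) : ℝ) - a| ≤ 1 := by
  have h1 := Int.floor_le x
  have h2 := Int.lt_floor_add_one x
  have h3 := Int.floor_le y
  have h4 := Int.lt_floor_add_one y
  push_cast
  rw [abs_le]
  constructor <;> linarith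

/-- The trilinear form restricted to the frequency cubes near the lines `ξ₂ - t ξ₁ = e₀ + n L`. -/
theorem exists_cubeForm_edge_bound {ρ : ℝ} (hρ : 0 ≤ ρ) {t : ℝ} (ht : t ≠ 0) (ht1 : 1 + t ≠ 0) :
    ∃ K₀ : ℝ, 0 < K₀ ∧ ∀ K : ℝ, K₀ ≤ K → ∀ {χ : Fin 3 → 𝓢(ℝ, ℂ)},
      (∀ i η, ρ < |η| → χ i η = 0) → ∀ {p : Fin 3 → ℝ}, (∀ i, 2 < p i) →
      1 / p 0 + 1 / p 1 + 1 / p 2 = 1 →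
    ∃ M : ℝ, 0 ≤ M ∧ ∀ {Ω : Type} [Fintype Ω] (L e₀ : ℝ) (n : Ω → ℤ), K ≤ L →
      ∀ S : Finset (Ω × ℕ × ℤ × ℤ),
      (∀ s ∈ S, ∀ s' ∈ S, s.2 = s'.2 → s.1 = s'.1) →
      (∀ s ∈ S, K ≤ |s.2.2.2 - t * s.2.2.1 - 2 ^ s.2.1 * (e₀ + n s.1 * L)| ∧
        |s.2.2.2 - t * s.2.2.1 - 2 ^ s.2.1 * (e₀ + n s.1 * L)| ≤ 3 * K) →
      ∀ (f g : ℝ → ℂ) (h : Ω → ℝ → ℂ), MemLp f 2 → MemLp g 2 → (∀ ω, MemLp (h ω) 2) →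
      Measurable f → Measurable g → (∀ ω, Measurable (h ω)) →
      (Integrable fun y => (‖f y‖ ^ 2) ^ (p 0 / 2)) →
      (Integrable fun y => (‖g y‖ ^ 2) ^ (p 1 / 2)) →
      (Integrable fun y => (∑ ω, ‖h ω y‖ ^ 2) ^ (p 2 / 2)) →
      ∀ u : ℝ, 0 ≤ u → u ≤ 1 → ∀ N : Finset ℤ, ∑ s ∈ S, cubeForm χ f g h u N s ≤
        M * ((∫ y, (‖f y‖ ^ 2) ^ (p 0 / 2)) ^ (1 / p 0) *
          (∫ y, (‖g y‖ ^ 2) ^ (p 1 / 2)) ^ (1 / p 1) *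
          (∫ y, (∑ ω, ‖h ω y‖ ^ 2) ^ (p 2 / 2)) ^ (1 / p 2)) := by
  classical
  have hta : 0 < |t| := abs_pos.mpr ht
  have ht1a : 0 < |1 + t| := abs_pos.mpr ht1
  set B : ℝ := 2 * (ρ + 1) + 2 * (|1 / t| * ρ + 1) + 2 * (|-1 / (1 + t)| * ρ + 1) with hB
  have hb0 : 0 ≤ |1 / t| * ρ := by positivity
  have hb1 : 0 ≤ |-1 / (1 + t)| * ρ := by positivity
  have hBpos : 0 < B := by simp only [hB]; linarith
  refine ⟨(4 * B + 6) * (|t| + |1 + t| + |t * (1 + t)|), by positivity, ?_⟩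
  intro K hK χ hχ p hp hp1
  have hK1 : (4 * B + 6) * |t| ≤ K := le_trans (mul_le_mul_of_nonneg_left
    (by linarith [abs_nonneg (t * (1 + t))]) (by linarith)) hK
  have hK2 : (4 * B + 6) * |1 + t| ≤ K := le_trans (mul_le_mul_of_nonneg_left
    (by linarith [abs_nonneg (t * (1 + t))]) (by linarith)) hK
  have hK3 : (4 * B + 6) * |t * (1 + t)| ≤ K := le_trans (mul_le_mul_of_nonneg_left
    (by linarith [abs_nonneg (t * (1 + t))]) (by linarith)) hK
  have hKpos : 0 < K := lt_of_lt_of_le (by positivity) hK1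
  set E : ℝ := 3 * K / |t| + 3 * K / |1 + t| + 1 with hE
  obtain ⟨m, hm⟩ := exists_nat_gt (4 * (E + B) * |t| / K)
  have hE0 : 0 < E := by positivity
  have hm0 : 0 < (m : ℝ) := lt_of_le_of_lt (by positivity) hm
  have hm0' : 0 < (m : ℤ) := by exact_mod_cast hm0
  set cond : ℤ × ℤ → Prop := fun d => |(d.1 : ℝ)| ≤ E ∧ |(d.2 : ℝ)| ≤ E ∧
    4 * B + 4 ≤ |(d.1 : ℝ)| ∧ 4 * B + 4 ≤ |(d.2 : ℝ)| ∧ 4 * B + 4 ≤ |(d.1 : ℝ) - d.2| with hcond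
  have hcell := fun d : {d : ℤ × ℤ // cond d} => exists_cubeForm_cell_bound hρ hχ ht ht1
    d.2.1 d.2.2.1 (B := B) (by linarith) (by linarith) (by linarith) d.2.2.2.1 d.2.2.2.2.1
    d.2.2.2.2.2 hp hp1
  choose M hM0 hM using hcell
  set M' : ℤ × ℤ → ℝ := fun d => if h : cond d then M ⟨d, h⟩ else 0 with hM'
  have hM'0 : ∀ d, 0 ≤ M' d := by
    intro d
    simp only [hM']
    split_ifs
    exacts [hM0 _, le_rfl]
  set R : Finset ℤ := Finset.Icc (-⌈E⌉) ⌈E⌉ with hR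
  have hmemR : ∀ d : ℤ, |(d : ℝ)| ≤ E → d ∈ R := by
    intro d hd
    obtain ⟨h1, h2⟩ := abs_le.mp hd
    have h3 := Int.le_ceil E
    rw [hR, Finset.mem_Icc]
    constructor
    · have : ((-⌈E⌉ : ℤ) : ℝ) ≤ d := by push_cast; linarith
      exact_mod_cast this
    · have : (d : ℝ) ≤ (⌈E⌉ : ℤ) := h2.trans h3
      exact_mod_cast this
  set Γ : Finset (ℤ × ℤ × ℤ × ℤ) := (Finset.Ico 0 (m : ℤ)) ×ˢ ({0, 1} : Finset ℤ) ×ˢ R ×ˢ R with hΓ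
  refine ⟨∑ γ ∈ Γ, M' γ.2.2, Finset.sum_nonneg fun _ _ => hM'0 _, ?_⟩
  intro Ω _ L e₀ n hL S huniq hS f g h hf hg hh hfm hgm hhm hfi hgi hhi u hu0 hu1 N
  set X := ((∫ y, (‖f y‖ ^ 2) ^ (p 0 / 2)) ^ (1 / p 0) *
          (∫ y, (‖g y‖ ^ 2) ^ (p 1 / 2)) ^ (1 / p 1) *
          (∫ y, (∑ ω, ‖h ω y‖ ^ 2) ^ (p 2 / 2)) ^ (1 / p 2)) with hX
  set q : ℝ := m * L / |t| with hq
  have hL0 : 0 < L := hKpos.trans_le hL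
  have hqpos : 0 < q := by positivity
  have hqE : 4 * (E + B) < q := by
    rw [hq, lt_div_iff₀ hta]
    rw [div_lt_iff₀ hKpos] at hm
    exact hm.trans_le (mul_le_mul_of_nonneg_left hL hm0.le)
  set sg : ℤ := if 0 < t then 1 else -1 with hsg
  have hsgt : (sg : ℝ) * t = |t| := by
    simp only [hsg]
    split_ifs with h0
    · rw [abs_of_pos h0]; simp
    · rw [abs_of_nonpos (not_lt.mp h0)]; simp
  have hsgq : ∀ i : ℤ, ((sg * i : ℤ) : ℝ) * (q * t) = i * (m * L) := by
    intro i
    have : ((sg * i : ℤ) : ℝ) * (q * t) = (sg * t) * q * i := by push_cast; ring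
    rw [this, hsgt, hq]
    field_simp
  set κ : Ω × ℕ × ℤ × ℤ → ℤ := fun s => ⌊(s.2.2.1 : ℝ) / 2 ^ s.2.1 / q⌋ with hκ
  set b : Ω × ℕ × ℤ × ℤ → ℤ := fun s =>
    if Int.fract ((s.2.2.1 : ℝ) / 2 ^ s.2.1 / q) < 1 / 2 then 0 else 1 with hb
  set x₀ : Ω × ℕ × ℤ × ℤ → ℝ := fun s =>
    (s.2.2.1 : ℝ) + 2 ^ s.2.1 * (-(b s * (q / 2)) - κ s * q) with hx₀
  set x₁ : Ω × ℕ × ℤ × ℤ → ℝ := fun s => 1 / t * s.2.2.2 + 2 ^ s.2.1 *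
    (-((e₀ + (n s.1 % m : ℤ) * L) / t) - (b s * (q / 2)) - (κ s + (sg * (n s.1 / m) : ℤ)) * q)
    with hx₁
  set x₂ : Ω × ℕ × ℤ × ℤ → ℝ := fun s => ((s.2.2.1 : ℝ) + s.2.2.2) / (1 + t) + 2 ^ s.2.1 *
    (-((e₀ + (n s.1 % m : ℤ) * L + (sg * (n s.1 / m) : ℤ) * (q * t)) / (1 + t)) - (b s * (q / 2))
      - κ s * q) with hx₂
  set v : Ω × ℕ × ℤ × ℤ → ℝ := fun s =>
    s.2.2.2 - t * s.2.2.1 - 2 ^ s.2.1 * (e₀ + n s.1 * L) with hv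
  have hn : ∀ ω, (n ω : ℝ) = m * ((n ω / m : ℤ) : ℝ) + ((n ω % m : ℤ) : ℝ) := by
    intro ω
    exact_mod_cast (Int.mul_ediv_add_emod (n ω) m).symm
  have hx10 : ∀ s, x₁ s - x₀ s = v s / t := by
    intro s
    have h1 := hsgq (n s.1 / m)
    have h2 : ((sg * (n s.1 / m) : ℤ) : ℝ) * q = ((n s.1 / m : ℤ) : ℝ) * (m * L) / t := by
      rw [eq_div_iff ht, ← h1]; ring
    simp only [hx₁, hx₀, hv, add_mul, h2, hn s.1]
    field_simp
    ring
  have hx20 : ∀ s, x₂ s - x₀ s = v s / (1 + t) := by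
    intro s
    simp only [hx₂, hx₀, hv, hsgq, hn s.1]
    field_simp
    ring
  have hx12 : ∀ s, x₁ s - x₂ s = v s / (t * (1 + t)) := by
    intro s
    have : x₁ s - x₂ s = v s / t - v s / (1 + t) := by rw [← hx10, ← hx20]; ring
    rw [this]
    field_simp
    ring
  set D₁ : Ω × ℕ × ℤ × ℤ → ℤ := fun s => ⌊x₁ s⌋ - ⌊x₀ s⌋ with hD₁
  set D₂ : Ω × ℕ × ℤ × ℤ → ℤ := fun s => ⌊x₂ s⌋ - ⌊x₀ s⌋ with hD₂
  have hlow : ∀ (w c : ℝ) (d : ℝ), c ≠ 0 → (4 * B + 6) * |c| ≤ K → K ≤ |w| → |d - w / c| ≤ 1 →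
      4 * B + 4 ≤ |d| := by
    intro w c d hc h1 h2 h3
    have h4 : 4 * B + 6 ≤ |w / c| := by
      rw [abs_div, le_div_iff₀ (abs_pos.mpr hc)]; exact h1.trans h2
    have h5 := abs_sub_abs_le_abs_sub (w / c) d
    rw [abs_sub_comm] at h5
    linarith
  have hupp : ∀ (w c : ℝ) (d : ℝ), |w| ≤ 3 * K → |d - w / c| ≤ 1 → |d| ≤ 3 * K / |c| + 1 := by
    intro w c d h1 h2
    have h3 : |w / c| ≤ 3 * K / |c| := by
      rw [abs_div]; exact div_le_div_of_nonneg_right h1 (abs_nonneg _)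
    have h5 := abs_sub_abs_le_abs_sub d (w / c)
    linarith
  have hcondS : ∀ s ∈ S, cond (D₁ s, D₂ s) := by
    intro s hs
    obtain ⟨g1, g2⟩ := hS s hs
    have a1 := abs_floor_sub_floor_sub_le (hx10 s)
    have a2 := abs_floor_sub_floor_sub_le (hx20 s)
    have a3 := abs_floor_sub_floor_sub_le (hx12 s)
    have p1 : 0 ≤ 3 * K / |t| := by positivity
    have p2 : 0 ≤ 3 * K / |1 + t| := by positivity
    refine ⟨(hupp _ _ _ g2 a1).trans (by linarith), (hupp _ _ _ g2 a2).trans (by linarith),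
      hlow _ _ _ ht hK1 g1 a1, hlow _ _ _ ht1 hK2 g1 a2, ?_⟩
    have := hlow _ _ _ (mul_ne_zero ht ht1) hK3 g1 a3
    have e : ((D₁ s : ℝ) - D₂ s) = ((⌊x₁ s⌋ - ⌊x₂ s⌋ : ℤ) : ℝ) := by
      simp only [hD₁, hD₂]; push_cast; ring
    rw [e]; exact this
  set cls : Ω × ℕ × ℤ × ℤ → ℤ × ℤ × ℤ × ℤ := fun s => (n s.1 % m, b s, D₁ s, D₂ s) with hcls
  have hmaps : ∀ s ∈ S, cls s ∈ Γ := by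
    intro s hs
    have hc := hcondS s hs
    simp only [hΓ, hcls, Finset.mem_product, Finset.mem_Ico]
    refine ⟨⟨Int.emod_nonneg _ hm0'.ne', Int.emod_lt_of_pos _ hm0'⟩, ?_, hmemR _ hc.1,
      hmemR _ hc.2.1⟩
    simp only [hb]
    split_ifs <;> simp
  rw [← Finset.sum_fiberwise_of_maps_to hmaps, Finset.sum_mul]
  refine Finset.sum_le_sum fun γ _ => ?_
  set S' := S.filter (fun s => cls s = γ) with hS'
  have hS'm : ∀ s ∈ S', s ∈ S ∧ cls s = γ := fun s hs => Finset.mem_filter.mp hs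
  by_cases hγ : cond γ.2.2
  · have e : M' γ.2.2 = M ⟨γ.2.2, hγ⟩ := by simp only [hM']; rw [dif_pos hγ]
    rw [e]
    refine hM ⟨γ.2.2, hγ⟩ q (γ.2.1 * (q / 2)) (e₀ + γ.1 * L) (fun ω => sg * (n ω / m)) hqE S' κ
      (fun s => ⌊x₀ s⌋) ?_ ?_ ?_ ?_ ?_ f g h hf hg hh hfm hgm hhm hfi hgi hhi u hu0 hu1 N
    · exact fun s hs s' hs' => huniq s (hS'm s hs).1 s' (hS'm s' hs').1
    · intro s hs
      rw [← (hS'm s hs).2]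
    · intro s hs
      change ⌊_⌋ = ⌊x₀ s⌋ + γ.2.2.1
      rw [← (hS'm s hs).2]
      change ⌊x₁ s⌋ = ⌊x₀ s⌋ + (⌊x₁ s⌋ - ⌊x₀ s⌋)
      ring
    · intro s hs
      change ⌊_⌋ = ⌊x₀ s⌋ + γ.2.2.2
      rw [← (hS'm s hs).2]
      change ⌊x₂ s⌋ = ⌊x₀ s⌋ + (⌊x₂ s⌋ - ⌊x₀ s⌋)
      ring
    · intro s _
      have hLj : (0 : ℝ) < 2 ^ s.2.1 := by positivity
      set w : ℝ := (s.2.2.1 : ℝ) / 2 ^ s.2.1 / q with hw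
      have hwe : (s.2.2.1 : ℝ) = 2 ^ s.2.1 * q * w := by rw [hw]; field_simp
      have hfl : w = κ s + Int.fract w := by simp only [hκ]; exact (Int.floor_add_fract w).symm
      have hx : x₀ s = 2 ^ s.2.1 * q * (Int.fract w - b s / 2) := by
        simp only [hx₀]
        rw [hwe]
        nth_rw 1 [hfl]
        ring
      have h0 : 0 ≤ Int.fract w - b s / 2 ∧ Int.fract w - b s / 2 ≤ 1 / 2 := by
        simp only [hb]
        have f1 := Int.fract_nonneg w
        have f2 := Int.fract_lt_one w
        split_ifs with hlt
        · push_cast; constructor <;> linarith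
        · push_cast; constructor <;> linarith
      have hx0 : 0 ≤ x₀ s := by rw [hx]; exact mul_nonneg (by positivity) h0.1
      have hx1 : x₀ s ≤ 2 ^ s.2.1 * (q / 2) := by
        rw [hx]
        have := mul_le_mul_of_nonneg_left h0.2 (by positivity : 0 ≤ 2 ^ s.2.1 * q)
        linarith
      constructor
      · exact_mod_cast Int.floor_nonneg.mpr hx0
      · exact (Int.floor_le _).trans hx1
  · have : S' = ∅ := by
      refine Finset.eq_empty_of_forall_notMem fun s hs => hγ ?_
      rw [← (hS'm s hs).2]
      exact hcondS s (hS'm s hs).1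
    rw [this, Finset.sum_empty]
    exact mul_nonneg (hM'0 _) (by positivity)

lemma fourier_packet_eq_shift (χ : ℝ → ℂ) (j : ℕ) (k : ℤ) (x y : ℝ) :
    𝓕 (packet χ j k x) y = 𝓕 (packet χ j k 0) (y - x) := by
  rw [Real.fourier_real_eq_integral_exp_smul, Real.fourier_real_eq_integral_exp_smul]
  refine integral_congr_ae (.of_forall fun η => ?_)
  simp only [packet, smul_eq_mul]
  rw [mul_left_comm, mul_left_comm (Complex.exp _) (χ _), ← Complex.exp_add, ← Complex.exp_add]
  congr 2
  push_cast
  ring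

lemma measurable_coef (χ : 𝓢(ℝ, ℂ)) {ρ : ℝ} (hχ : ∀ η, ρ < |η| → χ η = 0) {f : ℝ → ℂ}
    (hf : Measurable f) (j : ℕ) (k : ℤ) : Measurable (coef χ f j k) := by
  obtain ⟨B, hB, -⟩ := exists_schwartz_packet χ hχ j k 0
  have h1 : Continuous (𝓕 (packet χ j k 0)) := by
    rw [← hB, ← SchwartzMap.fourier_coe]
    exact (𝓕 B).continuous
  have h2 : StronglyMeasurable (Function.uncurry fun x y : ℝ => f y * 𝓕 (packet χ j k x) y) := by
    have e : (Function.uncurry fun x y : ℝ => f y * 𝓕 (packet χ j k x) y) =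
        fun z : ℝ × ℝ => f z.2 * 𝓕 (packet χ j k 0) (z.2 - z.1) := by
      ext z
      simp only [Function.uncurry]
      rw [fourier_packet_eq_shift]
    rw [e]
    exact ((hf.comp measurable_snd).mul
      (h1.measurable.comp (measurable_snd.sub measurable_fst))).stronglyMeasurable
  exact h2.integral_prod_right.measurable

lemma lintegral_eq_lintegral_tsum {φ : ℝ → ℝ≥0∞} (hφ : Measurable φ) {c : ℝ} (hc : 0 < c) :
    ∫⁻ x, φ x = ∫⁻ u in Ioc (0 : ℝ) 1, ∑' i : ℤ, ENNReal.ofReal c * φ ((i + u) * c) := by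
  have hψ : Measurable fun x => ENNReal.ofReal c * φ (x * c) := by fun_prop
  have h1 : ∫⁻ x, φ x = ∫⁻ x, ENNReal.ofReal c * φ (x * c) := by
    conv_lhs => rw [← Real.smul_map_volume_mul_right hc.ne']
    rw [lintegral_smul_measure, lintegral_map hφ (by fun_prop), abs_of_pos hc,
      lintegral_const_mul _ (by fun_prop), smul_eq_mul]
  rw [h1, lintegral_tsum fun i => by fun_prop, ← setLIntegral_univ, ← iUnion_Ioc_intCast,
    lintegral_iUnion (fun _ => measurableSet_Ioc) (pairwise_disjoint_Ioc_intCast ℝ)]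
  refine tsum_congr fun i => ?_
  rw [← (measurePreserving_add_left volume (i : ℝ)).setLIntegral_comp_preimage measurableSet_Ioc hψ]
  congr 2
  ext u
  simp only [Set.mem_preimage, Set.mem_Ioc]
  constructor <;> rintro ⟨h1, h2⟩ <;> constructor <;> linarith

lemma sum_lintegral_le_of_sampling {ι : Type*} {S : Finset ι} {φ : ι → ℝ → ℝ} (h0 : ∀ s x, 0 ≤ φ s x)
    (hφ : ∀ s, Measurable (φ s)) {c : ι → ℝ} (hc : ∀ s, 0 < c s) {M : ℝ}
    (hM : ∀ u : ℝ, 0 ≤ u → u ≤ 1 → ∀ N : Finset ℤ,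
      ∑ s ∈ S, ∑ i ∈ N, c s * φ s ((i + u) * c s) ≤ M) :
    ∑ s ∈ S, ∫⁻ x, ENNReal.ofReal (φ s x) ≤ ENNReal.ofReal M := by
  have e : ∀ s, ∫⁻ x, ENNReal.ofReal (φ s x) = ∫⁻ u in Ioc (0 : ℝ) 1, ∑' i : ℤ,
      ENNReal.ofReal (c s * φ s ((i + u) * c s)) := by
    intro s
    rw [lintegral_eq_lintegral_tsum (hφ s).ennreal_ofReal (hc s)]
    simp_rw [ENNReal.ofReal_mul (hc s).le]
  simp_rw [e]
  rw [← lintegral_finsetSum]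
  · calc ∫⁻ u in Ioc (0 : ℝ) 1, ∑ s ∈ S, ∑' i : ℤ, ENNReal.ofReal (c s * φ s ((i + u) * c s))
        ≤ ∫⁻ _ in Ioc (0 : ℝ) 1, ENNReal.ofReal M := by
          refine setLIntegral_mono measurable_const fun u hu => ?_
          rw [← Summable.tsum_finsetSum fun _ _ => ENNReal.summable]
          rw [ENNReal.tsum_eq_iSup_sum]
          refine iSup_le fun N => ?_
          refine le_trans (le_of_eq ?_) (ENNReal.ofReal_le_ofReal (hM u hu.1.le hu.2 N))
          rw [Finset.sum_comm, ENNReal.ofReal_sum_of_nonneg fun s _ =>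
            Finset.sum_nonneg fun i _ => mul_nonneg (hc s).le (h0 _ _)]
          refine Finset.sum_congr rfl fun s _ => ?_
          rw [ENNReal.ofReal_sum_of_nonneg fun i _ => mul_nonneg (hc s).le (h0 _ _)]
      _ = ENNReal.ofReal M := by simp
  · intro s _
    refine Measurable.tsum fun i => ?_
    have := hφ s
    fun_prop

/-- Integral form of the bound for the frequency cubes near the lines `ξ₂ - t ξ₁ = e₀ + n L`. -/
theorem exists_lintegral_edge_bound {ρ : ℝ} (hρ : 0 ≤ ρ) {t : ℝ} (ht : t ≠ 0) (ht1 : 1 + t ≠ 0) :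
    ∃ K₀ : ℝ, 0 < K₀ ∧ ∀ K : ℝ, K₀ ≤ K → ∀ {χ : Fin 3 → 𝓢(ℝ, ℂ)},
      (∀ i η, ρ < |η| → χ i η = 0) → ∀ {p : Fin 3 → ℝ}, (∀ i, 2 < p i) →
      1 / p 0 + 1 / p 1 + 1 / p 2 = 1 →
    ∃ M : ℝ, 0 ≤ M ∧ ∀ {Ω : Type} [Fintype Ω] (L e₀ : ℝ) (n : Ω → ℤ), K ≤ L →
      ∀ S : Finset (Ω × ℕ × ℤ × ℤ),
      (∀ s ∈ S, ∀ s' ∈ S, s.2 = s'.2 → s.1 = s'.1) →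
      (∀ s ∈ S, K ≤ |s.2.2.2 - t * s.2.2.1 - 2 ^ s.2.1 * (e₀ + n s.1 * L)| ∧
        |s.2.2.2 - t * s.2.2.1 - 2 ^ s.2.1 * (e₀ + n s.1 * L)| ≤ 3 * K) →
      ∀ (f g : ℝ → ℂ) (h : Ω → ℝ → ℂ), MemLp f 2 → MemLp g 2 → (∀ ω, MemLp (h ω) 2) →
      Measurable f → Measurable g → (∀ ω, Measurable (h ω)) →
      (Integrable fun y => (‖f y‖ ^ 2) ^ (p 0 / 2)) →
      (Integrable fun y => (‖g y‖ ^ 2) ^ (p 1 / 2)) →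
      (Integrable fun y => (∑ ω, ‖h ω y‖ ^ 2) ^ (p 2 / 2)) →
      ∑ s ∈ S, ∫⁻ x, ENNReal.ofReal (‖coef (χ 0) f s.2.1 s.2.2.1 x‖ *
          ‖coef (χ 1) g s.2.1 s.2.2.2 x‖ *
          ‖coef (χ 2) (h s.1) s.2.1 (-(s.2.2.1 + s.2.2.2)) x‖) ≤
        ENNReal.ofReal (M * ((∫ y, (‖f y‖ ^ 2) ^ (p 0 / 2)) ^ (1 / p 0) *
          (∫ y, (‖g y‖ ^ 2) ^ (p 1 / 2)) ^ (1 / p 1) *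
          (∫ y, (∑ ω, ‖h ω y‖ ^ 2) ^ (p 2 / 2)) ^ (1 / p 2))) := by
  obtain ⟨K₀, hK₀, H⟩ := exists_cubeForm_edge_bound hρ ht ht1
  refine ⟨K₀, hK₀, fun K hK χ hχ p hp hp1 => ?_⟩
  obtain ⟨M, hM0, hM⟩ := H K hK hχ hp hp1
  refine ⟨M, hM0, ?_⟩
  intro Ω _ L e₀ n hL S hS1 hS2 f g h hf hg hh hfm hgm hhm hfi hgi hhi
  have hφm : ∀ s : Ω × ℕ × ℤ × ℤ, Measurable fun x => ‖coef (χ 0) f s.2.1 s.2.2.1 x‖ *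
      ‖coef (χ 1) g s.2.1 s.2.2.2 x‖ * ‖coef (χ 2) (h s.1) s.2.1 (-(s.2.2.1 + s.2.2.2)) x‖ :=
    fun s => ((measurable_coef _ (hχ 0) hfm _ _).norm.mul
      (measurable_coef _ (hχ 1) hgm _ _).norm).mul (measurable_coef _ (hχ 2) (hhm _) _ _).norm
  have hφ0 : ∀ (s : Ω × ℕ × ℤ × ℤ) (x : ℝ), 0 ≤ ‖coef (χ 0) f s.2.1 s.2.2.1 x‖ *
      ‖coef (χ 1) g s.2.1 s.2.2.2 x‖ * ‖coef (χ 2) (h s.1) s.2.1 (-(s.2.2.1 + s.2.2.2)) x‖ :=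
    fun s x => mul_nonneg (mul_nonneg (norm_nonneg _) (norm_nonneg _)) (norm_nonneg _)
  have hc : ∀ s : Ω × ℕ × ℤ × ℤ, (0 : ℝ) < 2 ^ s.2.1 := fun s => pow_pos two_pos _
  have hb := hM L e₀ n hL S hS1 hS2 f g h hf hg hh hfm hgm hhm hfi hgi hhi
  simp only [cubeForm] at hb
  exact sum_lintegral_le_of_sampling hφ0 hφm hc hb

/-- The restriction to the diagonal of the two-dimensional inverse Fourier transform. -/
noncomputable def diagInv (A : ℝ × ℝ → ℂ) (x : ℝ) : ℂ :=
  ∫ ξ : ℝ × ℝ, Complex.exp (((2 * π * x * (ξ.1 + ξ.2) : ℝ) : ℂ) * Complex.I) * A ξ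

lemma norm_diagInv_le (A : ℝ × ℝ → ℂ) (x : ℝ) : ‖diagInv A x‖ ≤ ∫ ξ, ‖A ξ‖ := by
  refine (norm_integral_le_integral_norm _).trans (le_of_eq ?_)
  simp only [norm_mul, Complex.norm_exp_ofReal_mul_I, one_mul]

lemma integrable_exp_mul {A : ℝ × ℝ → ℂ} (hA : Integrable A) (x : ℝ) :
    Integrable fun ξ : ℝ × ℝ =>
      Complex.exp (((2 * π * x * (ξ.1 + ξ.2) : ℝ) : ℂ) * Complex.I) * A ξ := by
  refine hA.bdd_mul (c := 1) (Continuous.aestronglyMeasurable (by fun_prop)) (.of_forall fun ξ => ?_)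
  rw [Complex.norm_exp_ofReal_mul_I]

lemma continuous_diagInv {A : ℝ × ℝ → ℂ} (hA : Integrable A) : Continuous (diagInv A) := by
  refine continuous_of_dominated (bound := fun ξ => ‖A ξ‖)
    (fun x => (integrable_exp_mul hA x).aestronglyMeasurable) (fun x => .of_forall fun ξ => ?_)
    hA.norm (.of_forall fun ξ => by fun_prop)
  rw [norm_mul, Complex.norm_exp_ofReal_mul_I, one_mul]

lemma diagInv_sum {ι : Type*} (S : Finset ι) {A : ι → ℝ × ℝ → ℂ} (hA : ∀ i ∈ S, Integrable (A i))
    (x : ℝ) : diagInv (fun ξ => ∑ i ∈ S, A i ξ) x = ∑ i ∈ S, diagInv (A i) x := by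
  simp only [diagInv, Finset.mul_sum]
  exact integral_finsetSum _ fun i hi => integrable_exp_mul (hA i hi) x

lemma diagInv_mul (F G : ℝ → ℂ) (x : ℝ) : diagInv (fun ξ => F ξ.1 * G ξ.2) x =
    (∫ η, F η * Complex.exp (((2 * π * x * η : ℝ) : ℂ) * Complex.I)) *
      ∫ η, G η * Complex.exp (((2 * π * x * η : ℝ) : ℂ) * Complex.I) := by
  rw [diagInv, Measure.volume_eq_prod, ← integral_prod_mul]
  refine integral_congr_ae (.of_forall fun ξ => ?_)
  have : Complex.exp (((2 * π * x * (ξ.1 + ξ.2) : ℝ) : ℂ) * Complex.I) =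
      Complex.exp (((2 * π * x * ξ.1 : ℝ) : ℂ) * Complex.I) *
        Complex.exp (((2 * π * x * ξ.2 : ℝ) : ℂ) * Complex.I) := by
    rw [← Complex.exp_add]; congr 1; push_cast; ring
  simp only [this]
  ring

lemma coef_eq_integral_fourier (χ : 𝓢(ℝ, ℂ)) {ρ : ℝ} (hχ : ∀ η, ρ < |η| → χ η = 0) (f : 𝓢(ℝ, ℂ))
    (j : ℕ) (k : ℤ) (x : ℝ) : coef χ f j k x = ∫ η, (𝓕 (f : ℝ → ℂ) η * χ (2 ^ j * η - k)) *
      Complex.exp (((2 * π * x * η : ℝ) : ℂ) * Complex.I) := by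
  obtain ⟨B, hB, -⟩ := exists_schwartz_packet χ hχ j k x
  have h := SchwartzMap.integral_fourier_mul_eq f B
  rw [coef, ← hB, ← SchwartzMap.fourier_coe, ← h, hB]
  refine integral_congr_ae (.of_forall fun η => ?_)
  simp only [packet, SchwartzMap.fourier_coe]
  ring

/-- Convolving with the Fourier transform of `B` reproduces functions whose frequencies `σ`
satisfy `B (-σ) = 1`. -/
lemma integral_diagInv_mul_convolution {A : ℝ × ℝ → ℂ} (hA : Integrable A) (B : 𝓢(ℝ, ℂ))
    (hAB : ∀ ξ, A ξ ≠ 0 → B (-(ξ.1 + ξ.2)) = 1) {h : ℝ → ℂ} (hh : Integrable h) :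
    ∫ x, diagInv A x * ∫ y, h y * 𝓕 (B : ℝ → ℂ) (y - x) = ∫ x, diagInv A x * h x := by
  have hB : Integrable (𝓕 (B : ℝ → ℂ)) := by
    rw [← SchwartzMap.fourier_coe]; exact (𝓕 B).integrable
  have hBc : Continuous (𝓕 (B : ℝ → ℂ)) := by
    rw [← SchwartzMap.fourier_coe]; exact (𝓕 B).continuous
  have hFF : ∀ σ, ∫ z, Complex.exp (((-2 * π * z * σ : ℝ) : ℂ) * Complex.I) •
      𝓕 (B : ℝ → ℂ) z = B (-σ) := by
    intro σ
    rw [← Real.fourier_real_eq_integral_exp_smul]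
    have := congrFun (B.continuous.fourierInv_fourier_eq B.integrable hB) (-σ)
    rw [Real.fourierInv_eq_fourier_neg, neg_neg] at this
    exact this
  have key : ∀ y, ∫ x, diagInv A x * 𝓕 (B : ℝ → ℂ) (y - x) = diagInv A y := by
    intro y
    rw [← integral_sub_left_eq_self (fun x => diagInv A x * 𝓕 (B : ℝ → ℂ) (y - x)) volume y]
    simp only [sub_sub_cancel, diagInv]
    simp only [← integral_mul_const]
    rw [integral_integral_swap]
    · refine integral_congr_ae (.of_forall fun ξ => ?_)
      have e : ∀ z : ℝ, Complex.exp (((2 * π * (y - z) * (ξ.1 + ξ.2) : ℝ) : ℂ) * Complex.I) * A ξ *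
          𝓕 (B : ℝ → ℂ) z = (Complex.exp (((2 * π * y * (ξ.1 + ξ.2) : ℝ) : ℂ) * Complex.I) * A ξ) *
            (Complex.exp (((-2 * π * z * (ξ.1 + ξ.2) : ℝ) : ℂ) * Complex.I) •
              𝓕 (B : ℝ → ℂ) z) := by
        intro z
        have : Complex.exp (((2 * π * (y - z) * (ξ.1 + ξ.2) : ℝ) : ℂ) * Complex.I) =
            Complex.exp (((2 * π * y * (ξ.1 + ξ.2) : ℝ) : ℂ) * Complex.I) *
              Complex.exp (((-2 * π * z * (ξ.1 + ξ.2) : ℝ) : ℂ) * Complex.I) := by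
          rw [← Complex.exp_add]; congr 1; push_cast; ring
        rw [this, smul_eq_mul]; ring
      simp only [e]
      rw [integral_const_mul, hFF]
      by_cases h0 : A ξ = 0
      · simp [h0]
      · rw [hAB ξ h0, mul_one]
    · have h1 : Integrable (fun w : ℝ × (ℝ × ℝ) => 𝓕 (B : ℝ → ℂ) w.1 * A w.2)
          (volume.prod volume) := hB.mul_prod hA
      have h2 := h1.bdd_mul (c := 1) (f := fun w : ℝ × (ℝ × ℝ) =>
          Complex.exp (((2 * π * (y - w.1) * (w.2.1 + w.2.2) : ℝ) : ℂ) * Complex.I))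
        (Continuous.aestronglyMeasurable (by fun_prop))
        (.of_forall fun w => by rw [Complex.norm_exp_ofReal_mul_I])
      refine h2.congr (.of_forall fun w => ?_)
      simp only [Function.uncurry]
      ring
  simp only [← integral_const_mul]
  rw [integral_integral_swap]
  · refine integral_congr_ae (.of_forall fun y => ?_)
    have e : ∀ x, diagInv A x * (h y * 𝓕 (B : ℝ → ℂ) (y - x)) =
        h y * (diagInv A x * 𝓕 (B : ℝ → ℂ) (y - x)) := fun x => by ring
    simp only [e]
    rw [integral_const_mul, key, mul_comm]
  · have h1 : Integrable (fun w : ℝ × ℝ => h w.2 * 𝓕 (B : ℝ → ℂ) (w.2 - w.1))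
        (volume.prod volume) := by
      refine (hh.convolution_integrand (ContinuousLinearMap.mul ℂ ℂ) hB.comp_neg).congr
        (.of_forall fun w => ?_)
      simp
    have h2 := h1.bdd_mul (c := ∫ ξ, ‖A ξ‖) (f := fun w : ℝ × ℝ => diagInv A w.1)
      (((continuous_diagInv hA).comp continuous_fst).aestronglyMeasurable)
      (.of_forall fun w => norm_diagInv_le A _)
    exact h2

lemma integrable_fourier_mul_cutoff {χ : 𝓢(ℝ, ℂ)} {ρ : ℝ} (hχ : ∀ η, ρ < |η| → χ η = 0)
    (f : 𝓢(ℝ, ℂ)) (j : ℕ) (k : ℤ) :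
    Integrable fun η => 𝓕 (f : ℝ → ℂ) η * χ (2 ^ j * η - k) := by
  obtain ⟨B, hB, -⟩ := exists_schwartz_packet χ hχ j k 0
  have e : ∀ η, χ (2 ^ j * η - k) = B η := by
    intro η; rw [hB]; simp [packet]
  simp only [e]
  have hfi : Integrable (𝓕 (f : ℝ → ℂ)) := by
    rw [← SchwartzMap.fourier_coe]; exact (𝓕 f).integrable
  obtain ⟨C, -, hC⟩ := B.decay 0 0
  refine hfi.mul_bdd (c := C) B.continuous.aestronglyMeasurable (.of_forall fun η => ?_)
  simpa using hC η

lemma coef_mul_coef_eq_diagInv {χ₁ χ₂ : 𝓢(ℝ, ℂ)} {ρ : ℝ} (h₁ : ∀ η, ρ < |η| → χ₁ η = 0)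
    (h₂ : ∀ η, ρ < |η| → χ₂ η = 0) (f g : 𝓢(ℝ, ℂ)) (j : ℕ) (k l : ℤ) (x : ℝ) :
    coef χ₁ f j k x * coef χ₂ g j l x = diagInv (fun ξ =>
      (𝓕 (f : ℝ → ℂ) ξ.1 * χ₁ (2 ^ j * ξ.1 - k)) * (𝓕 (g : ℝ → ℂ) ξ.2 * χ₂ (2 ^ j * ξ.2 - l))) x := by
  rw [coef_eq_integral_fourier χ₁ h₁, coef_eq_integral_fourier χ₂ h₂]
  exact (diagInv_mul (fun η => 𝓕 (f : ℝ → ℂ) η * χ₁ (2 ^ j * η - k)) _ x).symm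

/-- A product of two frequency-localised functions is reproduced by a wider frequency cutoff. -/
lemma integral_coef_mul_coef_mul {χ₁ χ₂ χ₃ : 𝓢(ℝ, ℂ)} {ρ : ℝ} (h₁ : ∀ η, 1 < |η| → χ₁ η = 0)
    (h₂ : ∀ η, 1 < |η| → χ₂ η = 0) (h₃ : ∀ η, ρ < |η| → χ₃ η = 0) (h₃' : ∀ η, |η| ≤ 2 → χ₃ η = 1)
    (f g : 𝓢(ℝ, ℂ)) {h : ℝ → ℂ} (hh : Integrable h) (j : ℕ) (k l : ℤ) :
    ∫ x, coef χ₁ f j k x * coef χ₂ g j l x * h x =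
      ∫ x, coef χ₁ f j k x * coef χ₂ g j l x * coef χ₃ h j (-(k + l)) x := by
  obtain ⟨B, hB, -⟩ := exists_schwartz_packet χ₃ h₃ j (-(k + l)) 0
  set A : ℝ × ℝ → ℂ := fun ξ => (𝓕 (f : ℝ → ℂ) ξ.1 * χ₁ (2 ^ j * ξ.1 - k)) *
    (𝓕 (g : ℝ → ℂ) ξ.2 * χ₂ (2 ^ j * ξ.2 - l)) with hA
  have hAi : Integrable A := (integrable_fourier_mul_cutoff h₁ f j k).mul_prod
    (integrable_fourier_mul_cutoff h₂ g j l)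
  have hd : ∀ x, coef χ₁ f j k x * coef χ₂ g j l x = diagInv A x := fun x =>
    coef_mul_coef_eq_diagInv h₁ h₂ f g j k l x
  have hc : ∀ x, coef χ₃ h j (-(k + l)) x = ∫ y, h y * 𝓕 (B : ℝ → ℂ) (y - x) := by
    intro x
    simp only [coef, hB, ← fourier_packet_eq_shift]
  simp only [hd, hc]
  refine (integral_diagInv_mul_convolution hAi B (fun ξ hξ => ?_) hh).symm
  have hm : |2 ^ j * ξ.1 - k| ≤ 1 ∧ |2 ^ j * ξ.2 - l| ≤ 1 := by
    constructor <;> by_contra hn <;> apply hξ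
    · simp only [hA]; rw [h₁ _ (not_le.mp hn)]; ring
    · simp only [hA]; rw [h₂ _ (not_le.mp hn)]; ring
  rw [hB]
  simp only [packet, mul_zero, zero_mul, Complex.ofReal_zero, Complex.exp_zero, mul_one]
  apply h₃'
  obtain ⟨a1, a2⟩ := abs_le.mp hm.1
  obtain ⟨b1, b2⟩ := abs_le.mp hm.2
  push_cast
  rw [abs_le]
  constructor <;> linarith

/-- A smooth bump supported in `[-1, 1]` whose integer translates form a partition of unity. -/
noncomputable def unitBump (x : ℝ) : ℝ := smoothTransition (x + 1) - smoothTransition x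

lemma unitBump_nonneg (x : ℝ) : 0 ≤ unitBump x :=
  sub_nonneg.mpr (smoothTransition.monotone (by linarith))

lemma unitBump_eq_zero {x : ℝ} (hx : 1 ≤ |x|) : unitBump x = 0 := by
  rcases le_abs.mp hx with h | h
  · rw [unitBump, smoothTransition.one_of_one_le h, smoothTransition.one_of_one_le (by linarith),
      sub_self]
  · rw [unitBump, smoothTransition.zero_of_nonpos (by linarith),
      smoothTransition.zero_of_nonpos (by linarith), sub_self]

lemma contDiff_unitBump : ContDiff ℝ (⊤ : ℕ∞) unitBump := by
  have h := smoothTransition.contDiff (n := (⊤ : ℕ∞))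
  exact (h.comp (by fun_prop)).sub h

/-- The offsets between an integer and the double of an integer at the next coarser scale. -/
def offsets : Finset ℤ := {-2, -1, 0, 1, 2}

lemma sum_offsets (φ : ℤ → ℝ) : ∑ i ∈ offsets, φ i = φ (-2) + φ (-1) + φ 0 + φ 1 + φ 2 := by
  simp [offsets]
  ring

lemma sum_unitBump_two_mul_sub {y : ℝ} (hy : |y| ≤ 1) :
    ∑ i ∈ offsets, unitBump (2 * y - i) = 1 := by
  obtain ⟨h1, h2⟩ := abs_le.mp hy
  rw [sum_offsets]
  simp only [unitBump]
  push_cast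
  rw [show 2 * y - -2 + 1 = 2 * y + 3 by ring, show 2 * y - -1 + 1 = 2 * y - -2 by ring,
    show 2 * y - 0 + 1 = 2 * y - -1 by ring, show 2 * y - 1 + 1 = 2 * y - 0 by ring,
    show 2 * y - 2 + 1 = 2 * y - 1 by ring,
    smoothTransition.one_of_one_le (show 1 ≤ 2 * y + 3 by linarith),
    smoothTransition.zero_of_nonpos (show 2 * y - 2 ≤ 0 by linarith)]
  ring

lemma sum_unitBump_half {x : ℝ} (hx : |x| ≤ 1) (k : ℤ) :
    ∑ i ∈ offsets, (if 2 ∣ k - i then unitBump ((x + i) / 2) else 0) = 1 := by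
  obtain ⟨h1, h2⟩ := abs_le.mp hx
  rw [sum_offsets]
  rcases Int.even_or_odd' k with ⟨m, rfl | rfl⟩
  · rw [if_pos (by omega), if_neg (by omega), if_pos (by omega), if_neg (by omega),
      if_pos (by omega)]
    simp only [unitBump]
    push_cast
    rw [show (x + -2) / 2 + 1 = (x + 0) / 2 by ring, show (x + 0) / 2 + 1 = (x + 2) / 2 by ring,
      smoothTransition.one_of_one_le (show 1 ≤ (x + 2) / 2 + 1 by linarith),
      smoothTransition.zero_of_nonpos (show (x + -2) / 2 ≤ 0 by linarith)]
    ring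
  · rw [if_neg (by omega), if_pos (by omega), if_neg (by omega), if_pos (by omega),
      if_neg (by omega)]
    simp only [unitBump]
    push_cast
    rw [show (x + -1) / 2 + 1 = (x + 1) / 2 by ring,
      smoothTransition.one_of_one_le (show 1 ≤ (x + 1) / 2 + 1 by linarith),
      smoothTransition.zero_of_nonpos (show (x + -1) / 2 ≤ 0 by linarith)]
    ring

/-- The one-dimensional factors of the difference of consecutive smooth approximations. -/
noncomputable def pairBump (i : ℤ) (x : ℝ) : ℝ := unitBump x * unitBump ((x + i) / 2)

/-- The sum of the smooth bumps attached to a finite set of dyadic squares. -/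
noncomputable def cubeSum (G : Finset (ℤ × ℤ)) (j : ℕ) (ξ : ℝ × ℝ) : ℝ :=
  ∑ k ∈ G, unitBump (2 ^ j * ξ.1 - k.1) * unitBump (2 ^ j * ξ.2 - k.2)

/-- The dyadic squares of `H`, paired with offsets leading to a parent not in `G`. -/
def newCubes (G H : Finset (ℤ × ℤ)) : Finset ((ℤ × ℤ) × (ℤ × ℤ)) :=
  (H ×ˢ (offsets ×ˢ offsets)).filter fun z => (2 ∣ z.1.1 - z.2.1 ∧ 2 ∣ z.1.2 - z.2.2) ∧
    ((z.1.1 - z.2.1) / 2, (z.1.2 - z.2.2) / 2) ∉ G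

lemma cubeSum_succ {G H : Finset (ℤ × ℤ)} (hGH : ∀ k ∈ G, ∀ i₁ ∈ offsets, ∀ i₂ ∈ offsets,
    (2 * k.1 + i₁, 2 * k.2 + i₂) ∈ H) (j : ℕ) (ξ : ℝ × ℝ) :
    cubeSum H (j + 1) ξ = cubeSum G j ξ + ∑ z ∈ newCubes G H,
      pairBump z.2.1 (2 ^ (j + 1) * ξ.1 - z.1.1) * pairBump z.2.2 (2 ^ (j + 1) * ξ.2 - z.1.2) := by
  set Φ : (ℤ × ℤ) × (ℤ × ℤ) → ℝ := fun z =>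
    pairBump z.2.1 (2 ^ (j + 1) * ξ.1 - z.1.1) * pairBump z.2.2 (2 ^ (j + 1) * ξ.2 - z.1.2) with hΦ
  set T := (H ×ˢ (offsets ×ˢ offsets)).filter fun z : (ℤ × ℤ) × (ℤ × ℤ) =>
    2 ∣ z.1.1 - z.2.1 ∧ 2 ∣ z.1.2 - z.2.2 with hT
  have e1 : cubeSum H (j + 1) ξ = ∑ z ∈ T, Φ z := by
    rw [hT, Finset.sum_filter, Finset.sum_product]
    refine Finset.sum_congr rfl fun k _ => ?_
    set x₁ : ℝ := 2 ^ (j + 1) * ξ.1 - k.1 with hx₁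
    set x₂ : ℝ := 2 ^ (j + 1) * ξ.2 - k.2 with hx₂
    have e : ∀ i : ℤ × ℤ, (if 2 ∣ k.1 - i.1 ∧ 2 ∣ k.2 - i.2 then Φ (k, i) else 0) =
        (unitBump x₁ * unitBump x₂) * ((if 2 ∣ k.1 - i.1 then unitBump ((x₁ + i.1) / 2) else 0) *
          (if 2 ∣ k.2 - i.2 then unitBump ((x₂ + i.2) / 2) else 0)) := by
      intro i
      by_cases c1 : 2 ∣ k.1 - i.1 <;> by_cases c2 : 2 ∣ k.2 - i.2 <;>
        simp only [c1, c2, true_and, and_true, and_false, false_and, if_true, if_false, mul_zero,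
          zero_mul]
      simp only [hΦ, pairBump]
      ring
    simp only [e]
    rw [← Finset.mul_sum, Finset.sum_product]
    dsimp only
    rw [← Finset.sum_mul_sum offsets offsets
      (fun i => if 2 ∣ k.1 - i then unitBump ((x₁ + i) / 2) else 0)
      (fun i => if 2 ∣ k.2 - i then unitBump ((x₂ + i) / 2) else 0)]
    by_cases c1 : |x₁| ≤ 1
    · by_cases c2 : |x₂| ≤ 1
      · rw [sum_unitBump_half c1, sum_unitBump_half c2]; ring
      · rw [unitBump_eq_zero (not_le.mp c2).le]; ring
    · rw [unitBump_eq_zero (not_le.mp c1).le]; ring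
  have e2 : ∑ z ∈ T.filter (fun z => ((z.1.1 - z.2.1) / 2, (z.1.2 - z.2.2) / 2) ∈ G), Φ z =
      cubeSum G j ξ := by
    have e3 : cubeSum G j ξ = ∑ z ∈ G ×ˢ (offsets ×ˢ offsets),
        Φ ((2 * z.1.1 + z.2.1, 2 * z.1.2 + z.2.2), z.2) := by
      rw [Finset.sum_product]
      refine Finset.sum_congr rfl fun k _ => ?_
      set y₁ : ℝ := 2 ^ j * ξ.1 - k.1 with hy₁
      set y₂ : ℝ := 2 ^ j * ξ.2 - k.2 with hy₂
      have e : ∀ i : ℤ × ℤ, Φ ((2 * k.1 + i.1, 2 * k.2 + i.2), i) =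
          (unitBump y₁ * unitBump y₂) * (unitBump (2 * y₁ - i.1) * unitBump (2 * y₂ - i.2)) := by
        intro i
        have a1 : (2 : ℝ) ^ (j + 1) * ξ.1 - ((2 * k.1 + i.1 : ℤ) : ℝ) = 2 * y₁ - i.1 := by
          rw [hy₁]; push_cast; ring
        have a2 : (2 : ℝ) ^ (j + 1) * ξ.2 - ((2 * k.2 + i.2 : ℤ) : ℝ) = 2 * y₂ - i.2 := by
          rw [hy₂]; push_cast; ring
        simp only [hΦ, pairBump, a1, a2]
        rw [show (2 * y₁ - i.1 + i.1) / 2 = y₁ by ring, show (2 * y₂ - i.2 + i.2) / 2 = y₂ by ring]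
        ring
      simp only [e]
      rw [← Finset.mul_sum, Finset.sum_product]
      dsimp only
      rw [← Finset.sum_mul_sum]
      by_cases c1 : |y₁| ≤ 1
      · by_cases c2 : |y₂| ≤ 1
        · rw [sum_unitBump_two_mul_sub c1, sum_unitBump_two_mul_sub c2]; ring
        · rw [unitBump_eq_zero (not_le.mp c2).le]; ring
      · rw [unitBump_eq_zero (not_le.mp c1).le]; ring
    rw [e3]
    refine Finset.sum_nbij' (fun z => (((z.1.1 - z.2.1) / 2, (z.1.2 - z.2.2) / 2), z.2))
      (fun z => ((2 * z.1.1 + z.2.1, 2 * z.1.2 + z.2.2), z.2)) ?_ ?_ ?_ ?_ ?_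
    · intro z hz
      simp only [hT, Finset.mem_filter, Finset.mem_product] at hz ⊢
      exact ⟨hz.2, hz.1.1.2⟩
    · intro z hz
      simp only [hT, Finset.mem_filter, Finset.mem_product] at hz ⊢
      refine ⟨⟨⟨hGH _ hz.1 _ hz.2.1 _ hz.2.2, hz.2⟩, by omega, by omega⟩, ?_⟩
      have a1 : (2 * z.1.1 + z.2.1 - z.2.1) / 2 = z.1.1 := by omega
      have a2 : (2 * z.1.2 + z.2.2 - z.2.2) / 2 = z.1.2 := by omega
      rw [a1, a2]
      exact hz.1
    · rintro ⟨⟨a, b⟩, ⟨c, d⟩⟩ hz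
      simp only [hT, Finset.mem_filter] at hz
      simp only [Prod.mk.injEq, and_true]
      omega
    · rintro ⟨⟨a, b⟩, ⟨c, d⟩⟩ hz
      simp only [Prod.mk.injEq, and_true]
      omega
    · rintro ⟨⟨a, b⟩, ⟨c, d⟩⟩ hz
      simp only [hT, Finset.mem_filter] at hz
      have a1 : 2 * ((a - c) / 2) + c = a := by omega
      have a2 : 2 * ((b - d) / 2) + d = b := by omega
      simp only [a1, a2]
  rw [e1, ← e2, ← Finset.sum_filter_add_sum_filter_not T
    (fun z => ((z.1.1 - z.2.1) / 2, (z.1.2 - z.2.2) / 2) ∈ G), newCubes, hT, Finset.filter_filter,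
    Finset.filter_filter]

lemma cubeSum_eq_sum {G : ℕ → Finset (ℤ × ℤ)} (h0 : G 0 = ∅)
    (hG : ∀ j, ∀ k ∈ G j, ∀ i₁ ∈ offsets, ∀ i₂ ∈ offsets,
      (2 * k.1 + i₁, 2 * k.2 + i₂) ∈ G (j + 1)) (J : ℕ) (ξ : ℝ × ℝ) :
    cubeSum (G J) J ξ = ∑ j ∈ Finset.range J, ∑ z ∈ newCubes (G j) (G (j + 1)),
      pairBump z.2.1 (2 ^ (j + 1) * ξ.1 - z.1.1) * pairBump z.2.2 (2 ^ (j + 1) * ξ.2 - z.1.2) := by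
  induction J with
  | zero => simp [h0, cubeSum]
  | succ J ih => rw [cubeSum_succ (hG J), ih, Finset.sum_range_succ]

lemma exists_schwartz_ofReal {φ : ℝ → ℝ} (hφ : ContDiff ℝ (⊤ : ℕ∞) φ) {R : ℝ}
    (h0 : ∀ x, R < |x| → φ x = 0) : ∃ χ : 𝓢(ℝ, ℂ), ∀ x, χ x = (φ x : ℂ) := by
  have hc : HasCompactSupport fun x => (φ x : ℂ) := by
    refine HasCompactSupport.of_support_subset_isCompact (K := Icc (-R) R) isCompact_Icc
      fun x hx => ?_
    by_contra hn
    apply hx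
    simp only [h0 x (by by_contra h; exact hn (abs_le.mp (not_lt.mp h))), Complex.ofReal_zero]
  have hs : ContDiff ℝ (⊤ : ℕ∞) fun x => (φ x : ℂ) := Complex.ofRealCLM.contDiff.comp hφ
  exact ⟨hc.toSchwartzMap hs, fun _ => rfl⟩

lemma exists_schwartz_pairBump (i : ℤ) : ∃ χ : 𝓢(ℝ, ℂ), (∀ x, χ x = (pairBump i x : ℂ)) ∧
    ∀ x, 1 < |x| → χ x = 0 := by
  have h0 : ∀ x, 1 < |x| → pairBump i x = 0 := fun x hx => by
    rw [pairBump, unitBump_eq_zero hx.le, zero_mul]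
  have hs : ContDiff ℝ (⊤ : ℕ∞) (pairBump i) :=
    contDiff_unitBump.mul (contDiff_unitBump.comp (by fun_prop))
  obtain ⟨χ, hχ⟩ := exists_schwartz_ofReal hs h0
  exact ⟨χ, hχ, fun x hx => by rw [hχ, h0 x hx, Complex.ofReal_zero]⟩

lemma exists_schwartz_plateau : ∃ χ : 𝓢(ℝ, ℂ), (∀ x, |x| ≤ 2 → χ x = 1) ∧
    ∀ x, 3 < |x| → χ x = 0 := by
  have h0 : ∀ x : ℝ, 3 < |x| → smoothTransition (x + 3) * smoothTransition (3 - x) = 0 := by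
    intro x hx
    rcases lt_abs.mp hx with h | h
    · rw [smoothTransition.zero_of_nonpos (show 3 - x ≤ 0 by linarith), mul_zero]
    · rw [smoothTransition.zero_of_nonpos (show x + 3 ≤ 0 by linarith), zero_mul]
  have h := smoothTransition.contDiff (n := (⊤ : ℕ∞))
  have hs : ContDiff ℝ (⊤ : ℕ∞) fun x : ℝ => smoothTransition (x + 3) * smoothTransition (3 - x) :=
    (h.comp (by fun_prop)).mul (h.comp (by fun_prop))
  obtain ⟨χ, hχ⟩ := exists_schwartz_ofReal hs h0
  refine ⟨χ, fun x hx => ?_, fun x hx => by rw [hχ, h0 x hx, Complex.ofReal_zero]⟩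
  obtain ⟨h1, h2⟩ := abs_le.mp hx
  rw [hχ, smoothTransition.one_of_one_le (by linarith), smoothTransition.one_of_one_le (by linarith),
    one_mul, Complex.ofReal_one]

lemma cubeSum_nonneg (G : Finset (ℤ × ℤ)) (j : ℕ) (ξ : ℝ × ℝ) : 0 ≤ cubeSum G j ξ :=
  Finset.sum_nonneg fun _ _ => mul_nonneg (unitBump_nonneg _) (unitBump_nonneg _)

/-- The integers whose unit bumps do not vanish at `x`. -/
noncomputable def nearInts (x : ℝ) : Finset ℤ := {⌊x⌋, ⌊x⌋ + 1}

lemma mem_nearInts {x : ℝ} {k : ℤ} (h : unitBump (x - k) ≠ 0) : k ∈ nearInts x := by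
  have h1 : |x - k| < 1 := by
    by_contra hn; exact h (unitBump_eq_zero (not_lt.mp hn))
  obtain ⟨h2, h3⟩ := abs_lt.mp h1
  have h4 := Int.floor_le x
  have h5 := Int.lt_floor_add_one x
  have h6 : ((⌊x⌋ - 1 : ℤ) : ℝ) < k := by push_cast; linarith
  have h7 : (k : ℝ) < ((⌊x⌋ + 2 : ℤ) : ℝ) := by push_cast; linarith
  have h8 : ⌊x⌋ - 1 < k := by exact_mod_cast h6
  have h9 : k < ⌊x⌋ + 2 := by exact_mod_cast h7
  simp only [nearInts, Finset.mem_insert, Finset.mem_singleton]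
  omega

lemma abs_sub_le_of_mem_nearInts {x : ℝ} {k : ℤ} (h : k ∈ nearInts x) : |x - k| ≤ 1 := by
  have h4 := Int.floor_le x
  have h5 := Int.lt_floor_add_one x
  simp only [nearInts, Finset.mem_insert, Finset.mem_singleton] at h
  rcases h with rfl | rfl
  · rw [abs_le]; constructor <;> linarith
  · push_cast; rw [abs_le]; constructor <;> linarith

lemma sum_nearInts (x : ℝ) : ∑ k ∈ nearInts x, unitBump (x - k) = 1 := by
  have h4 := Int.floor_le x
  have h5 := Int.lt_floor_add_one x
  rw [nearInts, Finset.sum_pair (by simp)]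
  simp only [unitBump]
  push_cast
  rw [show x - (⌊x⌋ + 1) + 1 = x - ⌊x⌋ by ring,
    smoothTransition.one_of_one_le (show 1 ≤ x - ⌊x⌋ + 1 by linarith),
    smoothTransition.zero_of_nonpos (show x - (⌊x⌋ + 1) ≤ 0 by linarith)]
  ring

lemma sum_near_squares (j : ℕ) (ξ : ℝ × ℝ) :
    cubeSum (nearInts (2 ^ j * ξ.1) ×ˢ nearInts (2 ^ j * ξ.2)) j ξ = 1 := by
  rw [cubeSum, Finset.sum_product]
  dsimp only
  rw [← Finset.sum_mul_sum (nearInts (2 ^ j * ξ.1)) (nearInts (2 ^ j * ξ.2))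
    (fun k => unitBump (2 ^ j * ξ.1 - k)) (fun k => unitBump (2 ^ j * ξ.2 - k)), sum_nearInts,
    sum_nearInts, one_mul]

lemma mem_near_squares {j : ℕ} {ξ : ℝ × ℝ} {k : ℤ × ℤ}
    (h : unitBump (2 ^ j * ξ.1 - k.1) * unitBump (2 ^ j * ξ.2 - k.2) ≠ 0) :
    k ∈ nearInts (2 ^ j * ξ.1) ×ˢ nearInts (2 ^ j * ξ.2) :=
  Finset.mem_product.mpr ⟨mem_nearInts (left_ne_zero_of_mul h), mem_nearInts (right_ne_zero_of_mul h)⟩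

lemma cubeSum_eq_one {G : Finset (ℤ × ℤ)} {j : ℕ} {ξ : ℝ × ℝ}
    (h : nearInts (2 ^ j * ξ.1) ×ˢ nearInts (2 ^ j * ξ.2) ⊆ G) : cubeSum G j ξ = 1 := by
  rw [← sum_near_squares j ξ]
  refine (Finset.sum_subset h fun k _ hk => ?_).symm
  by_contra hn
  exact hk (mem_near_squares hn)

lemma cubeSum_le_one (G : Finset (ℤ × ℤ)) (j : ℕ) (ξ : ℝ × ℝ) : cubeSum G j ξ ≤ 1 := by
  classical
  have h := cubeSum_eq_one (G := G ∪ nearInts (2 ^ j * ξ.1) ×ˢ nearInts (2 ^ j * ξ.2))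
    Finset.subset_union_right
  rw [← h]
  exact Finset.sum_le_sum_of_subset_of_nonneg Finset.subset_union_left
    fun _ _ _ => mul_nonneg (unitBump_nonneg _) (unitBump_nonneg _)

lemma continuous_cubeSum (G : Finset (ℤ × ℤ)) (j : ℕ) : Continuous (cubeSum G j) := by
  have h := contDiff_unitBump.continuous
  unfold cubeSum
  fun_prop

/-- The parallelogram bounded by two pairs of parallel lines with slopes `t₁` and `t₂`. -/
def strips (t₁ t₂ a b c d : ℝ) : Set (ℝ × ℝ) :=
  {ξ : ℝ × ℝ | a ≤ ξ.2 - t₁ * ξ.1 ∧ ξ.2 - t₁ * ξ.1 ≤ b ∧ c ≤ ξ.2 - t₂ * ξ.1 ∧ ξ.2 - t₂ * ξ.1 ≤ d}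

/-- The dyadic squares well inside the parallelogram `strips t₁ t₂ a b c d`. -/
def GoodSquare (K t₁ t₂ a b c d : ℝ) (j : ℕ) (k : ℤ × ℤ) : Prop :=
  (2 ^ j * a + K ≤ k.2 - t₁ * k.1 ∧ k.2 - t₁ * k.1 ≤ 2 ^ j * b - K) ∧
    2 ^ j * c + K ≤ k.2 - t₂ * k.1 ∧ k.2 - t₂ * k.1 ≤ 2 ^ j * d - K

lemma finite_goodSquare {t₁ t₂ : ℝ} (h : t₁ ≠ t₂) (K a b c d : ℝ) (j : ℕ) :
    {k | GoodSquare K t₁ t₂ a b c d j k}.Finite := by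
  have hpos : 0 < |t₂ - t₁| := abs_pos.mpr (sub_ne_zero.mpr h.symm)
  set R : ℝ := max |2 ^ j * a + K| |2 ^ j * b - K| + max |2 ^ j * c + K| |2 ^ j * d - K| with hR
  have hfin : ∀ Q : ℝ, {m : ℤ | |(m : ℝ)| ≤ Q}.Finite := by
    intro Q
    refine (Finset.Icc (-⌈Q⌉) ⌈Q⌉).finite_toSet.subset fun m hm => ?_
    obtain ⟨h1, h2⟩ := abs_le.mp (show |(m : ℝ)| ≤ Q from hm)
    have h3 := Int.le_ceil Q
    rw [Finset.mem_coe, Finset.mem_Icc]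
    constructor
    · have : ((-⌈Q⌉ : ℤ) : ℝ) ≤ m := by push_cast; linarith
      exact_mod_cast this
    · exact_mod_cast h2.trans h3
  refine ((hfin (R / |t₂ - t₁|)).prod (hfin (R + |t₁| * (R / |t₂ - t₁|)))).subset fun k hk => ?_
  obtain ⟨⟨h1, h2⟩, h3, h4⟩ := hk
  have b1 : |(k.2 : ℝ) - t₁ * k.1| ≤ max |2 ^ j * a + K| |2 ^ j * b - K| := abs_le_max_abs_abs h1 h2
  have b2 : |(k.2 : ℝ) - t₂ * k.1| ≤ max |2 ^ j * c + K| |2 ^ j * d - K| := abs_le_max_abs_abs h3 h4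
  have e1 : |(k.1 : ℝ)| ≤ R / |t₂ - t₁| := by
    rw [le_div_iff₀ hpos, ← abs_mul]
    have : (k.1 : ℝ) * (t₂ - t₁) = (k.2 - t₁ * k.1) - (k.2 - t₂ * k.1) := by ring
    rw [this]
    exact (abs_sub _ _).trans (add_le_add b1 b2)
  refine ⟨e1, ?_⟩
  show |(k.2 : ℝ)| ≤ _
  have : (k.2 : ℝ) = (k.2 - t₁ * k.1) + t₁ * k.1 := by ring
  rw [this]
  refine (abs_add_le _ _).trans (add_le_add (b1.trans ?_) ?_)
  · rw [hR]
    exact le_add_of_nonneg_right (le_max_of_le_left (abs_nonneg _))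
  · rw [abs_mul]
    exact mul_le_mul_of_nonneg_left e1 (abs_nonneg _)

/-- The finite set of dyadic squares of side `2⁻ʲ` well inside a parallelogram. -/
noncomputable def goodSquares {t₁ t₂ : ℝ} (h : t₁ ≠ t₂) (K a b c d : ℝ) (j : ℕ) :
    Finset (ℤ × ℤ) := (finite_goodSquare h K a b c d j).toFinset

lemma mem_goodSquares {t₁ t₂ : ℝ} {h : t₁ ≠ t₂} {K a b c d : ℝ} {j : ℕ} {k : ℤ × ℤ} :
    k ∈ goodSquares h K a b c d j ↔ GoodSquare K t₁ t₂ a b c d j k := by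
  simp [goodSquares]

lemma abs_le_two_of_mem_offsets {i : ℤ} (h : i ∈ offsets) : |(i : ℝ)| ≤ 2 := by
  simp only [offsets, Finset.mem_insert, Finset.mem_singleton] at h
  rcases h with rfl | rfl | rfl | rfl | rfl <;> norm_num

lemma abs_offset_sub_le {i₁ i₂ : ℤ} (h₁ : i₁ ∈ offsets) (h₂ : i₂ ∈ offsets) {t K : ℝ}
    (hK : 2 + 2 * |t| ≤ K) : |(i₂ : ℝ) - t * i₁| ≤ K := by
  refine (abs_sub _ _).trans (le_trans ?_ hK)
  rw [abs_mul]
  have := mul_le_mul_of_nonneg_left (abs_le_two_of_mem_offsets h₁) (abs_nonneg t)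
  have := abs_le_two_of_mem_offsets h₂
  linarith

section GoodSquares

variable {t₁ t₂ : ℝ} {h : t₁ ≠ t₂} {K a b c d : ℝ}

lemma goodSquares_succ (h₁ : 2 + 2 * |t₁| ≤ K) (h₂ : 2 + 2 * |t₂| ≤ K) (j : ℕ) :
    ∀ k ∈ goodSquares h K a b c d j, ∀ i₁ ∈ offsets, ∀ i₂ ∈ offsets,
      (2 * k.1 + i₁, 2 * k.2 + i₂) ∈ goodSquares h K a b c d (j + 1) := by
  intro k hk i₁ hi₁ i₂ hi₂
  rw [mem_goodSquares] at hk ⊢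
  obtain ⟨⟨g1, g2⟩, g3, g4⟩ := hk
  obtain ⟨a1, a2⟩ := abs_le.mp (abs_offset_sub_le hi₁ hi₂ h₁)
  obtain ⟨b1, b2⟩ := abs_le.mp (abs_offset_sub_le hi₁ hi₂ h₂)
  refine ⟨⟨?_, ?_⟩, ?_, ?_⟩ <;> dsimp only <;> rw [pow_succ] <;> push_cast <;> nlinarith

lemma goodSquares_zero (hab : b - a < 2 * K ∨ d - c < 2 * K) : goodSquares h K a b c d 0 = ∅ := by
  refine Finset.eq_empty_of_forall_notMem fun k hk => ?_
  rw [mem_goodSquares] at hk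
  obtain ⟨⟨g1, g2⟩, g3, g4⟩ := hk
  rw [pow_zero] at *
  rcases hab with h | h <;> linarith

lemma edge_of_mem_newCubes (h₁ : 2 + 2 * |t₁| ≤ K) (h₂ : 2 + 2 * |t₂| ≤ K) {j : ℕ}
    {z : (ℤ × ℤ) × (ℤ × ℤ)}
    (hz : z ∈ newCubes (goodSquares h K a b c d j) (goodSquares h K a b c d (j + 1))) :
    ((K ≤ |z.1.2 - t₁ * z.1.1 - 2 ^ (j + 1) * a| ∧ |z.1.2 - t₁ * z.1.1 - 2 ^ (j + 1) * a| ≤ 3 * K) ∨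
    (K ≤ |z.1.2 - t₁ * z.1.1 - 2 ^ (j + 1) * b| ∧
      |z.1.2 - t₁ * z.1.1 - 2 ^ (j + 1) * b| ≤ 3 * K)) ∨
    (K ≤ |z.1.2 - t₂ * z.1.1 - 2 ^ (j + 1) * c| ∧ |z.1.2 - t₂ * z.1.1 - 2 ^ (j + 1) * c| ≤ 3 * K) ∨
    (K ≤ |z.1.2 - t₂ * z.1.1 - 2 ^ (j + 1) * d| ∧
      |z.1.2 - t₂ * z.1.1 - 2 ^ (j + 1) * d| ≤ 3 * K) := by
  simp only [newCubes, Finset.mem_filter, Finset.mem_product, mem_goodSquares] at hz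
  obtain ⟨⟨⟨⟨g1, g2⟩, g3, g4⟩, hi₁, hi₂⟩, ⟨⟨u, hu⟩, v, hv⟩, hn⟩ := hz
  have e1 : (z.1.1 - z.2.1) / 2 = u := by omega
  have e2 : (z.1.2 - z.2.2) / 2 = v := by omega
  rw [e1, e2] at hn
  have f1 : (z.1.1 : ℝ) = 2 * u + z.2.1 := by
    have : z.1.1 = 2 * u + z.2.1 := by omega
    exact_mod_cast this
  have f2 : (z.1.2 : ℝ) = 2 * v + z.2.2 := by
    have : z.1.2 = 2 * v + z.2.2 := by omega
    exact_mod_cast this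
  obtain ⟨a1, a2⟩ := abs_le.mp (abs_offset_sub_le hi₁ hi₂ h₁)
  obtain ⟨b1, b2⟩ := abs_le.mp (abs_offset_sub_le hi₁ hi₂ h₂)
  have hK : 0 ≤ K := le_trans (by positivity) h₁
  simp only [GoodSquare, not_and_or, not_le] at hn
  rw [pow_succ] at *
  rcases hn with (hn | hn) | hn | hn
  · left; left
    rw [abs_of_nonneg (by linarith)]
    constructor
    · linarith
    · rw [f1, f2] at *; linarith
  · left; right
    rw [abs_of_nonpos (by linarith)]
    constructor
    · linarith
    · rw [f1, f2] at *; linarith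
  · right; left
    rw [abs_of_nonneg (by linarith)]
    constructor
    · linarith
    · rw [f1, f2] at *; linarith
  · right; right
    rw [abs_of_nonpos (by linarith)]
    constructor
    · linarith
    · rw [f1, f2] at *; linarith

lemma abs_slope_sub_le {t K x₁ x₂ y₁ y₂ : ℝ} (hK : 2 + 2 * |t| ≤ K) (h1 : |x₁ - y₁| ≤ 1)
    (h2 : |x₂ - y₂| ≤ 1) : |(x₂ - t * x₁) - (y₂ - t * y₁)| ≤ K := by
  have e : (x₂ - t * x₁) - (y₂ - t * y₁) = (x₂ - y₂) - t * (x₁ - y₁) := by ring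
  rw [e]
  refine (abs_sub _ _).trans (le_trans ?_ hK)
  rw [abs_mul]
  have := mul_le_mul_of_nonneg_left h1 (abs_nonneg t)
  have := abs_nonneg t
  linarith

lemma cubeSum_goodSquares_eq_zero (h₁ : 2 + 2 * |t₁| ≤ K) (h₂ : 2 + 2 * |t₂| ≤ K) (j : ℕ)
    {ξ : ℝ × ℝ} (hξ : ξ ∉ strips t₁ t₂ a b c d) :
    cubeSum (goodSquares h K a b c d j) j ξ = 0 := by
  refine Finset.sum_eq_zero fun k hk => ?_
  by_contra hn
  have hm := Finset.mem_product.mp (mem_near_squares hn)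
  have n1 := abs_sub_le_of_mem_nearInts hm.1
  have n2 := abs_sub_le_of_mem_nearInts hm.2
  obtain ⟨a1, a2⟩ := abs_le.mp (abs_slope_sub_le h₁ n1 n2)
  obtain ⟨b1, b2⟩ := abs_le.mp (abs_slope_sub_le h₂ n1 n2)
  obtain ⟨⟨g1, g2⟩, g3, g4⟩ := mem_goodSquares.mp hk
  have hp : (0 : ℝ) < 2 ^ j := by positivity
  refine hξ ⟨?_, ?_, ?_, ?_⟩ <;> refine le_of_mul_le_mul_left ?_ hp <;> linarith

lemma eventually_cubeSum_goodSquares_eq_one (h₁ : 2 + 2 * |t₁| ≤ K) (h₂ : 2 + 2 * |t₂| ≤ K)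
    {ξ : ℝ × ℝ} (g1 : a < ξ.2 - t₁ * ξ.1) (g2 : ξ.2 - t₁ * ξ.1 < b) (g3 : c < ξ.2 - t₂ * ξ.1)
    (g4 : ξ.2 - t₂ * ξ.1 < d) :
    ∀ᶠ j : ℕ in Filter.atTop, cubeSum (goodSquares h K a b c d j) j ξ = 1 := by
  have hlim : Filter.Tendsto (fun j : ℕ => (2 : ℝ) ^ j) Filter.atTop Filter.atTop :=
    tendsto_pow_atTop_atTop_of_one_lt one_lt_two
  have key : ∀ w : ℝ, 0 < w → ∀ᶠ j : ℕ in Filter.atTop, 2 * K ≤ 2 ^ j * w := by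
    intro w hw
    filter_upwards [hlim.eventually_ge_atTop (2 * K / w)] with j hj
    rwa [div_le_iff₀ hw] at hj
  filter_upwards [key _ (sub_pos.mpr g1), key _ (sub_pos.mpr g2), key _ (sub_pos.mpr g3),
    key _ (sub_pos.mpr g4)] with j k1 k2 k3 k4
  refine cubeSum_eq_one fun k hk => ?_
  have hm := Finset.mem_product.mp hk
  have n1 := abs_sub_le_of_mem_nearInts hm.1
  have n2 := abs_sub_le_of_mem_nearInts hm.2
  obtain ⟨a1, a2⟩ := abs_le.mp (abs_slope_sub_le h₁ n1 n2)
  obtain ⟨b1, b2⟩ := abs_le.mp (abs_slope_sub_le h₂ n1 n2)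
  rw [mem_goodSquares]
  refine ⟨⟨?_, ?_⟩, ?_, ?_⟩ <;> linarith

end GoodSquares

lemma ae_slope_ne (t e : ℝ) : ∀ᵐ ξ : ℝ × ℝ, ξ.2 - t * ξ.1 ≠ e := by
  have hm : MeasurableSet {ξ : ℝ × ℝ | ξ.2 - t * ξ.1 = e} :=
    (isClosed_eq (by fun_prop) continuous_const).measurableSet
  rw [ae_iff]
  simp only [not_not]
  rw [Measure.volume_eq_prod, Measure.measure_prod_null hm]
  refine .of_forall fun x => ?_
  have : Prod.mk x ⁻¹' {ξ : ℝ × ℝ | ξ.2 - t * ξ.1 = e} = {e + t * x} := by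
    ext y
    simp only [Set.mem_preimage, Set.mem_ofPred_eq, Set.mem_singleton_iff]
    constructor <;> intro h <;> linarith
  change volume (Prod.mk x ⁻¹' {ξ : ℝ × ℝ | ξ.2 - t * ξ.1 = e}) = 0
  rw [this]
  simp

/-- The smooth approximations of a parallelogram multiplier converge to it. -/
lemma tendsto_diagInv_cubeSum {t₁ t₂ : ℝ} (h : t₁ ≠ t₂) {K a b c d : ℝ} (h₁ : 2 + 2 * |t₁| ≤ K)
    (h₂ : 2 + 2 * |t₂| ≤ K) {A : ℝ × ℝ → ℂ} (hA : Integrable A) (x : ℝ) :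
    Filter.Tendsto (fun J : ℕ =>
      diagInv (fun ξ => A ξ * (cubeSum (goodSquares h K a b c d J) J ξ : ℂ)) x) Filter.atTop
      (nhds (diagInv (fun ξ => A ξ * (strips t₁ t₂ a b c d).indicator 1 ξ) x)) := by
  refine tendsto_integral_of_dominated_convergence (fun ξ => ‖A ξ‖) (fun J => ?_) hA.norm
    (fun J => .of_forall fun ξ => ?_) ?_
  · have h1 := (Complex.continuous_ofReal.comp
      (continuous_cubeSum (goodSquares h K a b c d J) J)).aestronglyMeasurable (μ := volume)
    exact (Continuous.aestronglyMeasurable (by fun_prop)).mul (hA.aestronglyMeasurable.mul h1)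
  · rw [norm_mul, Complex.norm_exp_ofReal_mul_I, one_mul, norm_mul, Complex.norm_real, norm_eq_abs,
      abs_of_nonneg (cubeSum_nonneg _ _ _)]
    exact mul_le_of_le_one_right (norm_nonneg _) (cubeSum_le_one _ _ _)
  · filter_upwards [ae_slope_ne t₁ a, ae_slope_ne t₁ b, ae_slope_ne t₂ c, ae_slope_ne t₂ d] with ξ
      n1 n2 n3 n4
    by_cases hξ : ξ ∈ strips t₁ t₂ a b c d
    · have hξ' := hξ
      obtain ⟨g1, g2, g3, g4⟩ := hξ'
      refine tendsto_const_nhds.congr' ?_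
      filter_upwards [eventually_cubeSum_goodSquares_eq_one (h := h) h₁ h₂
        (lt_of_le_of_ne g1 n1.symm) (lt_of_le_of_ne g2 n2) (lt_of_le_of_ne g3 n3.symm)
        (lt_of_le_of_ne g4 n4)] with J hJ
      rw [hJ, indicator_of_mem hξ]
      simp
    · refine tendsto_const_nhds.congr fun J => ?_
      rw [cubeSum_goodSquares_eq_zero h₁ h₂ J hξ, indicator_of_notMem hξ]
      simp

lemma integrable_coef_mul_coef_mul {χ₁ χ₂ : 𝓢(ℝ, ℂ)} {ρ : ℝ} (h₁ : ∀ η, ρ < |η| → χ₁ η = 0)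
    (h₂ : ∀ η, ρ < |η| → χ₂ η = 0) (f g : 𝓢(ℝ, ℂ)) {h : ℝ → ℂ} (hh : Integrable h) (j : ℕ)
    (k l : ℤ) : Integrable fun x => coef χ₁ f j k x * coef χ₂ g j l x * h x := by
  have hA := (integrable_fourier_mul_cutoff h₁ f j k).mul_prod
    (integrable_fourier_mul_cutoff h₂ g j l)
  simp only [coef_mul_coef_eq_diagInv h₁ h₂]
  exact hh.bdd_mul (continuous_diagInv hA).aestronglyMeasurable
    (.of_forall fun x => norm_diagInv_le _ x)

lemma diagInv_cubeSum_eq_sum {χ : ℤ → 𝓢(ℝ, ℂ)} (hχ : ∀ i x, χ i x = (pairBump i x : ℂ))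
    (hχ' : ∀ i x, 1 < |x| → χ i x = 0) {G : ℕ → Finset (ℤ × ℤ)} (h0 : G 0 = ∅)
    (hG : ∀ j, ∀ k ∈ G j, ∀ i₁ ∈ offsets, ∀ i₂ ∈ offsets,
      (2 * k.1 + i₁, 2 * k.2 + i₂) ∈ G (j + 1)) (J : ℕ) (f g : 𝓢(ℝ, ℂ)) (x : ℝ) :
    diagInv (fun ξ => 𝓕 (f : ℝ → ℂ) ξ.1 * 𝓕 (g : ℝ → ℂ) ξ.2 * (cubeSum (G J) J ξ : ℂ)) x =
      ∑ j ∈ Finset.range J, ∑ z ∈ newCubes (G j) (G (j + 1)),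
        coef (χ z.2.1) f (j + 1) z.1.1 x * coef (χ z.2.2) g (j + 1) z.1.2 x := by
  have hA : ∀ (j : ℕ) (z : (ℤ × ℤ) × (ℤ × ℤ)), Integrable fun ξ : ℝ × ℝ =>
      (𝓕 (f : ℝ → ℂ) ξ.1 * χ z.2.1 (2 ^ (j + 1) * ξ.1 - z.1.1)) *
        (𝓕 (g : ℝ → ℂ) ξ.2 * χ z.2.2 (2 ^ (j + 1) * ξ.2 - z.1.2)) := fun j z =>
    (integrable_fourier_mul_cutoff (hχ' _) f (j + 1) z.1.1).mul_prod
      (integrable_fourier_mul_cutoff (hχ' _) g (j + 1) z.1.2)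
  simp only [coef_mul_coef_eq_diagInv (hχ' _) (hχ' _)]
  simp only [← diagInv_sum _ fun z _ => hA _ z]
  rw [← diagInv_sum _ fun j _ => integrable_finsetSum _ fun z _ => hA j z]
  congr 1
  funext ξ
  rw [cubeSum_eq_sum h0 hG]
  push_cast
  simp only [Finset.mul_sum]
  refine Finset.sum_congr rfl fun j _ => Finset.sum_congr rfl fun z _ => ?_
  rw [hχ, hχ]
  ring

lemma enorm_integral_diagInv_cubeSum_le {χ : ℤ → 𝓢(ℝ, ℂ)}
    (hχ : ∀ i x, χ i x = (pairBump i x : ℂ)) (hχ' : ∀ i x, 1 < |x| → χ i x = 0) {χ₃ : 𝓢(ℝ, ℂ)}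
    (h₃ : ∀ η, 3 < |η| → χ₃ η = 0) (h₃' : ∀ η, |η| ≤ 2 → χ₃ η = 1)
    {G : ℕ → Finset (ℤ × ℤ)} (h0 : G 0 = ∅)
    (hG : ∀ j, ∀ k ∈ G j, ∀ i₁ ∈ offsets, ∀ i₂ ∈ offsets,
      (2 * k.1 + i₁, 2 * k.2 + i₂) ∈ G (j + 1)) (J : ℕ) (f g : 𝓢(ℝ, ℂ)) {h : ℝ → ℂ}
    (hh : Integrable h) :
    ‖∫ x, diagInv (fun ξ => 𝓕 (f : ℝ → ℂ) ξ.1 * 𝓕 (g : ℝ → ℂ) ξ.2 *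
        (cubeSum (G J) J ξ : ℂ)) x * h x‖ₑ ≤
      ∑ j ∈ Finset.range J, ∑ z ∈ newCubes (G j) (G (j + 1)),
        ∫⁻ x, ENNReal.ofReal (‖coef (χ z.2.1) f (j + 1) z.1.1 x‖ *
          ‖coef (χ z.2.2) g (j + 1) z.1.2 x‖ *
          ‖coef χ₃ h (j + 1) (-(z.1.1 + z.1.2)) x‖) := by
  simp only [diagInv_cubeSum_eq_sum hχ hχ' h0 hG, Finset.sum_mul]
  have hi : ∀ (j : ℕ) (z : (ℤ × ℤ) × (ℤ × ℤ)), Integrable fun x =>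
      coef (χ z.2.1) f (j + 1) z.1.1 x * coef (χ z.2.2) g (j + 1) z.1.2 x * h x := fun j z =>
    integrable_coef_mul_coef_mul (hχ' _) (hχ' _) f g hh _ _ _
  rw [integral_finsetSum _ fun j _ => integrable_finsetSum _ fun z _ => hi j z]
  refine (enorm_sum_le _ _).trans (Finset.sum_le_sum fun j _ => ?_)
  rw [integral_finsetSum _ fun z _ => hi j z]
  refine (enorm_sum_le _ _).trans (Finset.sum_le_sum fun z _ => ?_)
  rw [integral_coef_mul_coef_mul (hχ' _) (hχ' _) h₃ h₃' f g hh]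
  refine (enorm_integral_le_lintegral_enorm _).trans (le_of_eq ?_)
  simp only [← ofReal_norm, norm_mul]

lemma sum_le_sum_filter_add_sum_filter {ι : Type*} (S : Finset ι) (V : ι → ℝ≥0∞) (P Q : ι → Prop)
    [DecidablePred P] [DecidablePred Q] (h : ∀ s ∈ S, P s ∨ Q s) :
    ∑ s ∈ S, V s ≤ ∑ s ∈ S with P s, V s + ∑ s ∈ S with Q s, V s := by
  rw [Finset.sum_filter, Finset.sum_filter, ← Finset.sum_add_distrib]
  refine Finset.sum_le_sum fun s hs => ?_
  rcases h s hs with h | h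
  · rw [if_pos h]; exact le_self_add
  · rw [if_pos h]; exact le_add_self

/-- The lattice point `s.2` at scale `2 ^ s.1` is at distance about `K` from the line of slope `t`
and intercept `2 ^ s.1 * e`. -/
def NearLine (K t e : ℝ) (s : ℕ × ℤ × ℤ) : Prop :=
  K ≤ |s.2.2 - t * s.2.1 - 2 ^ s.1 * e| ∧ |s.2.2 - t * s.2.1 - 2 ^ s.1 * e| ≤ 3 * K

open scoped Classical in
lemma exists_lintegral_four_edges_bound {ρ : ℝ} (hρ : 0 ≤ ρ) {t₁ t₂ : ℝ} (ht₁ : t₁ ≠ 0)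
    (ht₁' : 1 + t₁ ≠ 0) (ht₂ : t₂ ≠ 0) (ht₂' : 1 + t₂ ≠ 0) :
    ∃ K₀ : ℝ, 0 < K₀ ∧ ∀ K : ℝ, K₀ ≤ K → ∀ {χ : Fin 3 → 𝓢(ℝ, ℂ)},
      (∀ i η, ρ < |η| → χ i η = 0) → ∀ {p : Fin 3 → ℝ}, (∀ i, 2 < p i) →
      1 / p 0 + 1 / p 1 + 1 / p 2 = 1 →
    ∃ M : ℝ, 0 ≤ M ∧ ∀ {Ω : Type} [Fintype Ω] (L₁ L₂ a b c d : ℝ) (n m : Ω → ℤ), K ≤ L₁ → K ≤ L₂ →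
      ∀ S : Finset (Ω × ℕ × ℤ × ℤ),
      (∀ s ∈ S, ∀ s' ∈ S, s.2 = s'.2 → s.1 = s'.1) →
      (∀ s ∈ S, (NearLine K t₁ (a + n s.1 * L₁) s.2 ∨ NearLine K t₁ (b + n s.1 * L₁) s.2) ∨
        NearLine K t₂ (c + m s.1 * L₂) s.2 ∨ NearLine K t₂ (d + m s.1 * L₂) s.2) →
      ∀ (f g : ℝ → ℂ) (h : Ω → ℝ → ℂ), MemLp f 2 → MemLp g 2 → (∀ ω, MemLp (h ω) 2) →
      Measurable f → Measurable g → (∀ ω, Measurable (h ω)) →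
      (Integrable fun y => (‖f y‖ ^ 2) ^ (p 0 / 2)) →
      (Integrable fun y => (‖g y‖ ^ 2) ^ (p 1 / 2)) →
      (Integrable fun y => (∑ ω, ‖h ω y‖ ^ 2) ^ (p 2 / 2)) →
      ∑ s ∈ S, ∫⁻ x, ENNReal.ofReal (‖coef (χ 0) f s.2.1 s.2.2.1 x‖ *
          ‖coef (χ 1) g s.2.1 s.2.2.2 x‖ *
          ‖coef (χ 2) (h s.1) s.2.1 (-(s.2.2.1 + s.2.2.2)) x‖) ≤
        ENNReal.ofReal (M * ((∫ y, (‖f y‖ ^ 2) ^ (p 0 / 2)) ^ (1 / p 0) *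
          (∫ y, (‖g y‖ ^ 2) ^ (p 1 / 2)) ^ (1 / p 1) *
          (∫ y, (∑ ω, ‖h ω y‖ ^ 2) ^ (p 2 / 2)) ^ (1 / p 2))) := by
  obtain ⟨K₁, hK₁, H₁⟩ := exists_lintegral_edge_bound hρ ht₁ ht₁'
  obtain ⟨K₂, -, H₂⟩ := exists_lintegral_edge_bound hρ ht₂ ht₂'
  refine ⟨max K₁ K₂, lt_max_of_lt_left hK₁, fun K hK χ hχ p hp hp1 => ?_⟩
  obtain ⟨M₁, hM₁0, hM₁⟩ := H₁ K ((le_max_left _ _).trans hK) hχ hp hp1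
  obtain ⟨M₂, hM₂0, hM₂⟩ := H₂ K ((le_max_right _ _).trans hK) hχ hp hp1
  refine ⟨(M₁ + M₁) + (M₂ + M₂), by positivity, ?_⟩
  intro Ω _ L₁ L₂ a b c d n m hL₁ hL₂ S hS1 hS2 f g h hf hg hh hfm hgm hhm hfi hgi hhi
  set X : ℝ := (∫ y, (‖f y‖ ^ 2) ^ (p 0 / 2)) ^ (1 / p 0) *
    (∫ y, (‖g y‖ ^ 2) ^ (p 1 / 2)) ^ (1 / p 1) *
    (∫ y, (∑ ω, ‖h ω y‖ ^ 2) ^ (p 2 / 2)) ^ (1 / p 2) with hX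
  have hX0 : 0 ≤ X := by positivity
  set V : Ω × ℕ × ℤ × ℤ → ℝ≥0∞ := fun s => ∫⁻ x, ENNReal.ofReal
    (‖coef (χ 0) f s.2.1 s.2.2.1 x‖ * ‖coef (χ 1) g s.2.1 s.2.2.2 x‖ *
      ‖coef (χ 2) (h s.1) s.2.1 (-(s.2.2.1 + s.2.2.2)) x‖) with hV
  have B₁ : ∀ (e : ℝ) (T : Finset (Ω × ℕ × ℤ × ℤ)), T ⊆ S →
      (∀ s ∈ T, NearLine K t₁ (e + n s.1 * L₁) s.2) → ∑ s ∈ T, V s ≤ ENNReal.ofReal (M₁ * X) :=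
    fun e T hT hN => hM₁ L₁ e n hL₁ T (fun s hs s' hs' => hS1 s (hT hs) s' (hT hs')) hN f g h hf hg
      hh hfm hgm hhm hfi hgi hhi
  have B₂ : ∀ (e : ℝ) (T : Finset (Ω × ℕ × ℤ × ℤ)), T ⊆ S →
      (∀ s ∈ T, NearLine K t₂ (e + m s.1 * L₂) s.2) → ∑ s ∈ T, V s ≤ ENNReal.ofReal (M₂ * X) :=
    fun e T hT hN => hM₂ L₂ e m hL₂ T (fun s hs s' hs' => hS1 s (hT hs) s' (hT hs')) hN f g h hf hg
      hh hfm hgm hhm hfi hgi hhi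
  have hsub := sum_le_sum_filter_add_sum_filter S V _ _ hS2
  refine hsub.trans ?_
  rw [add_mul, add_mul, add_mul, ENNReal.ofReal_add (by positivity) (by positivity),
    ENNReal.ofReal_add (by positivity) (by positivity),
    ENNReal.ofReal_add (by positivity) (by positivity)]
  refine add_le_add ?_ ?_
  · refine (sum_le_sum_filter_add_sum_filter _ V
      (fun s => NearLine K t₁ (a + n s.1 * L₁) s.2) (fun s => NearLine K t₁ (b + n s.1 * L₁) s.2)
      fun s hs => (Finset.mem_filter.mp hs).2).trans (add_le_add ?_ ?_)
    · exact B₁ a _ ((Finset.filter_subset _ _).trans (Finset.filter_subset _ _))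
        fun s hs => (Finset.mem_filter.mp hs).2
    · exact B₁ b _ ((Finset.filter_subset _ _).trans (Finset.filter_subset _ _))
        fun s hs => (Finset.mem_filter.mp hs).2
  · refine (sum_le_sum_filter_add_sum_filter _ V
      (fun s => NearLine K t₂ (c + m s.1 * L₂) s.2) (fun s => NearLine K t₂ (d + m s.1 * L₂) s.2)
      fun s hs => (Finset.mem_filter.mp hs).2).trans (add_le_add ?_ ?_)
    · exact B₂ c _ ((Finset.filter_subset _ _).trans (Finset.filter_subset _ _))
        fun s hs => (Finset.mem_filter.mp hs).2
    · exact B₂ d _ ((Finset.filter_subset _ _).trans (Finset.filter_subset _ _))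
        fun s hs => (Finset.mem_filter.mp hs).2

lemma eq_of_mem_disjoint_strips {α : Type*} {K : ℝ} (hK : 0 < K) {a b : ℤ → ℝ}
    (hab : ∀ n m, n < m → b n ≤ a m) {j : ℕ} {y : ℝ} {n : α → ℤ} {u v : α}
    (hu : 2 ^ j * a (n u) + K ≤ y ∧ y ≤ 2 ^ j * b (n u) - K)
    (hv : 2 ^ j * a (n v) + K ≤ y ∧ y ≤ 2 ^ j * b (n v) - K) : n u = n v := by
  have h2 : (0 : ℝ) < 2 ^ j := by positivity
  rcases lt_trichotomy (n u) (n v) with h | h | h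
  · have := mul_le_mul_of_nonneg_left (hab _ _ h) h2.le
    linarith [hu.2, hv.1]
  · exact h
  · have := mul_le_mul_of_nonneg_left (hab _ _ h) h2.le
    linarith [hv.2, hu.1]

lemma sum_newCubes_eq {Ω : Type} [Fintype Ω] [DecidableEq Ω]
    (N : Ω → ℕ → Finset ((ℤ × ℤ) × (ℤ × ℤ))) (hN : ∀ ω j, ∀ z ∈ N ω j, z.2 ∈ offsets ×ˢ offsets)
    (J : ℕ) (V : ℤ × ℤ → Ω × ℕ × ℤ × ℤ → ℝ≥0∞) :
    ∑ ω, ∑ j ∈ Finset.range J, ∑ z ∈ N ω j, V z.2 (ω, j + 1, z.1) =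
      ∑ i ∈ offsets ×ˢ offsets, ∑ s ∈ ((Finset.univ ×ˢ Finset.range J).sigma fun w =>
        (N w.1 w.2).filter fun z => z.2 = i).image
          fun w : (_ : Ω × ℕ) × ((ℤ × ℤ) × (ℤ × ℤ)) => (w.1.1, w.1.2 + 1, w.2.1), V i s := by
  have e1 : ∀ i, ∑ s ∈ ((Finset.univ ×ˢ Finset.range J).sigma fun w =>
        (N w.1 w.2).filter fun z => z.2 = i).image
          (fun w : (_ : Ω × ℕ) × ((ℤ × ℤ) × (ℤ × ℤ)) => (w.1.1, w.1.2 + 1, w.2.1)), V i s =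
      ∑ ω, ∑ j ∈ Finset.range J, ∑ z ∈ N ω j with z.2 = i, V i (ω, j + 1, z.1) := by
    intro i
    rw [Finset.sum_image, Finset.sum_sigma, Finset.sum_product]
    rintro ⟨⟨ω, j⟩, z⟩ hz ⟨⟨ω', j'⟩, z'⟩ hz' he
    have hz2 := (Finset.mem_filter.mp (Finset.mem_sigma.mp hz).2).2
    have hz2' := (Finset.mem_filter.mp (Finset.mem_sigma.mp hz').2).2
    dsimp only at hz2 hz2' he
    simp only [Prod.mk.injEq, Nat.add_right_cancel_iff] at he
    obtain ⟨rfl, rfl, h⟩ := he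
    have : z = z' := Prod.ext h (hz2.trans hz2'.symm)
    rw [this]
  simp only [e1]
  refine Eq.trans (Finset.sum_congr rfl fun ω _ => ?_) Finset.sum_comm
  refine Eq.trans (Finset.sum_congr rfl fun j _ => ?_) Finset.sum_comm
  rw [← Finset.sum_fiberwise_of_maps_to (hN ω j) (fun z => V z.2 (ω, j + 1, z.1))]
  refine Finset.sum_congr rfl fun i _ => Finset.sum_congr rfl fun z hz => ?_
  rw [(Finset.mem_filter.mp hz).2]

open scoped Classical in
/-- The trilinear estimate for smooth approximations of a family of parallelograms. -/
theorem exists_trilinear_bound {t₁ t₂ : ℝ} (h₁₂ : t₁ ≠ t₂) (ht₁ : t₁ ≠ 0) (ht₁' : 1 + t₁ ≠ 0)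
    (ht₂ : t₂ ≠ 0) (ht₂' : 1 + t₂ ≠ 0) :
    ∃ K : ℝ, 0 < K ∧ 2 + 2 * |t₁| ≤ K ∧ 2 + 2 * |t₂| ≤ K ∧ ∀ {p : Fin 3 → ℝ}, (∀ i, 2 < p i) →
      1 / p 0 + 1 / p 1 + 1 / p 2 = 1 →
    ∃ M : ℝ, 0 ≤ M ∧ ∀ (a b c d : ℤ → ℝ) (L₁ L₂ : ℝ), K ≤ L₁ → K ≤ L₂ →
      (∀ n : ℤ, a n = a 0 + n * L₁) → (∀ n : ℤ, b n = b 0 + n * L₁) →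
      (∀ n : ℤ, c n = c 0 + n * L₂) → (∀ n : ℤ, d n = d 0 + n * L₂) →
      (∀ n m, n < m → b n ≤ a m) → (∀ n m, n < m → d n ≤ c m) →
      (b 0 - a 0 < 2 * K ∨ d 0 - c 0 < 2 * K) →
      ∀ (Ω : Finset (ℤ × ℤ)) (J : ℕ) (f g : 𝓢(ℝ, ℂ)) (h : Ω → ℝ → ℂ), (∀ ω, Integrable (h ω)) →
      (∀ ω, MemLp (h ω) 2) → (∀ ω, Measurable (h ω)) →
      (Integrable fun y => (‖f y‖ ^ 2) ^ (p 0 / 2)) →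
      (Integrable fun y => (‖g y‖ ^ 2) ^ (p 1 / 2)) →
      (Integrable fun y => (∑ ω, ‖h ω y‖ ^ 2) ^ (p 2 / 2)) →
      ‖∑ ω : Ω, ∫ x, diagInv (fun ξ => 𝓕 (f : ℝ → ℂ) ξ.1 * 𝓕 (g : ℝ → ℂ) ξ.2 *
          (cubeSum (goodSquares h₁₂ K (a ω.1.1) (b ω.1.1) (c ω.1.2) (d ω.1.2) J) J ξ : ℂ)) x *
          h ω x‖ₑ ≤
        ENNReal.ofReal (M * ((∫ y, (‖f y‖ ^ 2) ^ (p 0 / 2)) ^ (1 / p 0) *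
          (∫ y, (‖g y‖ ^ 2) ^ (p 1 / 2)) ^ (1 / p 1) *
          (∫ y, (∑ ω, ‖h ω y‖ ^ 2) ^ (p 2 / 2)) ^ (1 / p 2))) := by
  obtain ⟨K₀, hK₀, H⟩ := exists_lintegral_four_edges_bound (ρ := 3) (by norm_num) ht₁ ht₁' ht₂ ht₂'
  choose χ hχ hχ' using exists_schwartz_pairBump
  obtain ⟨χ₃, h₃', h₃⟩ := exists_schwartz_plateau
  set K : ℝ := max K₀ (max (2 + 2 * |t₁|) (2 + 2 * |t₂|)) with hK
  have hKpos : 0 < K := lt_max_of_lt_left hK₀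
  have hk₁ : 2 + 2 * |t₁| ≤ K := (le_max_left _ _).trans (le_max_right _ _)
  have hk₂ : 2 + 2 * |t₂| ≤ K := (le_max_right _ _).trans (le_max_right _ _)
  refine ⟨K, hKpos, hk₁, hk₂, fun {p} hp hp1 => ?_⟩
  have hsupp : ∀ (i : ℤ × ℤ) (l : Fin 3) (η : ℝ), 3 < |η| →
      (![χ i.1, χ i.2, χ₃] : Fin 3 → 𝓢(ℝ, ℂ)) l η = 0 := by
    intro i l η hη
    fin_cases l
    · exact hχ' _ _ (by linarith)
    · exact hχ' _ _ (by linarith)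
    · exact h₃ _ hη
  choose M hM0 hM using fun i : ℤ × ℤ => H K (le_max_left _ _) (hsupp i) hp hp1
  refine ⟨∑ i ∈ offsets ×ˢ offsets, M i, Finset.sum_nonneg fun i _ => hM0 i, ?_⟩
  intro a b c d L₁ L₂ hL₁ hL₂ ha hb hc hd hab hcd hsmall Ω J f g h hhi hh2 hhm hfp hgp hhp
  set X : ℝ := (∫ y, (‖f y‖ ^ 2) ^ (p 0 / 2)) ^ (1 / p 0) *
    (∫ y, (‖g y‖ ^ 2) ^ (p 1 / 2)) ^ (1 / p 1) *
    (∫ y, (∑ ω, ‖h ω y‖ ^ 2) ^ (p 2 / 2)) ^ (1 / p 2) with hX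
  have hX0 : 0 ≤ X := by positivity
  set G : Ω → ℕ → Finset (ℤ × ℤ) := fun ω j =>
    goodSquares h₁₂ K (a ω.1.1) (b ω.1.1) (c ω.1.2) (d ω.1.2) j with hG
  have hG0 : ∀ ω, G ω 0 = ∅ := by
    intro ω
    refine goodSquares_zero ?_
    rw [ha ω.1.1, hb ω.1.1, hc ω.1.2, hd ω.1.2]
    rcases hsmall with h | h
    · left; linarith
    · right; linarith
  have hterm : ∀ ω : Ω, ‖∫ x, diagInv (fun ξ => 𝓕 (f : ℝ → ℂ) ξ.1 * 𝓕 (g : ℝ → ℂ) ξ.2 *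
      (cubeSum (G ω J) J ξ : ℂ)) x * h ω x‖ₑ ≤ _ := fun ω =>
    enorm_integral_diagInv_cubeSum_le hχ hχ' h₃ h₃' (hG0 ω) (goodSquares_succ hk₁ hk₂) J f g (hhi ω)
  refine (enorm_sum_le _ _).trans ((Finset.sum_le_sum fun ω _ => hterm ω).trans ?_)
  set V : ℤ × ℤ → Ω × ℕ × ℤ × ℤ → ℝ≥0∞ := fun i s => ∫⁻ x, ENNReal.ofReal
    (‖coef (χ i.1) f s.2.1 s.2.2.1 x‖ * ‖coef (χ i.2) g s.2.1 s.2.2.2 x‖ *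
      ‖coef χ₃ (h s.1) s.2.1 (-(s.2.2.1 + s.2.2.2)) x‖) with hV
  have e := sum_newCubes_eq (fun (ω : Ω) j => newCubes (G ω j) (G ω (j + 1)))
    (fun ω j z hz => (Finset.mem_product.mp (Finset.mem_filter.mp hz).1).2) J V
  refine e.le.trans ?_
  rw [Finset.sum_mul, ENNReal.ofReal_sum_of_nonneg fun i _ => mul_nonneg (hM0 i) hX0]
  refine Finset.sum_le_sum fun i _ => ?_
  have hS : ∀ s ∈ ((Finset.univ ×ˢ Finset.range J).sigma fun w : Ω × ℕ =>
        (newCubes (G w.1 w.2) (G w.1 (w.2 + 1))).filter fun z => z.2 = i).image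
          (fun w : (_ : Ω × ℕ) × ((ℤ × ℤ) × (ℤ × ℤ)) => (w.1.1, w.1.2 + 1, w.2.1)),
      ∃ j z, z ∈ newCubes (G s.1 j) (G s.1 (j + 1)) ∧ s.2 = (j + 1, z.1) := by
    intro s hs
    obtain ⟨⟨⟨ω, j⟩, z⟩, hz, rfl⟩ := Finset.mem_image.mp hs
    exact ⟨j, z, (Finset.mem_filter.mp (Finset.mem_sigma.mp hz).2).1, rfl⟩
  have hgood : ∀ s ∈ ((Finset.univ ×ˢ Finset.range J).sigma fun w : Ω × ℕ =>
        (newCubes (G w.1 w.2) (G w.1 (w.2 + 1))).filter fun z => z.2 = i).image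
          (fun w : (_ : Ω × ℕ) × ((ℤ × ℤ) × (ℤ × ℤ)) => (w.1.1, w.1.2 + 1, w.2.1)),
      GoodSquare K t₁ t₂ (a s.1.1.1) (b s.1.1.1) (c s.1.1.2) (d s.1.1.2) s.2.1 s.2.2 := by
    intro s hs
    obtain ⟨j, z, hz, hs2⟩ := hS s hs
    rw [hs2]
    exact mem_goodSquares.mp (Finset.mem_product.mp (Finset.mem_filter.mp hz).1).1
  refine hM i L₁ L₂ (a 0) (b 0) (c 0) (d 0) (fun ω => ω.1.1) (fun ω => ω.1.2) hL₁ hL₂ _ ?_ ?_ f g h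
    (f.memLp 2) (g.memLp 2) hh2 f.continuous.measurable g.continuous.measurable hhm hfp hgp hhp
  · intro s hs s' hs' hss
    have g1 := hgood s hs
    have g2 := hgood s' hs'
    rw [← hss] at g2
    exact Subtype.ext (Prod.ext
      (eq_of_mem_disjoint_strips hKpos hab (n := fun ω : Ω => ω.1.1) g1.1 g2.1)
      (eq_of_mem_disjoint_strips hKpos hcd (n := fun ω : Ω => ω.1.2) g1.2 g2.2))
  · intro s hs
    obtain ⟨j, z, hz, hs2⟩ := hS s hs
    rw [← ha, ← hb, ← hc, ← hd, hs2]
    exact edge_of_mem_newCubes hk₁ hk₂ hz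

lemma sum_norm_mul_rpow_sq {Ω : Type*} [Fintype Ω] (u : Ω → ℂ) {r : ℝ} (hr : 1 < r) :
    ∑ ω, ‖(starRingEnd ℂ) (u ω) * (((∑ ω, ‖u ω‖ ^ 2) ^ ((r - 2) / 2) : ℝ) : ℂ)‖ ^ 2 =
      (∑ ω, ‖u ω‖ ^ 2) ^ (r - 1) := by
  have hQ : 0 ≤ ∑ ω, ‖u ω‖ ^ 2 := by positivity
  simp only [norm_mul, RCLike.norm_conj, Complex.norm_real, norm_eq_abs, mul_pow, sq_abs]
  rw [← Finset.sum_mul]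
  generalize ∑ ω, ‖u ω‖ ^ 2 = Q at hQ
  rw [← rpow_natCast (Q ^ ((r - 2) / 2)), ← rpow_mul hQ]
  rcases hQ.eq_or_lt with rfl | h
  · rw [zero_mul, zero_rpow (by linarith)]
  · nth_rewrite 1 [← rpow_one Q]
    rw [← rpow_add h]
    congr 1
    push_cast
    ring

lemma sum_mul_conj_mul_rpow {Ω : Type*} [Fintype Ω] (u : Ω → ℂ) {r : ℝ} (hr : 1 < r) :
    ∑ ω, u ω * ((starRingEnd ℂ) (u ω) * (((∑ ω, ‖u ω‖ ^ 2) ^ ((r - 2) / 2) : ℝ) : ℂ)) =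
      (((∑ ω, ‖u ω‖ ^ 2) ^ (r / 2) : ℝ) : ℂ) := by
  have hQ : 0 ≤ ∑ ω, ‖u ω‖ ^ 2 := by positivity
  simp only [← mul_assoc, Complex.mul_conj']
  rw [← Finset.sum_mul]
  have e : ∑ ω, (‖u ω‖ : ℂ) ^ 2 = ((∑ ω, ‖u ω‖ ^ 2 : ℝ) : ℂ) := by push_cast; rfl
  rw [e]
  generalize ∑ ω, ‖u ω‖ ^ 2 = Q at hQ
  rw [← Complex.ofReal_mul]
  congr 1
  rcases hQ.eq_or_lt with rfl | h
  · rw [zero_mul, zero_rpow (by linarith)]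
  · nth_rewrite 1 [← rpow_one Q]
    rw [← rpow_add h]
    congr 1
    ring

/-- A vector-valued function is controlled by its pairings with the dual space. -/
lemma lintegral_le_of_forall_pairing {Ω : Type*} [Fintype Ω] {T : Ω → ℝ → ℂ}
    (hT : ∀ ω, Continuous (T ω)) {r s N : ℝ} (hr : 1 < r) (hs : s = r / (r - 1)) (hN : 0 ≤ N)
    (H : ∀ h : Ω → ℝ → ℂ, (∀ ω, Integrable (h ω)) → (∀ ω, MemLp (h ω) 2) →
      (∀ ω, Measurable (h ω)) → (Integrable fun y => (∑ ω, ‖h ω y‖ ^ 2) ^ (s / 2)) →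
      ‖∑ ω, ∫ x, T ω x * h ω x‖ₑ ≤
        ENNReal.ofReal (N * (∫ y, (∑ ω, ‖h ω y‖ ^ 2) ^ (s / 2)) ^ (1 / s))) :
    ∫⁻ x, ENNReal.ofReal ((∑ ω, ‖T ω x‖ ^ 2) ^ (r / 2)) ≤ ENNReal.ofReal (N ^ r) := by
  have hr1 : 0 < r - 1 := by linarith
  set Q : ℝ → ℝ := fun x => ∑ ω, ‖T ω x‖ ^ 2 with hQ
  have hQ0 : ∀ x, 0 ≤ Q x := fun x => by positivity
  have hQc : Continuous Q := by fun_prop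
  have hQr : ∀ e : ℝ, 0 ≤ e → Continuous fun x => Q x ^ e := fun e he =>
    hQc.rpow_const fun x => Or.inr he
  set v : Ω → ℝ → ℂ := fun ω x => (starRingEnd ℂ) (T ω x) * ((Q x ^ ((r - 2) / 2) : ℝ) : ℂ) with hv
  have hvm : ∀ ω, Measurable (v ω) := by
    intro ω
    have h1 : Measurable fun x => (starRingEnd ℂ) (T ω x) :=
      (Complex.continuous_conj.comp (hT ω)).measurable
    exact h1.mul (Complex.measurable_ofReal.comp (hQc.measurable.pow_const _))
  have hv2 : ∀ x, ∑ ω, ‖v ω x‖ ^ 2 = Q x ^ (r - 1) := fun x =>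
    sum_norm_mul_rpow_sq (fun ω => T ω x) hr
  have hvT : ∀ x, ∑ ω, T ω x * v ω x = ((Q x ^ (r / 2) : ℝ) : ℂ) := fun x =>
    sum_mul_conj_mul_rpow (fun ω => T ω x) hr
  have key : ∀ R : ℝ, ∫⁻ x in Icc (-R) R, ENNReal.ofReal (Q x ^ (r / 2)) ≤
      ENNReal.ofReal (N ^ r) := by
    intro R
    set B := Icc (-R) R with hB
    have hBm : MeasurableSet B := measurableSet_Icc
    obtain ⟨C, hC⟩ := isCompact_Icc.exists_bound_of_continuousOn (s := B)
      (hQr ((r - 1) / 2) (by linarith)).continuousOn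
    have hvb : ∀ ω, ∀ x ∈ B, ‖v ω x‖ ≤ C := by
      intro ω x hx
      refine le_trans ?_ ((le_abs_self _).trans (hC x hx))
      have h1 : ‖v ω x‖ ^ 2 ≤ Q x ^ (r - 1) := by
        rw [← hv2]
        exact Finset.single_le_sum (f := fun ω => ‖v ω x‖ ^ 2) (fun _ _ => by positivity)
          (Finset.mem_univ ω)
      refine abs_le_of_sq_le_sq' (h1.trans (le_of_eq ?_)) (by positivity) |>.2
      rw [← rpow_natCast, ← rpow_mul (hQ0 x)]
      congr 1
      push_cast
      ring
    have hmem : ∀ (ω) (e : ℝ≥0∞), MemLp (B.indicator (v ω)) e := by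
      intro ω e
      rw [memLp_indicator_iff_restrict hBm]
      exact MemLp.of_bound (hvm ω).aestronglyMeasurable C
        ((ae_restrict_iff' hBm).mpr (.of_forall (hvb ω)))
    have hsum : ∀ y, (∑ ω, ‖B.indicator (v ω) y‖ ^ 2) ^ (s / 2) =
        B.indicator (fun x => Q x ^ (r / 2)) y := by
      intro y
      by_cases hy : y ∈ B
      · simp only [indicator_of_mem hy]
        rw [hv2, ← rpow_mul (hQ0 y), hs]
        congr 1
        field_simp
      · simp only [indicator_of_notMem hy]
        have : s ≠ 0 := by rw [hs]; positivity
        simp [zero_rpow (div_ne_zero this two_ne_zero)]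
    have hQi : IntegrableOn (fun x => Q x ^ (r / 2)) B :=
      (hQr _ (by positivity)).continuousOn.integrableOn_compact isCompact_Icc
    set Z : ℝ := ∫ x in B, Q x ^ (r / 2) with hZ
    have hZ0 : 0 ≤ Z := setIntegral_nonneg hBm fun x _ => rpow_nonneg (hQ0 x) _
    have h1 := H (fun ω => B.indicator (v ω)) (fun ω => memLp_one_iff_integrable.mp (hmem ω 1))
      (fun ω => hmem ω 2) (fun ω => (hvm ω).indicator hBm)
      (by simp only [hsum]; exact hQi.integrable_indicator hBm)
    simp only [hsum] at h1
    rw [integral_indicator hBm, ← hZ] at h1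
    have hTi : ∀ ω, IntegrableOn (fun x => T ω x * v ω x) B := by
      intro ω
      have := (memLp_indicator_iff_restrict hBm).mp (hmem ω 1)
      obtain ⟨C', hC'⟩ := isCompact_Icc.exists_bound_of_continuousOn (s := B) (hT ω).continuousOn
      exact (this.integrable le_rfl).bdd_mul (hT ω).aestronglyMeasurable
        ((ae_restrict_iff' hBm).mpr (.of_forall hC'))
    have h2 : ∑ ω, ∫ x, T ω x * B.indicator (v ω) x = ((Z : ℝ) : ℂ) := by
      have e1 : ∀ ω x, T ω x * B.indicator (v ω) x = B.indicator (fun x => T ω x * v ω x) x := by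
        intro ω x
        by_cases hx : x ∈ B
        · simp only [indicator_of_mem hx]
        · simp only [indicator_of_notMem hx, mul_zero]
      simp only [e1, integral_indicator hBm]
      rw [← integral_finsetSum _ fun ω _ => hTi ω]
      simp only [hvT]
      exact integral_ofReal
    rw [h2, ← ofReal_norm, Complex.norm_real, norm_eq_abs, abs_of_nonneg hZ0,
      ENNReal.ofReal_le_ofReal_iff (by positivity)] at h1
    rw [← ofReal_integral_eq_lintegral_ofReal hQi (.of_forall fun x => rpow_nonneg (hQ0 x) _), ← hZ]
    refine ENNReal.ofReal_le_ofReal ?_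
    rcases hZ0.eq_or_lt with h0 | h0
    · rw [← h0]; positivity
    · have e2 : Z = Z ^ (1 / r) * Z ^ (1 / s) := by
        rw [← rpow_add h0, hs]
        nth_rewrite 1 [← rpow_one Z]
        congr 1
        field_simp
        ring
      nth_rewrite 1 [e2] at h1
      have h3 := le_of_mul_le_mul_right h1 (rpow_pos_of_pos h0 _)
      calc Z = (Z ^ (1 / r)) ^ r := by
            rw [← rpow_mul hZ0, one_div_mul_cancel (by linarith), rpow_one]
        _ ≤ N ^ r := rpow_le_rpow (by positivity) h3 (by linarith)
  refine le_of_tendsto' ((aecover_Icc (μ := volume) (a := fun n : ℕ => -(n : ℝ))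
    (b := fun n : ℕ => (n : ℝ)) (l := Filter.atTop)
    (Filter.tendsto_neg_atTop_atBot.comp tendsto_natCast_atTop_atTop)
    tendsto_natCast_atTop_atTop).lintegral_tendsto_of_countably_generated ?_) fun n => key n
  exact (hQc.measurable.pow_const _).ennreal_ofReal.aemeasurable

lemma lintegral_le_of_tendsto_of_forall_le {F : ℕ → ℝ → ℝ≥0∞} {F' : ℝ → ℝ≥0∞} {B : ℝ≥0∞}
    (hF : ∀ J, Measurable (F J))
    (hlim : ∀ x, Filter.Tendsto (fun J => F J x) Filter.atTop (nhds (F' x)))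
    (hB : ∀ J, ∫⁻ x, F J x ≤ B) : ∫⁻ x, F' x ≤ B := by
  have h := lintegral_liminf_le (μ := volume) (u := Filter.atTop) hF
  simp only [fun x => (hlim x).liminf_eq] at h
  exact h.trans (Filter.liminf_le_of_frequently_le' (.of_forall hB))

lemma enorm_sqrt_tsum_rpow_le {ι : Type*} (u : ι → ℂ) {r : ℝ} (hr : 0 < r) :
    ‖√(∑' i, ‖u i‖ ^ 2)‖ₑ ^ r ≤
      ⨆ S : Finset ι, ENNReal.ofReal ((∑ i ∈ S, ‖u i‖ ^ 2) ^ (r / 2)) := by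
  by_cases hs : Summable fun i => ‖u i‖ ^ 2
  · have h0 : 0 ≤ ∑' i, ‖u i‖ ^ 2 := tsum_nonneg fun _ => by positivity
    have e : ‖√(∑' i, ‖u i‖ ^ 2)‖ₑ ^ r = ENNReal.ofReal ((∑' i, ‖u i‖ ^ 2) ^ (r / 2)) := by
      rw [← ofReal_norm, norm_eq_abs, abs_of_nonneg (sqrt_nonneg _),
        ENNReal.ofReal_rpow_of_nonneg (sqrt_nonneg _) hr.le, sqrt_eq_rpow, ← rpow_mul h0]
      congr 2
      ring
    rw [e]
    have ht : Filter.Tendsto (fun S : Finset ι => ENNReal.ofReal ((∑ i ∈ S, ‖u i‖ ^ 2) ^ (r / 2)))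
        Filter.atTop (nhds (ENNReal.ofReal ((∑' i, ‖u i‖ ^ 2) ^ (r / 2)))) :=
      ENNReal.tendsto_ofReal (Filter.Tendsto.rpow_const hs.hasSum (Or.inr (by positivity)))
    exact le_of_tendsto' ht fun S =>
      le_iSup (fun S : Finset ι => ENNReal.ofReal ((∑ i ∈ S, ‖u i‖ ^ 2) ^ (r / 2))) S
  · rw [tsum_eq_zero_of_not_summable hs]
    simp [ENNReal.zero_rpow_of_pos hr]

lemma eLpNorm_sqrt_tsum_le {ι : Type*} [Countable ι] {T : ι → ℝ → ℂ} (hT : ∀ i, Continuous (T i))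
    {r N : ℝ} (hr : 0 < r) (hN : 0 ≤ N)
    (H : ∀ S : Finset ι, ∫⁻ x, ENNReal.ofReal ((∑ i ∈ S, ‖T i x‖ ^ 2) ^ (r / 2)) ≤
      ENNReal.ofReal (N ^ r)) :
    eLpNorm (fun x => √(∑' i, ‖T i x‖ ^ 2)) (ENNReal.ofReal r) volume ≤ ENNReal.ofReal N := by
  rw [eLpNorm_eq_lintegral_rpow_enorm_toReal (by simpa using hr) ENNReal.ofReal_ne_top,
    ENNReal.toReal_ofReal hr.le, one_div, ENNReal.rpow_inv_le_iff hr,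
    ENNReal.ofReal_rpow_of_nonneg hN hr.le]
  refine (lintegral_mono fun x => enorm_sqrt_tsum_rpow_le (fun i => T i x) hr).trans ?_
  rw [lintegral_iSup_directed]
  · exact iSup_le H
  · intro S
    have hc : Continuous fun x => ∑ i ∈ S, ‖T i x‖ ^ 2 := by fun_prop
    exact (hc.measurable.pow_const _).ennreal_ofReal.aemeasurable
  · classical
    intro S S'
    have hmono : ∀ {A B : Finset ι}, A ⊆ B → (fun x => ENNReal.ofReal ((∑ i ∈ A, ‖T i x‖ ^ 2) ^
        (r / 2))) ≤ fun x => ENNReal.ofReal ((∑ i ∈ B, ‖T i x‖ ^ 2) ^ (r / 2)) := by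
      intro A B hAB x
      refine ENNReal.ofReal_le_ofReal (rpow_le_rpow (by positivity) ?_ (by positivity))
      exact Finset.sum_le_sum_of_subset_of_nonneg hAB fun _ _ _ => by positivity
    exact ⟨S ∪ S', hmono Finset.subset_union_left, hmono Finset.subset_union_right⟩

lemma norm_sq_rpow_half (z : ℂ) (p : ℝ) : (‖z‖ ^ 2) ^ (p / 2) = ‖z‖ ^ p := by
  rw [← rpow_natCast, ← rpow_mul (norm_nonneg _)]
  congr 1
  push_cast
  ring

lemma SchwartzMap.integrable_norm_sq_rpow (f : 𝓢(ℝ, ℂ)) {p : ℝ} (hp : 0 < p) :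
    Integrable fun y => (‖f y‖ ^ 2) ^ (p / 2) := by
  simp only [norm_sq_rpow_half]
  have h := (f.memLp (ENNReal.ofReal p)).integrable_norm_rpow (by simpa using hp)
    ENNReal.ofReal_ne_top
  rwa [ENNReal.toReal_ofReal hp.le] at h

lemma SchwartzMap.eLpNorm_eq_ofReal (f : 𝓢(ℝ, ℂ)) {p : ℝ} (hp : 0 < p) :
    eLpNorm f (ENNReal.ofReal p) volume =
      ENNReal.ofReal ((∫ y, (‖f y‖ ^ 2) ^ (p / 2)) ^ (1 / p)) := by
  simp only [norm_sq_rpow_half]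
  have h : MemLp f (ENNReal.ofReal p) volume := f.memLp _
  rw [h.eLpNorm_eq_integral_rpow_norm (by simpa using hp)
    ENNReal.ofReal_ne_top, ENNReal.toReal_ofReal hp.le, one_div]

lemma measurableSet_strips (t₁ t₂ a b c d : ℝ) : MeasurableSet (strips t₁ t₂ a b c d) := by
  have h : ∀ t : ℝ, Measurable fun ξ : ℝ × ℝ => ξ.2 - t * ξ.1 := fun t => by fun_prop
  exact (((measurableSet_Ici (a := a)).preimage (h t₁)).inter
    (((measurableSet_Iic (a := b)).preimage (h t₁)).inter
      (((measurableSet_Ici (a := c)).preimage (h t₂)).inter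
        ((measurableSet_Iic (a := d)).preimage (h t₂)))))

lemma integrable_mul_indicator_one {A : ℝ × ℝ → ℂ} (hA : Integrable A) {B : Set (ℝ × ℝ)}
    (hB : MeasurableSet B) : Integrable fun ξ => A ξ * B.indicator 1 ξ := by
  have e : (fun ξ => A ξ * B.indicator 1 ξ) = B.indicator A := by
    funext ξ
    by_cases h : ξ ∈ B <;> simp [h]
  rw [e]
  exact hA.indicator hB

lemma SchwartzMap.integrable_fourier_coe (f : 𝓢(ℝ, ℂ)) : Integrable (𝓕 (f : ℝ → ℂ)) := by
  rw [← SchwartzMap.fourier_coe]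
  exact (𝓕 f).integrable

/-- The square function estimate for periodic families of parallelograms, at a fixed scale. -/
theorem exists_square_function_bound {t₁ t₂ : ℝ} (h₁₂ : t₁ ≠ t₂) (ht₁ : t₁ ≠ 0) (ht₁' : 1 + t₁ ≠ 0)
    (ht₂ : t₂ ≠ 0) (ht₂' : 1 + t₂ ≠ 0) {p q r : ℝ} (hp : 2 < p) (hq : 2 < q)
    (hr : 1 / r = 1 / p + 1 / q) (hr' : 2 < r / (r - 1)) :
    ∃ K : ℝ, 0 < K ∧ ∃ M : ℝ, 0 ≤ M ∧ ∀ (a b c d : ℤ → ℝ) (L₁ L₂ : ℝ), K ≤ L₁ → K ≤ L₂ →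
      (∀ n : ℤ, a n = a 0 + n * L₁) → (∀ n : ℤ, b n = b 0 + n * L₁) →
      (∀ n : ℤ, c n = c 0 + n * L₂) → (∀ n : ℤ, d n = d 0 + n * L₂) →
      (∀ n m, n < m → b n ≤ a m) → (∀ n m, n < m → d n ≤ c m) →
      (b 0 - a 0 < 2 * K ∨ d 0 - c 0 < 2 * K) → ∀ f g : 𝓢(ℝ, ℂ),
      eLpNorm (fun x => √(∑' nm : ℤ × ℤ, ‖diagInv (fun ξ => 𝓕 (f : ℝ → ℂ) ξ.1 * 𝓕 (g : ℝ → ℂ) ξ.2 *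
          (strips t₁ t₂ (a nm.1) (b nm.1) (c nm.2) (d nm.2)).indicator 1 ξ) x‖ ^ 2))
          (ENNReal.ofReal r) volume ≤
        ENNReal.ofReal M * eLpNorm f (ENNReal.ofReal p) volume *
          eLpNorm g (ENNReal.ofReal q) volume := by
  have hp0 : 0 < p := by linarith
  have hq0 : 0 < q := by linarith
  have hr0 : 0 < r := by
    have : 0 < 1 / r := by rw [hr]; positivity
    exact one_div_pos.mp this
  have hr1 : 1 < r := by
    have h1 : 1 / p < 1 / 2 := one_div_lt_one_div_of_lt two_pos hp
    have h2 : 1 / q < 1 / 2 := one_div_lt_one_div_of_lt two_pos hq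
    by_contra hn
    have := one_le_one_div hr0 (not_lt.mp hn)
    linarith
  obtain ⟨K, hK, hk₁, hk₂, H⟩ := exists_trilinear_bound h₁₂ ht₁ ht₁' ht₂ ht₂'
  have hP : ∀ i, 2 < (![p, q, r / (r - 1)] : Fin 3 → ℝ) i := by
    intro i
    fin_cases i
    · exact hp
    · exact hq
    · exact hr'
  have hP1 : 1 / (![p, q, r / (r - 1)] : Fin 3 → ℝ) 0 + 1 / (![p, q, r / (r - 1)] : Fin 3 → ℝ) 1 +
      1 / (![p, q, r / (r - 1)] : Fin 3 → ℝ) 2 = 1 := by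
    simp only [Matrix.cons_val]
    rw [← hr]
    have : r - 1 ≠ 0 := by linarith
    field_simp
    ring
  obtain ⟨M, hM0, hM⟩ := H hP hP1
  simp only [Matrix.cons_val] at hM
  refine ⟨K, hK, M, hM0, ?_⟩
  intro a b c d L₁ L₂ hL₁ hL₂ ha hb hc hd hab hcd hsmall f g
  set N : ℝ := M * ((∫ y, (‖f y‖ ^ 2) ^ (p / 2)) ^ (1 / p) *
    (∫ y, (‖g y‖ ^ 2) ^ (q / 2)) ^ (1 / q)) with hN
  have hN0 : 0 ≤ N := by positivity
  have hA : Integrable fun ξ : ℝ × ℝ => 𝓕 (f : ℝ → ℂ) ξ.1 * 𝓕 (g : ℝ → ℂ) ξ.2 :=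
    f.integrable_fourier_coe.mul_prod g.integrable_fourier_coe
  have hNN : ENNReal.ofReal M * eLpNorm f (ENNReal.ofReal p) volume *
      eLpNorm g (ENNReal.ofReal q) volume = ENNReal.ofReal N := by
    rw [f.eLpNorm_eq_ofReal hp0, g.eLpNorm_eq_ofReal hq0, mul_assoc,
      ← ENNReal.ofReal_mul (by positivity), ← ENNReal.ofReal_mul hM0]
  rw [hNN]
  have hAJ : ∀ (G : Finset (ℤ × ℤ)) (J : ℕ), Integrable fun ξ : ℝ × ℝ =>
      𝓕 (f : ℝ → ℂ) ξ.1 * 𝓕 (g : ℝ → ℂ) ξ.2 * (cubeSum G J ξ : ℂ) := by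
    intro G J
    refine hA.mul_bdd (c := 1)
      (Complex.continuous_ofReal.comp (continuous_cubeSum G J)).aestronglyMeasurable
      (.of_forall fun ξ => ?_)
    rw [Complex.norm_real, norm_eq_abs, abs_of_nonneg (cubeSum_nonneg _ _ _)]
    exact cubeSum_le_one _ _ _
  refine eLpNorm_sqrt_tsum_le (fun nm : ℤ × ℤ => continuous_diagInv
    (integrable_mul_indicator_one hA (measurableSet_strips _ _ _ _ _ _))) hr0 hN0 fun S => ?_
  set T : ℕ → S → ℝ → ℂ := fun J ω => diagInv fun ξ => 𝓕 (f : ℝ → ℂ) ξ.1 * 𝓕 (g : ℝ → ℂ) ξ.2 *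
    (cubeSum (goodSquares h₁₂ K (a ω.1.1) (b ω.1.1) (c ω.1.2) (d ω.1.2) J) J ξ : ℂ) with hT
  have hTc : ∀ J ω, Continuous (T J ω) := fun J ω => continuous_diagInv (hAJ _ _)
  refine lintegral_le_of_tendsto_of_forall_le
    (F := fun J x => ENNReal.ofReal ((∑ ω : S, ‖T J ω x‖ ^ 2) ^ (r / 2))) (fun J => ?_)
    (fun x => ?_) fun J => ?_
  · have hc : Continuous fun x => ∑ ω : S, ‖T J ω x‖ ^ 2 :=
      continuous_finsetSum _ fun ω _ => (hTc J ω).norm.pow 2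
    exact (hc.measurable.pow_const _).ennreal_ofReal
  · rw [← Finset.sum_coe_sort S]
    refine ENNReal.tendsto_ofReal (Filter.Tendsto.rpow_const ?_ (Or.inr (by positivity)))
    exact tendsto_finsetSum _ fun ω _ => (tendsto_diagInv_cubeSum h₁₂ hk₁ hk₂ hA x).norm.pow 2
  · refine lintegral_le_of_forall_pairing (hTc J) hr1 rfl hN0 fun h hi h2 hm hs => ?_
    have := hM a b c d L₁ L₂ hL₁ hL₂ ha hb hc hd hab hcd hsmall S J f g h hi h2 hm
      (f.integrable_norm_sq_rpow hp0) (g.integrable_norm_sq_rpow hq0) hs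
    rw [← mul_assoc] at this
    exact this

lemma eLpNorm_comp_mul_left {E : Type*} [NormedAddCommGroup E] (F : ℝ → E) {δ : ℝ} (hδ : 0 < δ)
    {p : ℝ} (hp : 0 < p) : eLpNorm (fun x => F (δ * x)) (ENNReal.ofReal p) volume =
      ENNReal.ofReal (δ⁻¹ ^ (1 / p)) * eLpNorm F (ENNReal.ofReal p) volume := by
  have he : MeasurableEmbedding fun x : ℝ => δ * x :=
    (Homeomorph.mulLeft₀ δ hδ.ne').measurableEmbedding
  have h := he.eLpNorm_map_measure (μ := volume) (g := F) (p := ENNReal.ofReal p)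
  rw [Real.map_volume_mul_left hδ.ne', eLpNorm_smul_measure_of_ne_top ENNReal.ofReal_ne_top,
    smul_eq_mul, abs_of_pos (inv_pos.mpr hδ), one_div, ENNReal.toReal_inv,
    ENNReal.toReal_ofReal hp.le, ENNReal.ofReal_rpow_of_nonneg (by positivity) (by positivity),
    ← one_div p] at h
  exact h.symm

lemma fourier_comp_mul_left (f : ℝ → ℂ) {δ : ℝ} (hδ : 0 < δ) (ξ : ℝ) :
    𝓕 (fun x => f (δ * x)) (δ * ξ) = (δ⁻¹ : ℝ) * 𝓕 f ξ := by
  rw [Real.fourier_real_eq_integral_exp_smul, Real.fourier_real_eq_integral_exp_smul]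
  have h := Measure.integral_comp_mul_left
    (fun y => Complex.exp (((-2 * π * y * ξ : ℝ) : ℂ) * Complex.I) • f y) δ
  rw [abs_of_pos (inv_pos.mpr hδ), Complex.real_smul] at h
  rw [← h]
  congr 1
  funext v
  rw [show -2 * π * v * (δ * ξ) = -2 * π * (δ * v) * ξ by ring]

/-- The composition of a Schwartz function with a dilation. -/
lemma SchwartzMap.exists_comp_mul_left (f : 𝓢(ℝ, ℂ)) {δ : ℝ} (hδ : 0 < δ) :
    ∃ F : 𝓢(ℝ, ℂ), (F : ℝ → ℂ) = fun x => f (δ * x) :=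
  ⟨SchwartzMap.compCLMOfContinuousLinearEquiv ℝ
    (ContinuousLinearEquiv.smulLeft (Units.mk0 δ hδ.ne') : ℝ ≃L[ℝ] ℝ) f, rfl⟩

lemma indicator_strips_dilate {δ : ℝ} (hδ : 0 < δ) (t₁ t₂ a b c d : ℝ) (ξ : ℝ × ℝ) :
    (strips t₁ t₂ (δ * a) (δ * b) (δ * c) (δ * d)).indicator (1 : ℝ × ℝ → ℂ) (δ • ξ) =
      (strips t₁ t₂ a b c d).indicator 1 ξ := by
  have e : δ • ξ ∈ strips t₁ t₂ (δ * a) (δ * b) (δ * c) (δ * d) ↔ ξ ∈ strips t₁ t₂ a b c d := by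
    have h1 : ∀ t : ℝ, (δ • ξ).2 - t * (δ • ξ).1 = δ * (ξ.2 - t * ξ.1) := fun t => by
      simp only [Prod.smul_fst, Prod.smul_snd, smul_eq_mul]; ring
    simp only [strips, Set.mem_ofPred_eq, h1, mul_le_mul_iff_right₀ hδ]
  by_cases h : ξ ∈ strips t₁ t₂ a b c d
  · rw [indicator_of_mem h, indicator_of_mem (e.mpr h)]; rfl
  · rw [indicator_of_notMem h, indicator_of_notMem (mt e.mp h)]

lemma diagInv_dilate (f g : ℝ → ℂ) {δ : ℝ} (hδ : 0 < δ) (t₁ t₂ a b c d x : ℝ) :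
    diagInv (fun ξ => 𝓕 (fun x => f (δ * x)) ξ.1 * 𝓕 (fun x => g (δ * x)) ξ.2 *
      (strips t₁ t₂ (δ * a) (δ * b) (δ * c) (δ * d)).indicator 1 ξ) x =
    diagInv (fun ξ => 𝓕 f ξ.1 * 𝓕 g ξ.2 * (strips t₁ t₂ a b c d).indicator 1 ξ) (δ * x) := by
  have h := Measure.integral_comp_smul (volume : Measure (ℝ × ℝ)) (fun ξ : ℝ × ℝ =>
    Complex.exp (((2 * π * x * (ξ.1 + ξ.2) : ℝ) : ℂ) * Complex.I) *
      (𝓕 (fun x => f (δ * x)) ξ.1 * 𝓕 (fun x => g (δ * x)) ξ.2 *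
        (strips t₁ t₂ (δ * a) (δ * b) (δ * c) (δ * d)).indicator 1 ξ)) δ
  have hfr : Module.finrank ℝ (ℝ × ℝ) = 2 := by simp
  have hδ' : (δ : ℂ) ≠ 0 := by exact_mod_cast hδ.ne'
  rw [hfr, abs_of_pos (by positivity), Complex.real_smul] at h
  have e : ∀ ξ : ℝ × ℝ, Complex.exp (((2 * π * x * ((δ • ξ).1 + (δ • ξ).2) : ℝ) : ℂ) * Complex.I) *
      (𝓕 (fun x => f (δ * x)) (δ • ξ).1 * 𝓕 (fun x => g (δ * x)) (δ • ξ).2 *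
        (strips t₁ t₂ (δ * a) (δ * b) (δ * c) (δ * d)).indicator 1 (δ • ξ)) =
      (((δ ^ 2)⁻¹ : ℝ) : ℂ) * (Complex.exp (((2 * π * (δ * x) * (ξ.1 + ξ.2) : ℝ) : ℂ) * Complex.I) *
        (𝓕 f ξ.1 * 𝓕 g ξ.2 * (strips t₁ t₂ a b c d).indicator 1 ξ)) := by
    intro ξ
    rw [indicator_strips_dilate hδ]
    simp only [Prod.smul_fst, Prod.smul_snd, smul_eq_mul]
    rw [fourier_comp_mul_left f hδ, fourier_comp_mul_left g hδ,
      show 2 * π * x * (δ * ξ.1 + δ * ξ.2) = 2 * π * (δ * x) * (ξ.1 + ξ.2) by ring]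
    push_cast
    field_simp
  simp only [e] at h
  rw [integral_const_mul] at h
  have hne : (((δ ^ 2)⁻¹ : ℝ) : ℂ) ≠ 0 := by
    exact_mod_cast (inv_pos.mpr (pow_pos hδ 2)).ne'
  exact (mul_left_cancel₀ hne h).symm

lemma biMul2_parallelogram_eq_diagInv (θ₁ θ₂ a b c d : ℝ) (f g : ℝ → ℂ) (x : ℝ) :
    biMul2 (parallelogram θ₁ θ₂ a b c d) f g x = diagInv (fun ξ => 𝓕 f ξ.1 * 𝓕 g ξ.2 *
      (strips (tan θ₁) (tan θ₂) a b c d).indicator 1 ξ) x := by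
  have hFT : ∀ f : ℝ → ℂ, FT f = 𝓕 f := by
    intro f
    funext ξ
    rw [Real.fourier_real_eq_integral_exp_smul]
    rfl
  rw [biMul2, diagInv, hFT, hFT]
  simp only [mul_assoc]
  rfl

lemma eq_add_int_mul {a b : ℤ → ℝ} (h₁ : ∀ n, b n - a n = b 0 - a 0)
    (h₂ : ∀ n, a (n + 1) - b n = a 1 - b 0) (n : ℤ) : a n = a 0 + n * (a 1 - a 0) := by
  have hs : ∀ n, a (n + 1) = a n + (a 1 - a 0) := fun n => by linarith [h₁ n, h₂ n]
  induction n using Int.induction_on with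
  | zero => simp
  | succ n ih => rw [hs, ih]; push_cast; ring
  | pred n ih =>
    have := hs (-n - 1)
    rw [sub_add_cancel, ih] at this
    push_cast at this ⊢
    linarith

lemma le_of_lt_of_periodic {a b : ℤ → ℝ} {L : ℝ} (hL : 0 ≤ L) (ha : ∀ n, a n = a 0 + n * L)
    (hab : ∀ n, b n ≤ a (n + 1)) (n m : ℤ) (h : n < m) : b n ≤ a m := by
  refine (hab n).trans ?_
  rw [ha, ha m]
  have : ((n + 1 : ℤ) : ℝ) ≤ m := by exact_mod_cast h
  have := mul_le_mul_of_nonneg_right this hL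
  linarith

/-- The square function estimate for periodic families of parallelograms. -/
theorem exists_square_function_bound_of_periodic {t₁ t₂ : ℝ} (h₁₂ : t₁ ≠ t₂) (ht₁ : t₁ ≠ 0)
    (ht₁' : 1 + t₁ ≠ 0) (ht₂ : t₂ ≠ 0) (ht₂' : 1 + t₂ ≠ 0) {p q r : ℝ} (hp : 2 < p) (hq : 2 < q)
    (hr : 1 / r = 1 / p + 1 / q) (hr' : 2 < r / (r - 1)) :
    ∃ M : ℝ, 0 ≤ M ∧ ∀ (a b c d : ℤ → ℝ) (L₁ L₂ : ℝ), 0 < L₁ → 0 < L₂ →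
      (∀ n : ℤ, a n = a 0 + n * L₁) → (∀ n : ℤ, b n = b 0 + n * L₁) →
      (∀ n : ℤ, c n = c 0 + n * L₂) → (∀ n : ℤ, d n = d 0 + n * L₂) →
      (∀ n, b n ≤ a (n + 1)) → (∀ n, d n ≤ c (n + 1)) → ∀ f g : 𝓢(ℝ, ℂ),
      eLpNorm (fun x => √(∑' nm : ℤ × ℤ, ‖diagInv (fun ξ => 𝓕 (f : ℝ → ℂ) ξ.1 * 𝓕 (g : ℝ → ℂ) ξ.2 *
          (strips t₁ t₂ (a nm.1) (b nm.1) (c nm.2) (d nm.2)).indicator 1 ξ) x‖ ^ 2))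
          (ENNReal.ofReal r) volume ≤
        ENNReal.ofReal M * eLpNorm f (ENNReal.ofReal p) volume *
          eLpNorm g (ENNReal.ofReal q) volume := by
  have hp0 : 0 < p := by linarith
  have hq0 : 0 < q := by linarith
  have hr0 : 0 < r := by
    have : 0 < 1 / r := by rw [hr]; positivity
    exact one_div_pos.mp this
  obtain ⟨K, hK, M, hM0, H⟩ := exists_square_function_bound h₁₂ ht₁ ht₁' ht₂ ht₂' hp hq hr hr'
  refine ⟨M, hM0, ?_⟩
  intro a b c d L₁ L₂ hL₁ hL₂ ha hb hc hd hab hcd f g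
  have hmin : 0 < min L₁ L₂ := lt_min hL₁ hL₂
  set δ : ℝ := K / min L₁ L₂ with hδdef
  have hδ : 0 < δ := div_pos hK hmin
  have hδm : δ * min L₁ L₂ = K := div_mul_cancel₀ _ hmin.ne'
  obtain ⟨F, hF⟩ := f.exists_comp_mul_left hδ
  obtain ⟨G, hG⟩ := g.exists_comp_mul_left hδ
  have hper : ∀ {e : ℤ → ℝ} {L : ℝ}, (∀ n : ℤ, e n = e 0 + n * L) →
      ∀ n : ℤ, δ * e n = δ * e 0 + n * (δ * L) := by
    intro e L he n
    rw [he n]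
    ring
  have hdis : ∀ {e e' : ℤ → ℝ} {L : ℝ}, 0 < L → (∀ n : ℤ, e n = e 0 + n * L) →
      (∀ n, e' n ≤ e (n + 1)) → ∀ n m, n < m → δ * e' n ≤ δ * e m := fun hL he hee' n m h =>
    mul_le_mul_of_nonneg_left (le_of_lt_of_periodic hL.le he hee' n m h) hδ.le
  have hgap : ∀ {e e' : ℤ → ℝ} {L : ℝ}, (∀ n : ℤ, e n = e 0 + n * L) →
      (∀ n, e' n ≤ e (n + 1)) → min L₁ L₂ = L → δ * e' 0 - δ * e 0 < 2 * K := by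
    intro e e' L he hee' hL
    have h1 := hee' 0
    rw [he] at h1
    push_cast at h1
    have h2 := mul_le_mul_of_nonneg_left h1 hδ.le
    rw [hL] at hδm
    nlinarith
  have hmain := H (fun n => δ * a n) (fun n => δ * b n) (fun n => δ * c n) (fun n => δ * d n)
    (δ * L₁) (δ * L₂) (hδm.symm.le.trans (mul_le_mul_of_nonneg_left (min_le_left _ _) hδ.le))
    (hδm.symm.le.trans (mul_le_mul_of_nonneg_left (min_le_right _ _) hδ.le))
    (hper ha) (hper hb) (hper hc) (hper hd) (hdis hL₁ ha hab) (hdis hL₂ hc hcd)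
    ((min_choice L₁ L₂).imp (hgap ha hab) (hgap hc hcd)) F G
  rw [hF, hG] at hmain
  simp only [diagInv_dilate _ _ hδ] at hmain
  rw [eLpNorm_comp_mul_left (fun x => √(∑' nm : ℤ × ℤ, ‖diagInv (fun ξ => 𝓕 (f : ℝ → ℂ) ξ.1 *
      𝓕 (g : ℝ → ℂ) ξ.2 * (strips t₁ t₂ (a nm.1) (b nm.1) (c nm.2) (d nm.2)).indicator 1 ξ) x‖ ^ 2))
    hδ hr0, eLpNorm_comp_mul_left f hδ hp0, eLpNorm_comp_mul_left g hδ hq0, hr,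
    rpow_add (inv_pos.mpr hδ), ENNReal.ofReal_mul (by positivity)] at hmain
  set u := ENNReal.ofReal (δ⁻¹ ^ (1 / p)) with hu
  set v := ENNReal.ofReal (δ⁻¹ ^ (1 / q)) with hv
  have huv0 : u * v ≠ 0 := by
    refine mul_ne_zero ?_ ?_ <;> exact (ENNReal.ofReal_pos.mpr (by positivity)).ne'
  have huvt : u * v ≠ ⊤ := ENNReal.mul_ne_top ENNReal.ofReal_ne_top ENNReal.ofReal_ne_top
  refine (ENNReal.mul_le_mul_iff_right huv0 huvt).mp (hmain.trans (le_of_eq ?_))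
  ring

/-- **square function for parallelograms.** For `2 < p, q, r' < ∞` with
`1/r = 1/p + 1/q` and two non-degenerate distinct angles, the square function
associated to a doubly-indexed family of translated parallelograms `C_{n,m}`
maps `L^p × L^q` into `L^r`. -/
theorem bilinear_square_function_parallelograms
    (p q r : ℝ) (hp : 2 < p) (hq : 2 < q)
    (hr : 1 / r = 1 / p + 1 / q) (hr' : 2 < r / (r - 1))
    (θ₁ θ₂ : ℝ)
    (hθ₁ : θ₁ ∈ Set.Ioo (-(Real.pi / 2)) (Real.pi / 2)) (hθ₁0 : θ₁ ≠ 0)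
    (hθ₁4 : θ₁ ≠ -(Real.pi / 4))
    (hθ₂ : θ₂ ∈ Set.Ioo (-(Real.pi / 2)) (Real.pi / 2)) (hθ₂0 : θ₂ ≠ 0)
    (hθ₂4 : θ₂ ≠ -(Real.pi / 4))
    (hθ : θ₁ ≠ θ₂) :
    ∃ C : ℝ, 0 < C ∧ ∀ a b c d : ℤ → ℝ,
      (∀ n : ℤ, a n < b n) → (∀ n : ℤ, b n ≤ a (n + 1)) →
      (∀ n : ℤ, c n < d n) → (∀ n : ℤ, d n ≤ c (n + 1)) →
      (∀ n : ℤ, b n - a n = b 0 - a 0) →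
      (∀ n : ℤ, a (n + 1) - b n = a 1 - b 0) →
      (∀ n : ℤ, d n - c n = d 0 - c 0) →
      (∀ n : ℤ, c (n + 1) - d n = c 1 - d 0) →
      ∀ f g : SchwartzMap ℝ ℂ,
        eLpNorm (fun x : ℝ =>
            Real.sqrt (∑' nm : ℤ × ℤ,
              ‖biMul2 (parallelogram θ₁ θ₂ (a nm.1) (b nm.1) (c nm.2) (d nm.2))
                (⇑f) (⇑g) x‖ ^ 2))
            (ENNReal.ofReal r) volume ≤
          ENNReal.ofReal C * eLpNorm (⇑f) (ENNReal.ofReal p) volume *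
            eLpNorm (⇑g) (ENNReal.ofReal q) volume := by
  have h0 : (0 : ℝ) ∈ Ioo (-(π / 2)) (π / 2) := by constructor <;> linarith [pi_pos]
  have h4 : -(π / 4) ∈ Ioo (-(π / 2)) (π / 2) := by constructor <;> linarith [pi_pos]
  have htan0 : ∀ {θ : ℝ}, θ ∈ Ioo (-(π / 2)) (π / 2) → θ ≠ 0 → tan θ ≠ 0 := fun hθ hne h =>
    hne (Real.injOn_tan hθ h0 (h.trans tan_zero.symm))
  have htan4 : ∀ {θ : ℝ}, θ ∈ Ioo (-(π / 2)) (π / 2) → θ ≠ -(π / 4) → 1 + tan θ ≠ 0 :=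
    fun hθ hne h => hne (Real.injOn_tan hθ h4 (by rw [tan_neg, tan_pi_div_four]; linarith))
  obtain ⟨M, hM0, hM⟩ := exists_square_function_bound_of_periodic
    (fun h => hθ (Real.injOn_tan hθ₁ hθ₂ h)) (htan0 hθ₁ hθ₁0) (htan4 hθ₁ hθ₁4) (htan0 hθ₂ hθ₂0)
    (htan4 hθ₂ hθ₂4) hp hq hr hr'
  refine ⟨M + 1, by linarith, ?_⟩
  intro a b c d hab hba hcd hdc h1 h2 h3 h4 f g
  simp only [biMul2_parallelogram_eq_diagInv]
  have hp1 : ∀ {a b : ℤ → ℝ}, (∀ n, a n < b n) → (∀ n, b n ≤ a (n + 1)) → 0 < a 1 - a 0 :=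
    fun h h' => by
      have := h' 0
      rw [zero_add] at this
      linarith [h 0]
  have ha := eq_add_int_mul h1 h2
  have hc := eq_add_int_mul h3 h4
  refine (hM a b c d (a 1 - a 0) (c 1 - c 0) (hp1 hab hba) (hp1 hcd hdc) ha
    (fun n => by linarith [h1 n, ha n]) hc (fun n => by linarith [h3 n, hc n]) hba hdc f g).trans ?_
  gcongr
  linarith
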